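/- arXiv:2207.03869 — 2 statements merged into one kernel-verified Lean document; each statement's English description precedes it below -/
import Mathlib

section
/- If G is a finite simple graph with maximum degree Δ ≥ 5 that is (Δ+1)-list-edge-critical, then 2·|V₃| + 2·|V₄| < |V_{Δ−1}| + 2·|V_Δ|. -/
open scoped Classical

/-- A proper edge-coloring of `G` from the lists `L`: every edge receives a color
from its list, and distinct edges sharing a vertex receive distinct colors. -/
def IsProperListEdgeColoring {V : Type*} (G : SimpleGraph V)
    (L : Sym2 V → Finset ℕ) (f : Sym2 V → ℕ) : Prop :=
  (∀ e ∈ G.edgeSet, f e ∈ L e) ∧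
    ∀ e₁ ∈ G.edgeSet, ∀ e₂ ∈ G.edgeSet, e₁ ≠ e₂ → (∃ v, v ∈ e₁ ∧ v ∈ e₂) →
      f e₁ ≠ f e₂

/-- `G` is `k`-list-edge-colorable: for every edge-list-assignment `L` with all
lists of size at least `k`, `G` has a proper edge-coloring from the lists. -/
def ListEdgeColorable {V : Type*} (G : SimpleGraph V) (k : ℕ) : Prop :=
  ∀ L : Sym2 V → Finset ℕ, (∀ e ∈ G.edgeSet, k ≤ (L e).card) →
    ∃ f : Sym2 V → ℕ, IsProperListEdgeColoring G L f

/-- The list-chromatic index: the least `k` such that `G` is `k`-list-edge-colorable. -/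
noncomputable def listChromaticIndex {V : Type*} (G : SimpleGraph V) : ℕ :=
  sInf {k | ListEdgeColorable G k}

/-- `G` is `k`-list-edge-critical: `χ'ₗ(G) > k` and `χ'ₗ(G - e) ≤ k` for every edge `e`. -/
def ListEdgeCritical {V : Type*} (G : SimpleGraph V) (k : ℕ) : Prop :=
  k < listChromaticIndex G ∧
    ∀ e ∈ G.edgeSet, listChromaticIndex (G.deleteEdges {e}) ≤ k

/-- A preference structure on the edges of a bipartite multigraph has a kernel. -/
theorem exists_kernel {E S T R : Type*} [LinearOrder R] (src : E → S) (tgt : E → T)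
    (ra rb : E → R) (hra : Function.Injective ra) (hrb : Function.Injective rb)
    (H : Finset E) : ∃ K ⊆ H,
      (∀ e ∈ K, ∀ e' ∈ K, e ≠ e' → src e ≠ src e' ∧ tgt e ≠ tgt e') ∧
      ∀ e ∈ H, e ∉ K → ∃ e' ∈ K,
        (src e' = src e ∧ ra e' < ra e) ∨ (tgt e' = tgt e ∧ rb e' < rb e) := by
  induction H using Finset.strongInduction with
  | H H ih =>
    by_cases hT : ∃ e₁ ∈ H, ∃ e₂ ∈ H, (∀ e' ∈ H, src e' = src e₁ → ra e₁ ≤ ra e') ∧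
        tgt e₁ = tgt e₂ ∧ rb e₁ < rb e₂
    · obtain ⟨e₁, h₁, e₂, h₂, hb₁, ht, hlt⟩ := hT
      obtain ⟨K, hKH, hK, hdom⟩ := ih (H.erase e₂) (Finset.erase_ssubset h₂)
      refine ⟨K, hKH.trans (Finset.erase_subset _ _), hK, fun e he heK => ?_⟩
      by_cases hee : e = e₂
      · subst hee
        by_cases h1K : e₁ ∈ K
        · exact ⟨e₁, h1K, Or.inr ⟨ht, hlt⟩⟩
        · have hne : e₁ ≠ e := by rintro rfl; exact lt_irrefl _ hlt
          obtain ⟨e', he'K, h | h⟩ := hdom e₁ (Finset.mem_erase.2 ⟨hne, h₁⟩) h1K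
          · exact absurd h.2 (not_lt.2 (hb₁ e' (Finset.mem_of_mem_erase (hKH he'K)) h.1))
          · exact ⟨e', he'K, Or.inr ⟨h.1.trans ht, h.2.trans hlt⟩⟩
      · exact hdom e (Finset.mem_erase.2 ⟨hee, he⟩) heK
    · push Not at hT
      refine ⟨H.filter fun e => ∀ e' ∈ H, src e' = src e → ra e ≤ ra e',
        Finset.filter_subset _ _, ?_, ?_⟩
      · intro e he e' he' hne
        rw [Finset.mem_filter] at he he'
        refine ⟨fun hs => hne (hra (le_antisymm (he.2 e' he'.1 hs.symm) (he'.2 e he.1 hs))),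
          fun ht => hne (hrb (le_antisymm (hT e' he'.1 e he.1 he'.2 ht.symm)
            (hT e he.1 e' he'.1 he.2 ht)))⟩
      · intro e he heK
        obtain ⟨m, hm, hmin⟩ := Finset.exists_min_image (H.filter fun e' => src e' = src e) ra
          ⟨e, by simp [he]⟩
        rw [Finset.mem_filter] at hm
        have hmK : ∀ e' ∈ H, src e' = src m → ra m ≤ ra e' := fun e' he' hs =>
          hmin e' (Finset.mem_filter.2 ⟨he', hs.trans hm.2⟩)
        refine ⟨m, Finset.mem_filter.2 ⟨hm.1, hmK⟩, Or.inl ⟨hm.2, ?_⟩⟩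
        refine lt_of_le_of_ne (hmin e (by simp [he])) fun h => heK ?_
        rw [← hra h]
        exact Finset.mem_filter.2 ⟨hm.1, hmK⟩

/-- Galvin's theorem: lists longer than the number of preferred competitors suffice. -/
theorem exists_galvin_coloring {E S T R : Type*} [LinearOrder R] (src : E → S) (tgt : E → T)
    (ra rb : E → R) (hra : Function.Injective ra) (hrb : Function.Injective rb)
    (H : Finset E) : ∀ A : E → Finset ℕ,
      (∀ e ∈ H, (H.filter fun e' => (src e' = src e ∧ ra e' < ra e) ∨
        (tgt e' = tgt e ∧ rb e' < rb e)).card < (A e).card) →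
      ∃ f : E → ℕ, (∀ e ∈ H, f e ∈ A e) ∧ ∀ e ∈ H, ∀ e' ∈ H, e ≠ e' →
        (src e = src e' ∨ tgt e = tgt e') → f e ≠ f e' := by
  induction H using Finset.strongInduction with
  | H H ih =>
    intro A hA
    rcases H.eq_empty_or_nonempty with rfl | ⟨e₀, he₀⟩
    · exact ⟨fun _ => 0, by simp, by simp⟩
    obtain ⟨α, hα⟩ : (A e₀).Nonempty := Finset.card_pos.1 (lt_of_le_of_lt (Nat.zero_le _) (hA e₀ he₀))
    obtain ⟨K, hKH, hK, hdom⟩ := exists_kernel src tgt ra rb hra hrb (H.filter fun e => α ∈ A e)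
    have hKH' : K ⊆ H := hKH.trans (Finset.filter_subset _ _)
    have hKne : K.Nonempty := by
      by_cases h : e₀ ∈ K
      · exact ⟨_, h⟩
      · obtain ⟨e', he', -⟩ := hdom e₀ (Finset.mem_filter.2 ⟨he₀, hα⟩) h
        exact ⟨_, he'⟩
    obtain ⟨f, hf, hfp⟩ := ih (H \ K) (Finset.sdiff_ssubset hKH' hKne) (fun e => (A e).erase α) (by
      intro e he
      rw [Finset.mem_sdiff] at he
      by_cases hαe : α ∈ A e
      · rw [Finset.card_erase_of_mem hαe]
        obtain ⟨e', he'K, h⟩ := hdom e (Finset.mem_filter.2 ⟨he.1, hαe⟩) he.2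
        have := hA e he.1
        refine lt_of_lt_of_le (Finset.card_lt_card ?_) (Nat.le_sub_one_of_lt this)
        rw [Finset.ssubset_iff_of_subset
          (Finset.filter_subset_filter _ Finset.sdiff_subset)]
        exact ⟨e', Finset.mem_filter.2 ⟨hKH' he'K, h⟩, by simp [he'K]⟩
      · rw [Finset.erase_eq_of_notMem hαe]
        exact lt_of_le_of_lt (Finset.card_le_card
          (Finset.filter_subset_filter _ Finset.sdiff_subset)) (hA e he.1))
    have hKα : ∀ e ∈ K, α ∈ A e := fun e he => (Finset.mem_filter.1 (hKH he)).2
    refine ⟨fun e => if e ∈ K then α else f e, fun e he => ?_, fun e he e' he' hne hs => ?_⟩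
    · dsimp only
      split_ifs with h
      · exact hKα e h
      · exact Finset.mem_of_mem_erase (hf e (Finset.mem_sdiff.2 ⟨he, h⟩))
    · dsimp only
      split_ifs with h h' h'
      · have := hK e h e' h' hne
        tauto
      · exact (Finset.ne_of_mem_erase (hf e' (Finset.mem_sdiff.2 ⟨he', h'⟩))).symm
      · exact Finset.ne_of_mem_erase (hf e (Finset.mem_sdiff.2 ⟨he, h⟩))
      · exact hfp e (Finset.mem_sdiff.2 ⟨he, h⟩) e' (Finset.mem_sdiff.2 ⟨he', h'⟩) hne hs


/-- Two distinct edges are in conflict when they share a vertex. -/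
def EdgeConflict {V : Type*} (e e' : Sym2 V) : Prop := e ≠ e' ∧ ∃ v, v ∈ e ∧ v ∈ e'

theorem EdgeConflict.symm {V : Type*} {e e' : Sym2 V} (h : EdgeConflict e e') :
    EdgeConflict e' e :=
  ⟨h.1.symm, h.2.imp fun _ hv => hv.symm⟩

/-- The number of edges of `H` in conflict with `e`. -/
noncomputable def lineDeg {V : Type*} (H : Finset (Sym2 V)) (e : Sym2 V) : ℕ :=
  (H.filter (EdgeConflict e)).card

/-- `f` properly colors the edges in `H` from the lists `A`. -/
def IsListColoring {V : Type*} (H : Finset (Sym2 V)) (A : Sym2 V → Finset ℕ)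
    (f : Sym2 V → ℕ) : Prop :=
  (∀ e ∈ H, f e ∈ A e) ∧ ∀ e ∈ H, ∀ e' ∈ H, EdgeConflict e e' → f e ≠ f e'

/-- `H` can be colored from all lists whose sizes exceed the line degrees by the slack `ξ`. -/
def Choosable {V : Type*} (H : Finset (Sym2 V)) (ξ : Sym2 V → ℤ) : Prop :=
  ∀ A : Sym2 V → Finset ℕ, (∀ e ∈ H, (lineDeg H e : ℤ) + ξ e ≤ (A e).card) →
    ∃ f, IsListColoring H A f

/-- The colors remaining for `e` once the edges of `Q` are colored by `f`. -/
noncomputable def residualList {V : Type*} (Q : Finset (Sym2 V)) (f : Sym2 V → ℕ)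
    (A : Sym2 V → Finset ℕ) (e : Sym2 V) : Finset ℕ :=
  A e \ (Q.filter (EdgeConflict e)).image f

section
variable {V : Type*}

theorem lineDeg_mono {H H' : Finset (Sym2 V)} (h : H ⊆ H') (e : Sym2 V) :
    lineDeg H e ≤ lineDeg H' e :=
  Finset.card_le_card (Finset.filter_subset_filter _ h)

theorem lineDeg_add_lineDeg_sdiff {Q H : Finset (Sym2 V)} (h : Q ⊆ H) (e : Sym2 V) :
    lineDeg Q e + lineDeg (H \ Q) e = lineDeg H e := by
  unfold lineDeg
  rw [← Finset.card_union_of_disjoint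
    (Finset.disjoint_filter_filter Finset.disjoint_sdiff), ← Finset.filter_union,
    Finset.union_sdiff_of_subset h]

theorem card_le_card_residualList_add (Q : Finset (Sym2 V)) (f : Sym2 V → ℕ)
    (A : Sym2 V → Finset ℕ) (e : Sym2 V) :
    (A e).card ≤ (residualList Q f A e).card + lineDeg Q e := by
  have h1 := Finset.le_card_sdiff ((Q.filter (EdgeConflict e)).image f) (A e)
  have h2 : ((Q.filter (EdgeConflict e)).image f).card ≤ lineDeg Q e := Finset.card_image_le
  unfold residualList
  omega

theorem IsListColoring.extend {Q H : Finset (Sym2 V)} {A : Sym2 V → Finset ℕ}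
    {f g : Sym2 V → ℕ} (hf : IsListColoring Q A f)
    (hg : IsListColoring (H \ Q) (residualList Q f A) g) : ∃ h, IsListColoring H A h := by
  refine ⟨fun e => if e ∈ Q then f e else g e, fun e he => ?_, fun e he e' he' hc => ?_⟩
  · dsimp only
    split_ifs with h
    · exact hf.1 e h
    · exact (Finset.mem_sdiff.1 (hg.1 e (Finset.mem_sdiff.2 ⟨he, h⟩))).1
  · have key : ∀ e ∈ H, ∀ e' ∈ Q, EdgeConflict e e' → e ∉ Q → g e ≠ f e' := by
      intro e he e' he' hc h heq
      refine (Finset.mem_sdiff.1 (hg.1 e (Finset.mem_sdiff.2 ⟨he, h⟩))).2 ?_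
      exact Finset.mem_image.2 ⟨e', Finset.mem_filter.2 ⟨he', hc⟩, heq.symm⟩
    dsimp only
    split_ifs with h h' h'
    · exact hf.2 e h e' h' hc
    · exact (key e' he' e h hc.symm h').symm
    · exact key e he e' h' hc h
    · exact hg.2 e (Finset.mem_sdiff.2 ⟨he, h⟩) e' (Finset.mem_sdiff.2 ⟨he', h'⟩) hc

theorem IsListColoring.extend_of_choosable {Q H : Finset (Sym2 V)} (hQH : Q ⊆ H)
    {A : Sym2 V → Finset ℕ} {ξ : Sym2 V → ℤ} {f : Sym2 V → ℕ} (hf : IsListColoring Q A f)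
    (hc : Choosable (H \ Q) ξ)
    (hA : ∀ e ∈ H, e ∉ Q → (lineDeg H e : ℤ) + ξ e ≤ (A e).card) :
    ∃ h, IsListColoring H A h := by
  obtain ⟨g, hg⟩ := hc (residualList Q f A) fun e he => by
    rw [Finset.mem_sdiff] at he
    have := hA e he.1 he.2
    have := lineDeg_add_lineDeg_sdiff hQH e
    have := card_le_card_residualList_add Q f A e
    omega
  exact hf.extend hg

theorem choosable_of_rank (ξ : Sym2 V → ℤ) (r : Sym2 V → ℕ) (J : Finset (Sym2 V))
    (h0 : ∀ e ∈ J, 0 ≤ ξ e)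
    (hr : ∀ e ∈ J, 1 ≤ ξ e ∨ ∃ e' ∈ J, EdgeConflict e e' ∧ r e' < r e) : Choosable J ξ := by
  induction J using Finset.strongInduction with
  | H J ih =>
    intro A hA
    rcases J.eq_empty_or_nonempty with rfl | hJ
    · exact ⟨fun _ => 0, by simp [IsListColoring]⟩
    obtain ⟨m, hm, hmax⟩ := Finset.exists_max_image J r hJ
    have hpos : (A m).Nonempty := by
      rw [← Finset.card_pos]
      have h1 := hA m hm
      have h2 := h0 m hm
      rcases hr m hm with h | ⟨e', he', hc, -⟩
      · omega
      · have : 0 < lineDeg J m := Finset.card_pos.2 ⟨e', Finset.mem_filter.2 ⟨he', hc⟩⟩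
        omega
    obtain ⟨α, hα⟩ := hpos
    have hQ : IsListColoring {m} A fun _ => α := by
      refine ⟨by simpa using hα, fun e he e' he' hc => ?_⟩
      rw [Finset.mem_singleton] at he he'
      exact absurd (he.trans he'.symm) hc.1
    refine hQ.extend_of_choosable (ξ := ξ) (by simpa using hm)
      (ih _ (Finset.sdiff_ssubset (by simpa using hm) (by simp)) ?_ ?_) fun e he _ => hA e he
    · exact fun e he => h0 e (Finset.mem_sdiff.1 he).1
    · intro e he
      rw [Finset.mem_sdiff] at he
      refine (hr e he.1).imp_right ?_
      rintro ⟨e', he', hc, hlt⟩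
      refine ⟨e', Finset.mem_sdiff.2 ⟨he', ?_⟩, hc, hlt⟩
      rw [Finset.mem_singleton]
      rintro rfl
      exact absurd (hmax e he.1) (not_le.2 hlt)

/-- The edges of `H` leaving the vertex set `Z`. -/
noncomputable def boundaryEdges (H : Finset (Sym2 V)) (Z : Finset V) : Finset (Sym2 V) :=
  H.filter fun e => ∃ u ∈ Z, ∃ v ∉ Z, e = s(u, v)

theorem mem_boundaryEdges {H : Finset (Sym2 V)} {Z : Finset V} {e : Sym2 V} :
    e ∈ boundaryEdges H Z ↔ e ∈ H ∧ ∃ u ∈ Z, ∃ v ∉ Z, e = s(u, v) :=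
  Finset.mem_filter

theorem boundary_repr_unique {Z : Finset V} {u v u' v' : V} (hv : v ∉ Z)
    (hu' : u' ∈ Z) (h : s(u, v) = s(u', v')) : u = u' ∧ v = v' := by
  rw [Sym2.eq_iff] at h
  rcases h with h | ⟨rfl, rfl⟩
  · exact h
  · contradiction

theorem choosable_of_boundary [Fintype V] (Z : Finset V) (H : Finset (Sym2 V)) (ξ : Sym2 V → ℤ)
    (ca cb : V → V → ℕ)
    (hD : ∀ u ∈ Z, ∀ v ∉ Z, s(u, v) ∈ H → ∃ D ⊆ H, 1 ≤ (D.card : ℤ) + ξ s(u, v) ∧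
      ∀ e' ∈ D, EdgeConflict s(u, v) e' ∧ (e' ∉ boundaryEdges H Z ∨
        (∃ v' ∉ Z, e' = s(u, v') ∧ ca u v < ca u v') ∨
        ∃ u' ∈ Z, e' = s(u', v) ∧ cb u v < cb u' v))
    (hc : Choosable (H \ boundaryEdges H Z) ξ) : Choosable H ξ := by
  intro A hA
  have hsub : boundaryEdges H Z ⊆ H := fun e he => (mem_boundaryEdges.1 he).1
  rcases (boundaryEdges H Z).eq_empty_or_nonempty with hemp | ⟨e₀, he₀⟩
  · rw [hemp, Finset.sdiff_empty] at hc
    exact hc A hA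
  have hrep : ∃ src tgt : Sym2 V → V, ∀ u ∈ Z, ∀ v ∉ Z, src s(u, v) = u ∧ tgt s(u, v) = v := by
    have : ∀ e : Sym2 V, ∃ p : V × V, ∀ u ∈ Z, ∀ v ∉ Z, e = s(u, v) → p = (u, v) := by
      intro e
      by_cases he : ∃ u ∈ Z, ∃ v ∉ Z, e = s(u, v)
      · obtain ⟨u, hu, v, hv, rfl⟩ := he
        refine ⟨(u, v), fun u' hu' v' hv' h => ?_⟩
        obtain ⟨rfl, rfl⟩ := boundary_repr_unique hv hu' h
        rfl
      · push Not at he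
        obtain ⟨u, -, v, -, -⟩ := (mem_boundaryEdges.1 he₀).2
        exact ⟨(u, v), fun u' hu' v' hv' h => absurd h (he u' hu' v' hv')⟩
    choose p hp using this
    exact ⟨fun e => (p e).1, fun e => (p e).2, fun u hu v hv => by
      simp [hp _ u hu v hv rfl]⟩
  obtain ⟨src, tgt, hst⟩ := hrep
  let idx := Fintype.equivFin (Sym2 V)
  let ra : Sym2 V → ℕ ×ₗ Fin (Fintype.card (Sym2 V)) :=
    fun e => toLex (ca (src e) (tgt e), idx e)
  let rb : Sym2 V → ℕ ×ₗ Fin (Fintype.card (Sym2 V)) :=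
    fun e => toLex (cb (src e) (tgt e), idx e)
  have hra : Function.Injective ra := fun e e' h => idx.injective (Prod.ext_iff.1 (toLex.injective h)).2
  have hrb : Function.Injective rb := fun e e' h => idx.injective (Prod.ext_iff.1 (toLex.injective h)).2
  obtain ⟨f, hf, hfp⟩ := exists_galvin_coloring src tgt ra rb hra hrb (boundaryEdges H Z) A (by
    intro e he
    obtain ⟨heH, u, hu, v, hv, rfl⟩ := mem_boundaryEdges.1 he
    obtain ⟨D, hDH, hDc, hDp⟩ := hD u hu v hv heH
    have h1 := hA _ heH
    suffices h : ((boundaryEdges H Z).filter fun e' => (src e' = src s(u, v) ∧ ra e' < ra s(u, v)) ∨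
        (tgt e' = tgt s(u, v) ∧ rb e' < rb s(u, v))).card + D.card ≤ lineDeg H s(u, v) by omega
    rw [← Finset.card_union_of_disjoint]
    · refine Finset.card_le_card (Finset.union_subset ?_ ?_)
      · intro e' he'
        rw [Finset.mem_filter] at he'
        obtain ⟨he', hp⟩ := he'
        obtain ⟨heH', u', hu', v', hv', rfl⟩ := mem_boundaryEdges.1 he'
        refine Finset.mem_filter.2 ⟨heH', ?_, ?_⟩
        · intro h
          rw [h] at hp
          simp at hp
        · rcases hp with ⟨h, -⟩ | ⟨h, -⟩
          · rw [(hst u' hu' v' hv').1, (hst u hu v hv).1] at h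
            exact ⟨u, by simp [h]⟩
          · rw [(hst u' hu' v' hv').2, (hst u hu v hv).2] at h
            exact ⟨v, by simp [h]⟩
      · exact fun e' he' => Finset.mem_filter.2 ⟨hDH he', (hDp e' he').1⟩
    · rw [Finset.disjoint_left]
      intro e' he' heD
      rw [Finset.mem_filter] at he'
      obtain ⟨he', hp⟩ := he'
      obtain ⟨⟨hne, -⟩, h | ⟨v', hv', rfl, hlt⟩ | ⟨u', hu', rfl, hlt⟩⟩ := hDp e' heD
      · exact h he'
      · rw [(hst u hu v' hv').1, (hst u hu v hv).1, (hst u hu v' hv').2, (hst u hu v hv).2] at hp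
        rcases hp with ⟨-, h⟩ | ⟨h, -⟩
        · have : ca u v' ≤ ca u v := by
            have := (Prod.Lex.toLex_le_toLex.1 h.le)
            rw [(hst u hu v' hv').1, (hst u hu v hv).1, (hst u hu v' hv').2, (hst u hu v hv).2] at this
            rcases this with h | h
            · exact h.le
            · exact h.1.le
          omega
        · exact hne (by rw [h])
      · rw [(hst u' hu' v hv).1, (hst u hu v hv).1, (hst u' hu' v hv).2, (hst u hu v hv).2] at hp
        rcases hp with ⟨h, -⟩ | ⟨-, h⟩
        · exact hne (by rw [h])
        · have : cb u' v ≤ cb u v := by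
            have := (Prod.Lex.toLex_le_toLex.1 h.le)
            rw [(hst u' hu' v hv).1, (hst u hu v hv).1, (hst u' hu' v hv).2, (hst u hu v hv).2] at this
            rcases this with h | h
            · exact h.le
            · exact h.1.le
          omega)
  refine IsListColoring.extend_of_choosable (f := f) hsub ⟨hf, ?_⟩ hc fun e he _ => hA e he
  intro e he e' he' hc
  refine hfp e he e' he' hc.1 ?_
  obtain ⟨heH, u, hu, v, hv, rfl⟩ := mem_boundaryEdges.1 he
  obtain ⟨heH', u', hu', v', hv', rfl⟩ := mem_boundaryEdges.1 he'
  rw [(hst u hu v hv).1, (hst u' hu' v' hv').1, (hst u hu v hv).2, (hst u' hu' v' hv').2]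
  obtain ⟨-, w, hw, hw'⟩ := hc
  rw [Sym2.mem_iff] at hw hw'
  rcases hw with rfl | rfl <;> rcases hw' with rfl | rfl
  · exact Or.inl rfl
  · contradiction
  · contradiction
  · exact Or.inr rfl

end

theorem exists_pair_of_card_lt_add {A B C : Finset ℕ} {c : ℕ} (hA : A.Nonempty) (hB : B.Nonempty)
    (hcC : c ≤ C.card) (hc : c < A.card + B.card) :
    ∃ α ∈ A, ∃ β ∈ B, c ≤ (C \ {α, β}).card + 1 := by
  obtain ⟨a, ha⟩ := hA
  obtain ⟨b, hb⟩ := hB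
  have key : ∀ α β, C.card ≤ (C \ {α, β}).card + (C ∩ {α, β}).card := fun α β => by
    rw [Finset.card_sdiff_add_card_inter]
  by_cases h : ∃ α ∈ A, ∃ β ∈ B, (C ∩ {α, β}).card ≤ 1
  · obtain ⟨α, hα, β, hβ, h⟩ := h
    exact ⟨α, hα, β, hβ, by have := key α β; omega⟩
  · push Not at h
    have h2 : ∀ α ∈ A, ∀ β ∈ B, α ∈ C ∧ β ∈ C ∧ α ≠ β := by
      intro α hα β hβ
      have h3 := h α hα β hβ
      have hle : ({α, β} : Finset ℕ).card ≤ 2 := Finset.card_le_two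
      have heq : C ∩ {α, β} = {α, β} :=
        Finset.eq_of_subset_of_card_le Finset.inter_subset_right (by omega)
      have hsub : {α, β} ⊆ C := by rw [← heq]; exact Finset.inter_subset_left
      refine ⟨hsub (by simp), hsub (by simp), ?_⟩
      rintro rfl
      rw [heq] at h3
      simp at h3
    have hdisj : Disjoint A B := by
      rw [Finset.disjoint_left]
      exact fun x hx hx' => (h2 x hx x hx').2.2 rfl
    have hun : A ∪ B ⊆ C := Finset.union_subset (fun x hx => (h2 x hx b hb).1)
      fun x hx => (h2 a ha x hx).2.1
    have h5 := Finset.card_le_card hun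
    rw [Finset.card_union_of_disjoint hdisj] at h5
    refine ⟨a, ha, b, hb, ?_⟩
    have := key a b
    have : (C ∩ {a, b}).card ≤ 2 := (Finset.card_le_card Finset.inter_subset_right).trans Finset.card_le_two
    omega

section
variable {V : Type*}

theorem ListEdgeColorable.mono {G : SimpleGraph V} {k l : ℕ} (h : ListEdgeColorable G k)
    (hkl : k ≤ l) : ListEdgeColorable G l :=
  fun L hL => h L fun e he => hkl.trans (hL e he)

theorem ListEdgeColorable.mono_graph {G G' : SimpleGraph V} {k : ℕ} (h : ListEdgeColorable G k)
    (hG : G' ≤ G) : ListEdgeColorable G' k := by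
  intro L hL
  have hE : G'.edgeSet ⊆ G.edgeSet := SimpleGraph.edgeSet_mono hG
  obtain ⟨f, hf, hp⟩ := h (fun e => if e ∈ G'.edgeSet then L e else Finset.range k) fun e _ => by
    split_ifs with h'
    · exact hL e h'
    · simp
  refine ⟨f, fun e he => ?_, fun e he e' he' => hp e (hE he) e' (hE he')⟩
  simpa [he] using hf e (hE he)

/-- In a list-edge-critical graph, no nonempty set of edges is choosable with the slack left over
after coloring all the other edges. -/
theorem ListEdgeCritical.not_choosable [Fintype V] {G : SimpleGraph V} [DecidableRel G.Adj] {k : ℕ}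
    (hcrit : ListEdgeCritical G k) {H : Finset (Sym2 V)} (hH : H ⊆ G.edgeFinset)
    (hne : H.Nonempty) : ¬ Choosable H fun e => (k : ℤ) - lineDeg G.edgeFinset e := by
  intro hch
  obtain ⟨e₀, he₀⟩ := hne
  have hGne : {k | ListEdgeColorable G k}.Nonempty :=
    Nat.nonempty_of_pos_sInf (lt_of_le_of_lt (Nat.zero_le _) hcrit.1)
  obtain ⟨m, hm⟩ := hGne
  have hdel : ListEdgeColorable (G.deleteEdges {e₀}) k := by
    have h1 := hcrit.2 e₀ (SimpleGraph.mem_edgeFinset.1 (hH he₀))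
    have h2 : listChromaticIndex (G.deleteEdges {e₀}) ∈ {k | ListEdgeColorable (G.deleteEdges {e₀}) k} :=
      Nat.sInf_mem ⟨m, hm.mono_graph (G.deleteEdges_le _)⟩
    exact ListEdgeColorable.mono h2 h1
  refine absurd hcrit.1 (not_lt.2 (Nat.sInf_le ?_))
  intro L hL
  obtain ⟨f, hf, hp⟩ := hdel L fun e he => hL e (SimpleGraph.edgeSet_mono (G.deleteEdges_le _) he)
  have hmem : ∀ e ∈ G.edgeFinset \ H, e ∈ (G.deleteEdges {e₀}).edgeSet := by
    intro e he
    rw [Finset.mem_sdiff, SimpleGraph.mem_edgeFinset] at he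
    rw [SimpleGraph.edgeSet_deleteEdges]
    refine ⟨he.1, ?_⟩
    rintro rfl
    exact he.2 he₀
  have hQ : IsListColoring (G.edgeFinset \ H) L f :=
    ⟨fun e he => hf e (hmem e he), fun e he e' he' hc => hp e (hmem e he) e' (hmem e' he') hc.1 hc.2⟩
  obtain ⟨g, hg⟩ := hQ.extend_of_choosable (H := G.edgeFinset) Finset.sdiff_subset
    (by rwa [Finset.sdiff_sdiff_eq_self hH]) fun e he _ => by
      have := hL e (SimpleGraph.mem_edgeFinset.1 he)
      omega
  exact ⟨g, fun e he => hg.1 e (SimpleGraph.mem_edgeFinset.2 he), fun e he e' he' h1 h2 =>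
    hg.2 e (SimpleGraph.mem_edgeFinset.2 he) e' (SimpleGraph.mem_edgeFinset.2 he') ⟨h1, h2⟩⟩

theorem lineDeg_edgeFinset [Fintype V] {G : SimpleGraph V} [DecidableRel G.Adj] {u v : V}
    (h : G.Adj u v) : lineDeg G.edgeFinset s(u, v) + 2 = G.degree u + G.degree v := by
  have hu : s(u, v) ∈ G.incidenceFinset u := by simp [h]
  have hv : s(u, v) ∈ G.incidenceFinset v := by simp [SimpleGraph.incidenceSet, h]
  have heq : G.edgeFinset.filter (EdgeConflict s(u, v)) =
      (G.incidenceFinset u).erase s(u, v) ∪ (G.incidenceFinset v).erase s(u, v) := by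
    ext e
    simp only [Finset.mem_filter, SimpleGraph.mem_edgeFinset, EdgeConflict, Finset.mem_union,
      Finset.mem_erase, SimpleGraph.mem_incidenceFinset, SimpleGraph.incidenceSet, Sym2.mem_iff,
      Set.mem_ofPred_eq]
    constructor
    · rintro ⟨h1, h2, w, rfl | rfl, h3⟩
      · exact Or.inl ⟨h2.symm, h1, h3⟩
      · exact Or.inr ⟨h2.symm, h1, h3⟩
    · rintro (⟨h1, h2, h3⟩ | ⟨h1, h2, h3⟩)
      · exact ⟨h2, fun h => h1 h.symm, u, Or.inl rfl, h3⟩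
      · exact ⟨h2, fun h => h1 h.symm, v, Or.inr rfl, h3⟩
  have hdisj : Disjoint ((G.incidenceFinset u).erase s(u, v))
      ((G.incidenceFinset v).erase s(u, v)) := by
    rw [Finset.disjoint_left]
    intro e he he'
    simp only [Finset.mem_erase, SimpleGraph.mem_incidenceFinset, SimpleGraph.incidenceSet,
      Set.mem_ofPred_eq] at he he'
    exact he.1 ((Sym2.mem_and_mem_iff h.ne).1 ⟨he.2.2, he'.2.2⟩)
  have h1 := Finset.card_erase_add_one hu
  have h2 := Finset.card_erase_add_one hv
  rw [SimpleGraph.card_incidenceFinset_eq_degree] at h1 h2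
  unfold lineDeg
  rw [heq, Finset.card_union_of_disjoint hdisj]
  omega

theorem ListEdgeCritical.degree_add_degree [Fintype V] {G : SimpleGraph V} [DecidableRel G.Adj]
    {k : ℕ} (hcrit : ListEdgeCritical G k) {u v : V} (h : G.Adj u v) :
    k + 2 ≤ G.degree u + G.degree v := by
  by_contra hlt
  refine hcrit.not_choosable (H := {s(u, v)}) (by simpa using h) (by simp)
    (choosable_of_rank _ (fun _ => 0) _ ?_ ?_)
  all_goals
    intro e he
    rw [Finset.mem_singleton] at he
    subst he
    have := lineDeg_edgeFinset h
  · omega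
  · left; omega

end

/-- Hall's theorem for a finite subset of the index type. -/
theorem exists_injOn_of_hall {ι α : Type*} [Nonempty α] [DecidableEq α] (T : Finset ι) (t : ι → Finset α)
    (h : ∀ s ⊆ T, s.card ≤ (s.biUnion t).card) :
    ∃ f : ι → α, Set.InjOn f T ∧ ∀ x ∈ T, f x ∈ t x := by
  have hall := (Finset.all_card_le_biUnion_card_iff_exists_injective fun x : T => t x).1 fun s => by
    have h1 := h (s.map (Function.Embedding.subtype _)) (by
      intro x hx
      obtain ⟨y, -, rfl⟩ := Finset.mem_map.1 hx
      exact y.2)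
    rw [Finset.card_map] at h1
    refine h1.trans (Finset.card_le_card ?_)
    intro a ha
    rw [Finset.mem_biUnion] at ha ⊢
    obtain ⟨x, hx, ha⟩ := ha
    obtain ⟨y, hy, rfl⟩ := Finset.mem_map.1 hx
    exact ⟨y, hy, ha⟩
  obtain ⟨f, hf, hft⟩ := hall
  refine ⟨fun x => if h : x ∈ T then f ⟨x, h⟩ else Classical.arbitrary α, ?_, ?_⟩
  · intro x hx y hy hxy
    have hx' : x ∈ T := hx
    have hy' : y ∈ T := hy
    simp only [hx', hy', dif_pos] at hxy
    exact congrArg Subtype.val (hf hxy)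
  · intro x hx
    simp only [hx, dif_pos]
    exact hft ⟨x, hx⟩

theorem exists_token_assignment {V : Type*} [Fintype V] (adj : V → V → Prop) (B : Finset V)
    (w b : V → ℕ) (Z₀ : Finset V) (hne : Z₀.Nonempty)
    (h₀ : ∑ v ∈ B, min (b v) (Z₀.filter fun u => adj u v).card ≤ ∑ u ∈ Z₀, w u) :
    ∃ Z ⊆ Z₀, Z.Nonempty ∧ ∃ P : Finset (V × V), (∀ p ∈ P, p.1 ∈ Z ∧ p.2 ∈ B ∧ adj p.1 p.2) ∧
      (∀ u ∈ Z, (P.filter fun p => p.1 = u).card ≤ w u) ∧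
      ∀ v ∈ B, (P.filter fun p => p.2 = v).card = min (b v) (Z.filter fun u => adj u v).card := by
  obtain ⟨Z, hZmem, hZmin⟩ := Finset.exists_min_image
    (Z₀.powerset.filter fun Z => Z.Nonempty ∧
      ∑ v ∈ B, min (b v) (Z.filter fun u => adj u v).card ≤ ∑ u ∈ Z, w u) Finset.card
    ⟨Z₀, Finset.mem_filter.2 ⟨Finset.mem_powerset_self _, hne, h₀⟩⟩
  rw [Finset.mem_filter, Finset.mem_powerset] at hZmem
  obtain ⟨hZZ, hZne, hZg⟩ := hZmem
  refine ⟨Z, hZZ, hZne, ?_⟩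
  set m : V → ℕ := fun v => min (b v) (Z.filter fun u => adj u v).card with hm
  have hsmall : ∀ Y ⊆ Z, Y ≠ Z →
      ∑ u ∈ Y, w u ≤ ∑ v ∈ B, min (b v) (Y.filter fun u => adj u v).card := by
    intro Y hY hYZ
    by_contra hlt
    rcases Y.eq_empty_or_nonempty with rfl | hYne
    · simp at hlt
    · have := hZmin Y (Finset.mem_filter.2 ⟨Finset.mem_powerset.2 (hY.trans hZZ), hYne, by omega⟩)
      exact hYZ (Finset.eq_of_subset_of_card_le hY this)
  let Ed : Finset (V × V) := (Z ×ˢ B).filter fun p => adj p.1 p.2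
  have hEd : ∀ p, p ∈ Ed ↔ p.1 ∈ Z ∧ p.2 ∈ B ∧ adj p.1 p.2 := fun p => by
    simp [Ed, and_assoc]
  let Tok : Finset (Σ _ : V, ℕ) := B.sigma fun v => Finset.range (m v)
  have hTok : ∀ v i, (⟨v, i⟩ : Σ _ : V, ℕ) ∈ Tok ↔ v ∈ B ∧ i < m v := fun v i => by
    simp [Tok]
  let slots : V → Finset (Σ _ : V, ℕ) := fun u => (Finset.range (w u)).image fun j => ⟨u, j⟩
  let t : (Σ _ : V, ℕ) ⊕ (V × V) → Finset ((V × V) ⊕ (Σ _ : V, ℕ)) := fun x =>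
    x.elim (fun k => (Ed.filter fun p => p.2 = k.1).map Function.Embedding.inl)
      (fun p => insert (Sum.inl p) ((slots p.1).map Function.Embedding.inr))
  have : Nonempty V := ⟨hZne.choose⟩
  obtain ⟨f, hinj, hft⟩ := exists_injOn_of_hall (Tok.disjSum Ed) t (by
    intro s hs
    set sT := s.toLeft with hsT
    set sE := s.toRight with hsE
    have hsTT : ∀ x ∈ sT, x ∈ Tok := fun x hx => by
      simpa using hs (Finset.mem_toLeft.1 hx)
    have hsEE : ∀ x ∈ sE, x ∈ Ed := fun x hx => by
      simpa using hs (Finset.mem_toRight.1 hx)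
    have hcard : s.card = sT.card + sE.card := (Finset.card_toLeft_add_card_toRight).symm
    set V' := sT.image Sigma.fst with hV'
    set U' := sE.image Prod.fst with hU'
    have hV'B : V' ⊆ B := by
      intro v hv
      obtain ⟨⟨v', i⟩, hx, rfl⟩ := Finset.mem_image.1 hv
      exact ((hTok _ _).1 (hsTT _ hx)).1
    have hU'Z : U' ⊆ Z := by
      intro u hu
      obtain ⟨p, hx, rfl⟩ := Finset.mem_image.1 hu
      exact ((hEd _).1 (hsEE _ hx)).1
    have hTcard : sT.card ≤ ∑ v ∈ V', m v := by
      have : sT ⊆ V'.sigma fun v => Finset.range (m v) := by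
        rintro ⟨v, i⟩ hx
        exact Finset.mem_sigma.2 ⟨Finset.mem_image_of_mem _ hx,
          Finset.mem_range.2 ((hTok _ _).1 (hsTT _ hx)).2⟩
      simpa using Finset.card_le_card this
    set Y := Z \ U' with hY
    set X : Finset (V × V) := Ed.filter fun p => p.2 ∈ V' ∧ p.1 ∉ U' with hX
    have hXcard : X.card = ∑ v ∈ V', (Y.filter fun u => adj u v).card := by
      rw [Finset.card_eq_sum_card_fiberwise (f := Prod.snd) (t := V')
        fun p hp => (Finset.mem_filter.1 hp).2.1]
      refine Finset.sum_congr rfl fun v hv => ?_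
      refine Finset.card_bij' (fun p _ => p.1) (fun u _ => (u, v)) ?_ ?_ ?_ ?_
      · intro p hp
        simp only [hX, Finset.mem_filter, hEd] at hp
        obtain ⟨⟨⟨h1, h2, h3⟩, h4, h5⟩, rfl⟩ := hp
        simp [hY, h1, h5, h3]
      · intro u hu
        simp only [hY, Finset.mem_filter, Finset.mem_sdiff] at hu
        simp [hX, hEd, hu, hv, hV'B hv]
      · intro p hp
        simp only [Finset.mem_filter] at hp
        rw [← hp.2]
      · intro u _
        rfl
    have hXE : Disjoint X sE := by
      rw [Finset.disjoint_left]
      intro p hp hp'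
      exact (Finset.mem_filter.1 hp).2.2 (Finset.mem_image_of_mem _ hp')
    have hsub : (X ∪ sE).disjSum (U'.biUnion slots) ⊆ s.biUnion t := by
      intro x hx
      rw [Finset.mem_biUnion]
      rcases x with p | k
      · rw [Finset.inl_mem_disjSum, Finset.mem_union] at hx
        rcases hx with hp | hp
        · obtain ⟨h1, h2, -⟩ := Finset.mem_filter.1 hp
          obtain ⟨k, hk, hkp⟩ := Finset.mem_image.1 h2
          refine ⟨Sum.inl k, Finset.mem_toLeft.1 hk, ?_⟩
          simp [t, h1, hkp]
        · exact ⟨Sum.inr p, Finset.mem_toRight.1 hp, by simp [t]⟩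
      · rw [Finset.inr_mem_disjSum, Finset.mem_biUnion] at hx
        obtain ⟨u, hu, hk⟩ := hx
        obtain ⟨p, hp, rfl⟩ := Finset.mem_image.1 hu
        exact ⟨Sum.inr p, Finset.mem_toRight.1 hp, by simp [t, hk]⟩
    have hslots : (U'.biUnion slots).card = ∑ u ∈ U', w u := by
      rw [Finset.card_biUnion]
      · refine Finset.sum_congr rfl fun u _ => ?_
        rw [Finset.card_image_of_injective, Finset.card_range]
        intro i j hij
        simpa using hij
      · intro u _ u' _ huu
        rw [Function.onFun, Finset.disjoint_left]
        intro k hk hk'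
        obtain ⟨i, -, rfl⟩ := Finset.mem_image.1 hk
        obtain ⟨j, -, hj⟩ := Finset.mem_image.1 hk'
        exact huu (congrArg Sigma.fst hj).symm
    have hle := Finset.card_le_card hsub
    rw [Finset.card_disjSum, Finset.card_union_of_disjoint hXE, hslots, hXcard] at hle
    suffices hfin : ∑ v ∈ V', m v ≤
        ∑ v ∈ V', (Y.filter fun u => adj u v).card + ∑ u ∈ U', w u by omega
    by_cases hYZ : Y = Z
    · rw [hYZ]
      exact (Finset.sum_le_sum fun v _ => min_le_right _ _).trans (Nat.le_add_right _ _)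
    · have h1 := hsmall Y Finset.sdiff_subset hYZ
      have h2 : ∑ u ∈ Y, w u + ∑ u ∈ U', w u = ∑ u ∈ Z, w u := Finset.sum_sdiff hU'Z
      have h3 := Finset.sum_sdiff hV'B (f := m)
      have h4 := Finset.sum_sdiff hV'B
        (f := fun v => min (b v) (Y.filter fun u => adj u v).card)
      have h5 : ∑ v ∈ B \ V', min (b v) (Y.filter fun u => adj u v).card ≤ ∑ v ∈ B \ V', m v :=
        Finset.sum_le_sum fun v _ => min_le_min_left _ (Finset.card_le_card
          (Finset.filter_subset_filter _ Finset.sdiff_subset))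
      have h6 : ∑ v ∈ V', min (b v) (Y.filter fun u => adj u v).card ≤
          ∑ v ∈ V', (Y.filter fun u => adj u v).card := Finset.sum_le_sum fun v _ => min_le_right _ _
      have h7 : ∑ v ∈ B, m v ≤ ∑ u ∈ Z, w u := hZg
      omega)
  have hftok : ∀ v ∈ B, ∀ i < m v, ∃ p ∈ Ed, p.2 = v ∧ f (Sum.inl ⟨v, i⟩) = Sum.inl p := by
    intro v hv i hi
    have := hft (Sum.inl ⟨v, i⟩) (by simp [hTok, hv, hi])
    obtain ⟨p, hp, hpf⟩ := Finset.mem_map.1 this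
    rw [Finset.mem_filter] at hp
    exact ⟨p, hp.1, hp.2, hpf.symm⟩
  refine ⟨Ed.filter fun p => ∃ i < m p.2, f (Sum.inl ⟨p.2, i⟩) = Sum.inl p,
    fun p hp => (hEd p).1 (Finset.mem_filter.1 hp).1, ?_, ?_⟩
  · intro u _
    have hslot : ∀ p ∈ (Ed.filter fun p => ∃ i < m p.2, f (Sum.inl ⟨p.2, i⟩) = Sum.inl p).filter
        (fun p => p.1 = u), f (Sum.inr p) ∈ (slots u).map Function.Embedding.inr := by
      intro p hp
      simp only [Finset.mem_filter] at hp
      obtain ⟨⟨hpE, i, hi, hfi⟩, rfl⟩ := hp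
      have h1 := hft (Sum.inr p) (by simpa using hpE)
      rcases Finset.mem_insert.1 h1 with h2 | h2
      · have := hinj (by simp [hTok, hi, ((hEd p).1 hpE).2.1]) (by simpa using hpE) (hfi.trans h2.symm)
        simp at this
      · exact h2
    refine (Finset.card_le_card_of_injOn (fun p => f (Sum.inr p)) hslot ?_).trans ?_
    · intro p hp q hq hpq
      have hp' := (Finset.mem_filter.1 (Finset.mem_filter.1 hp).1).1
      have hq' := (Finset.mem_filter.1 (Finset.mem_filter.1 hq).1).1
      have := hinj (by simpa using hp') (by simpa using hq') hpq
      simpa using this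
    · rw [Finset.card_map]
      exact Finset.card_image_le.trans (by simp)
  · intro v hv
    change _ = m v
    symm
    rw [← Finset.card_range (m v)]
    refine Finset.card_bij (fun i hi => (hftok v hv i (Finset.mem_range.1 hi)).choose) ?_ ?_ ?_
    · intro i hi
      have := (hftok v hv i (Finset.mem_range.1 hi)).choose_spec
      refine Finset.mem_filter.2 ⟨Finset.mem_filter.2 ⟨this.1, i, ?_⟩, this.2.1⟩
      rw [this.2.1]
      exact ⟨Finset.mem_range.1 hi, this.2.2⟩
    · intro i hi j hj hij
      have h1 := (hftok v hv i (Finset.mem_range.1 hi)).choose_spec.2.2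
      have h2 := (hftok v hv j (Finset.mem_range.1 hj)).choose_spec.2.2
      rw [← hij] at h2
      have := hinj (by simpa [hTok, hv] using hi) (by simpa [hTok, hv] using hj) (h1.trans h2.symm)
      simpa using this
    · intro p hp
      simp only [Finset.mem_filter] at hp
      obtain ⟨⟨hpE, i, hi, hfi⟩, rfl⟩ := hp
      refine ⟨i, Finset.mem_range.2 hi, ?_⟩
      have h1 := (hftok p.2 hv i hi).choose_spec.2.2
      exact Sum.inl_injective (h1.symm.trans hfi)

theorem exists_pick_relation {V : Type*} [Fintype V] (adj : V → V → Prop) (B : Finset V)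
    (w b : V → ℕ) (Z₀ : Finset V) (hne : Z₀.Nonempty)
    (h₀ : ∑ v ∈ B, min (b v) (Z₀.filter fun u => adj u v).card ≤ ∑ u ∈ Z₀, w u) :
    ∃ Z ⊆ Z₀, Z.Nonempty ∧ ∃ P : V → V → Prop, (∀ u v, P u v → u ∈ Z ∧ v ∈ B ∧ adj u v) ∧
      (∀ u ∈ Z, (Finset.univ.filter fun v => P u v).card ≤ w u) ∧
      (∀ v ∈ B, (Finset.univ.filter fun u => P u v).card ≤ b v) ∧
      ∀ u ∈ Z, ∀ v ∈ B, adj u v → ¬ P u v →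
        (Finset.univ.filter fun u => P u v).card = b v := by
  obtain ⟨Z, hZ, hZne, P, hP, hPu, hPv⟩ := exists_token_assignment adj B w b Z₀ hne h₀
  obtain ⟨R, hR⟩ : ∃ R : V → V → Prop, ∀ u v, R u v ↔ (u, v) ∈ P :=
    ⟨fun u v => (u, v) ∈ P, fun _ _ => Iff.rfl⟩
  have hv : ∀ v, (Finset.univ.filter fun u => R u v).card =
      (P.filter fun p => p.2 = v).card := by
    intro v
    refine Finset.card_bij' (fun u _ => (u, v)) (fun p _ => p.1) ?_ ?_ ?_ ?_
    · simp [hR]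
    · rintro ⟨u, v'⟩ hp
      simp only [Finset.mem_filter] at hp
      obtain ⟨hp, rfl⟩ := hp
      simpa [hR] using hp
    · simp [hR]
    · rintro ⟨u, v'⟩ hp
      simp only [Finset.mem_filter] at hp
      rw [hp.2]
  refine ⟨Z, hZ, hZne, R, fun u v h => hP _ ((hR u v).1 h), ?_, ?_, ?_⟩
  · intro u hu
    refine le_trans (le_of_eq ?_) (hPu u hu)
    refine Finset.card_bij' (fun v _ => (u, v)) (fun p _ => p.2) ?_ ?_ ?_ ?_
    · simp [hR]
    · rintro ⟨u', v⟩ hp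
      simp only [Finset.mem_filter] at hp
      obtain ⟨hp, rfl⟩ := hp
      simpa [hR] using hp
    · simp [hR]
    · rintro ⟨u', v⟩ hp
      simp only [Finset.mem_filter] at hp
      rw [hp.2]
  · intro v hvB
    rw [hv, hPv v hvB]
    exact min_le_left _ _
  · intro u hu v hvB ha hn
    have hlt : (Finset.univ.filter fun u => R u v).card < (Z.filter fun u => adj u v).card := by
      refine Finset.card_lt_card ?_
      rw [Finset.ssubset_iff_of_subset]
      · exact ⟨u, by simp [hu, ha], by simpa using hn⟩
      · intro u' hu'
        have := hP _ ((hR _ _).1 (Finset.mem_filter.1 hu').2)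
        simp [this]
    rw [hv, hPv v hvB] at hlt ⊢
    omega

section
variable {V : Type*}

/-- The embedding of the vertices as the pairs containing `u`. -/
def starEmb (u : V) : V ↪ Sym2 V := ⟨fun v => s(u, v), fun _ _ h => Sym2.congr_right.1 h⟩

theorem edgeConflict_left {u v w : V} (h : v ≠ w) : EdgeConflict s(u, v) s(u, w) :=
  ⟨fun h' => h (Sym2.congr_right.1 h'), u, by simp, by simp⟩

theorem edgeConflict_right {u v w : V} (h : u ≠ w) : EdgeConflict s(u, v) s(w, v) :=
  ⟨fun h' => h (Sym2.congr_left.1 h'), v, by simp, by simp⟩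

/-- The edges of `G` meeting `Z`. -/
noncomputable def edgesMeeting [Fintype V] (G : SimpleGraph V) [DecidableRel G.Adj]
    (Z : Finset V) : Finset (Sym2 V) :=
  G.edgeFinset.filter fun e => ∃ u ∈ Z, u ∈ e

theorem mk_mem_edgesMeeting [Fintype V] {G : SimpleGraph V} [DecidableRel G.Adj]
    {Z : Finset V} {u v : V} : s(u, v) ∈ edgesMeeting G Z ↔ G.Adj u v ∧ (u ∈ Z ∨ v ∈ Z) := by
  unfold edgesMeeting
  rw [Finset.mem_filter, SimpleGraph.mem_edgeFinset, SimpleGraph.mem_edgeSet]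
  refine and_congr_right fun _ => ⟨?_, ?_⟩
  · rintro ⟨w, hw, h⟩
    rcases Sym2.mem_iff.1 h with rfl | rfl
    · exact Or.inl hw
    · exact Or.inr hw
  · rintro (h | h)
    · exact ⟨u, h, by simp⟩
    · exact ⟨v, h, by simp⟩

theorem lt_weighted_card_of_six_le [Fintype V] (G : SimpleGraph V) [DecidableRel G.Adj]
    (Δ : ℕ) (hΔ : G.maxDegree = Δ) (hΔ6 : 6 ≤ Δ) (hcrit : ListEdgeCritical G (Δ + 1)) :
    2 * (Finset.univ.filter fun v : V => G.degree v = 3).card +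
        2 * (Finset.univ.filter fun v : V => G.degree v = 4).card <
      (Finset.univ.filter fun v : V => G.degree v = Δ - 1).card +
        2 * (Finset.univ.filter fun v : V => G.degree v = Δ).card := by
  by_contra hcon
  have hle : ∀ v, G.degree v ≤ Δ := fun v => hΔ ▸ G.degree_le_maxDegree v
  have hadd : ∀ u v, G.Adj u v → Δ + 3 ≤ G.degree u + G.degree v :=
    fun u v h => hcrit.degree_add_degree h
  set Z₀ : Finset V := Finset.univ.filter fun v => G.degree v = 3 ∨ G.degree v = 4 with hZ₀
  set B : Finset V := Finset.univ.filter fun v => G.degree v = Δ - 1 ∨ G.degree v = Δ with hB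
  set b : V → ℕ := fun v => if G.degree v = Δ then 2 else 1 with hb
  have hZ₀c : Z₀.card = (Finset.univ.filter fun v : V => G.degree v = 3).card +
      (Finset.univ.filter fun v : V => G.degree v = 4).card := by
    rw [hZ₀, Finset.filter_or, Finset.card_union_of_disjoint]
    rw [Finset.disjoint_filter]
    intro v _ h; omega
  have hbsum : ∑ v ∈ B, b v = (Finset.univ.filter fun v : V => G.degree v = Δ - 1).card +
        2 * (Finset.univ.filter fun v : V => G.degree v = Δ).card := by
    rw [hB, Finset.filter_or, Finset.sum_union, mul_comm, Finset.card_eq_sum_ones,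
      ← smul_eq_mul, ← Finset.sum_const]
    · refine congrArg₂ _ (Finset.sum_congr rfl ?_) (Finset.sum_congr rfl ?_)
      · intro v hv
        have := (Finset.mem_filter.1 hv).2
        rw [hb]; dsimp only; rw [if_neg (by omega)]
      · intro v hv
        have := (Finset.mem_filter.1 hv).2
        rw [hb]; dsimp only; rw [if_pos this]
    · rw [Finset.disjoint_filter]
      intro v _ h; omega
  have hnonempty : Nonempty V := by
    by_contra hne
    rw [not_nonempty_iff] at hne
    rw [SimpleGraph.maxDegree_of_subsingleton] at hΔ
    omega
  have hΔpos : 0 < (Finset.univ.filter fun v : V => G.degree v = Δ).card := by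
    obtain ⟨v, hv⟩ := G.exists_maximal_degree_vertex
    exact Finset.card_pos.2 ⟨v, by simp [← hv, hΔ]⟩
  obtain ⟨Z, hZ, ⟨u₀, hu₀⟩, P, hP, hPu, hPv, hPb⟩ := exists_pick_relation G.Adj B (fun _ => 2) b Z₀
    (Finset.card_pos.1 (by omega)) (by
      refine (Finset.sum_le_sum fun v _ => min_le_left _ _).trans ?_
      rw [Finset.sum_const, smul_eq_mul]
      omega)
  have hZd : ∀ u ∈ Z, G.degree u = 3 ∨ G.degree u = 4 := fun u hu =>
    (Finset.mem_filter.1 (hZ hu)).2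
  have hnZ : ∀ u ∈ Z, ∀ v, G.Adj u v → v ∉ Z := fun u hu v h hv => by
    have := hadd u v h
    have := hZd u hu
    have := hZd v hv
    omega
  obtain ⟨v₀, hv₀⟩ : ∃ v, G.Adj u₀ v := by
    rw [← SimpleGraph.degree_pos_iff_exists_adj]
    have := hZd u₀ hu₀
    omega
  refine hcrit.not_choosable (H := edgesMeeting G Z) (Finset.filter_subset _ _)
    ⟨_, mk_mem_edgesMeeting.2 ⟨hv₀, Or.inl hu₀⟩⟩ ?_
  refine choosable_of_boundary Z _ _ (fun u v => if P u v then 0 else 1)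
    (fun u v => if P u v then 1 else 0) ?_ ?_
  · intro u hu v hv hH
    obtain ⟨huv, -⟩ := mk_mem_edgesMeeting.1 hH
    have h1 := lineDeg_edgeFinset huv
    have h2 := hadd u v huv
    have h3 := hZd u hu
    have h4 := hle v
    by_cases hp : P u v
    · refine ⟨((G.neighborFinset u).filter fun v' => ¬ P u v').map (starEmb u), ?_, ?_, ?_⟩
      · intro e he
        obtain ⟨v', hv', rfl⟩ := Finset.mem_map.1 he
        rw [Finset.mem_filter, SimpleGraph.mem_neighborFinset] at hv'
        exact mk_mem_edgesMeeting.2 ⟨hv'.1, Or.inl hu⟩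
      · rw [Finset.card_map]
        have h5 := Finset.card_filter_add_card_filter_not (s := G.neighborFinset u) (P u)
        have h6 : ((G.neighborFinset u).filter (P u)).card ≤ 2 :=
          (Finset.card_le_card (Finset.filter_subset_filter _ (Finset.subset_univ _))).trans (hPu u hu)
        rw [SimpleGraph.card_neighborFinset_eq_degree] at h5
        push_cast
        omega
      · intro e he
        obtain ⟨v', hv', rfl⟩ := Finset.mem_map.1 he
        rw [Finset.mem_filter, SimpleGraph.mem_neighborFinset] at hv'
        refine ⟨edgeConflict_left ?_, Or.inr (Or.inl ⟨v', hnZ u hu v' hv'.1, rfl, by simp [hp, hv'.2]⟩)⟩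
        rintro rfl
        exact hv'.2 hp
    · refine ⟨(Finset.univ.filter fun u' => P u' v).map (starEmb v), ?_, ?_, ?_⟩
      · intro e he
        obtain ⟨u', hu', rfl⟩ := Finset.mem_map.1 he
        have := hP u' v (Finset.mem_filter.1 hu').2
        exact mk_mem_edgesMeeting.2 ⟨this.2.2.symm, Or.inr this.1⟩
      · rw [Finset.card_map, hPb u hu v (by simp [hB]; omega) huv hp, hb]
        push_cast
        split_ifs <;> omega
      · intro e he
        obtain ⟨u', hu', rfl⟩ := Finset.mem_map.1 he
        have hp' := (Finset.mem_filter.1 hu').2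
        have h5 := hP u' v hp'
        have : starEmb v u' = s(u', v) := Sym2.eq_swap
        rw [this]
        refine ⟨edgeConflict_right ?_, Or.inr (Or.inr ⟨u', h5.1, rfl, by simp [hp, hp']⟩)⟩
        rintro rfl
        exact hp hp'
  · have hemp : edgesMeeting G Z \ boundaryEdges (edgesMeeting G Z) Z = ∅ := by
      rw [Finset.sdiff_eq_empty_iff_subset]
      intro e he
      refine mem_boundaryEdges.2 ⟨he, ?_⟩
      induction e using Sym2.ind with
      | h x y =>
        obtain ⟨h, hx | hy⟩ := mk_mem_edgesMeeting.1 he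
        · exact ⟨x, hx, y, hnZ x hx y h, rfl⟩
        · exact ⟨y, hy, x, hnZ y hy x h.symm, Sym2.eq_swap⟩
    rw [hemp]
    exact choosable_of_rank _ (fun _ => 0) _ (by simp) (by simp)

end

section
variable {V : Type*}

/-- Coloring two edges in conflict with `g` so that at most one color of `g` is lost. -/
theorem exists_pair_coloring {H : Finset (Sym2 V)} {A : Sym2 V → Finset ℕ} {e₀ f g : Sym2 V}
    (he₀ : e₀ ∈ H) (hf : f ∈ H) (hne : e₀ ≠ f) (h0g : EdgeConflict g e₀) (hfg : EdgeConflict g f)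
    (hn : ¬ EdgeConflict e₀ f) {A₀ B₀ : Finset ℕ} (hA₀ : A₀ ⊆ A e₀) (hB₀ : B₀ ⊆ A f)
    (hA₀n : A₀.Nonempty) (hB₀n : B₀.Nonempty) (hg : lineDeg H g ≤ (A g).card)
    (hlt : lineDeg H g < A₀.card + B₀.card) :
    ∃ c, IsListColoring {e₀, f} A c ∧ c e₀ ∈ A₀ ∧ c f ∈ B₀ ∧
      lineDeg (H \ {e₀, f}) g + 1 ≤ (residualList {e₀, f} c A g).card := by
  obtain ⟨α, hα, β, hβ, hc⟩ := exists_pair_of_card_lt_add hA₀n hB₀n hg hlt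
  have h2 : lineDeg {e₀, f} g = 2 := by
    unfold lineDeg
    rw [Finset.filter_true_of_mem, Finset.card_pair hne]
    intro e he
    rw [Finset.mem_insert, Finset.mem_singleton] at he
    rcases he with rfl | rfl <;> assumption
  have h3 := lineDeg_add_lineDeg_sdiff (H := H) (Q := {e₀, f})
    (Finset.insert_subset he₀ (Finset.singleton_subset_iff.2 hf)) g
  refine ⟨fun e => if e = e₀ then α else β, ⟨?_, ?_⟩, by simpa, by simpa [hne.symm], ?_⟩
  · intro e he
    rw [Finset.mem_insert, Finset.mem_singleton] at he
    rcases he with rfl | rfl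
    · simpa using hA₀ hα
    · simpa [hne.symm] using hB₀ hβ
  · intro e he e' he' hconf
    rw [Finset.mem_insert, Finset.mem_singleton] at he he'
    rcases he with rfl | rfl <;> rcases he' with rfl | rfl
    · exact absurd rfl hconf.1
    · exact absurd hconf hn
    · exact absurd hconf.symm hn
    · exact absurd rfl hconf.1
  · have : A g \ {α, β} ⊆ residualList {e₀, f} (fun e => if e = e₀ then α else β) A g := by
      refine Finset.sdiff_subset_sdiff le_rfl ?_
      intro x hx
      obtain ⟨e, -, rfl⟩ := Finset.mem_image.1 hx
      split_ifs <;> simp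
    have := Finset.card_le_card this
    omega

/-- A graph of minimum degree at least two on `W` with a vertex of degree at least three contains
a cycle with a pendant edge. -/
theorem exists_cycle_with_pendant [Fintype V] (G : SimpleGraph V) [DecidableRel G.Adj]
    (W : Finset V) (h2 : ∀ u ∈ W, 2 ≤ (W.filter (G.Adj u)).card) {x : V} (hxW : x ∈ W)
    (hx : 3 ≤ (W.filter (G.Adj x)).card) :
    ∃ (t : ℕ) (q : ℕ → V) (z : V), 2 ≤ t ∧ Set.InjOn q (Set.Iic t) ∧ (∀ i ≤ t, q i ∈ W) ∧
      (∀ i < t, G.Adj (q i) (q (i + 1))) ∧ G.Adj (q t) (q 0) ∧ z ∈ W ∧ (∀ i ≤ t, z ≠ q i) ∧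
      G.Adj z (q 0) := by
  let S : ℕ → Prop := fun n => ∃ p : ℕ → V, p 0 = x ∧ Set.InjOn p (Set.Iic n) ∧
    (∀ i ≤ n, p i ∈ W) ∧ ∀ i < n, G.Adj (p i) (p (i + 1))
  have hS0 : S 0 := ⟨fun _ => x, rfl, by
    intro i hi j hj _
    simp at hi hj
    omega, by simp [hxW], by simp⟩
  have hSb : ∀ n, S n → n ≤ Fintype.card V := by
    rintro n ⟨p, -, hp, -⟩
    have := Finset.card_le_card_of_injOn (s := Finset.Iic n) (t := Finset.univ) p (by simp)
      (by simpa using hp)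
    rw [Nat.card_Iic, Finset.card_univ] at this
    omega
  obtain ⟨n, hn⟩ : ∃ n, n = Nat.findGreatest S (Fintype.card V) := ⟨_, rfl⟩
  have hSn : S n := hn ▸ Nat.findGreatest_spec (Nat.zero_le _) hS0
  have hmax : ¬ S (n + 1) := fun h => by
    have := Nat.le_findGreatest (hSb _ h) h
    omega
  obtain ⟨p, hp0, hpi, hpW, hpa⟩ := hSn
  have hinj : ∀ i ≤ n, ∀ j ≤ n, p i = p j → i = j := fun i hi j hj h => hpi hi hj h
  have hend : ∀ y ∈ W, G.Adj (p n) y → ∃ i ≤ n, y = p i := by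
    intro y hy ha
    by_contra hcon
    push Not at hcon
    refine hmax ⟨fun i => if i ≤ n then p i else y, by simp [hp0], ?_, ?_, ?_⟩
    · intro i hi j hj hij
      simp only [Set.mem_Iic] at hi hj
      dsimp only at hij
      split_ifs at hij with h1 h2 h2
      · exact hinj i h1 j h2 hij
      · exact absurd hij.symm (hcon i h1)
      · exact absurd hij (hcon j h2)
      · omega
    · intro i hi
      dsimp only
      split_ifs with h1
      · exact hpW i h1
      · exact hy
    · intro i hi
      dsimp only
      rcases Nat.lt_succ_iff_lt_or_eq.1 hi with h | rfl
      · rw [if_pos (by omega), if_pos (by omega)]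
        exact hpa i h
      · rw [if_pos le_rfl, if_neg (by omega)]
        exact ha
  have hex : ∀ u ∈ W, ∀ a, ∃ y ∈ W, G.Adj u y ∧ y ≠ a := by
    intro u hu a
    obtain ⟨y, hy, hya⟩ := Finset.exists_mem_ne (lt_of_lt_of_le one_lt_two (h2 u hu)) a
    rw [Finset.mem_filter] at hy
    exact ⟨y, hy.1, hy.2, hya⟩
  obtain ⟨y, hyW, hya, hyn⟩ := hex (p n) (hpW n le_rfl) (p (n - 1))
  obtain ⟨i, hi, rfl⟩ := hend y hyW hya
  have hin : i ≠ n := by rintro rfl; exact G.loopless.irrefl _ hya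
  have hin1 : i ≠ n - 1 := by rintro rfl; exact hyn rfl
  rcases Nat.eq_zero_or_pos i with rfl | hipos
  · obtain ⟨y, hy, hy1, hyn'⟩ : ∃ y ∈ W.filter (G.Adj x), y ≠ p 1 ∧ y ≠ p n := by
      by_contra hcon
      push Not at hcon
      have : W.filter (G.Adj x) ⊆ {p 1, p n} := by
        intro y hy
        rw [Finset.mem_insert, Finset.mem_singleton]
        by_cases h : y = p 1
        · exact Or.inl h
        · exact Or.inr (hcon y hy h)
      have := (Finset.card_le_card this).trans Finset.card_le_two
      omega
    rw [Finset.mem_filter, ← hp0] at hy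
    by_cases hmem : ∃ j ≤ n, y = p j
    · obtain ⟨j, hj, rfl⟩ := hmem
      have hj0 : j ≠ 0 := by rintro rfl; exact G.loopless.irrefl _ hy.2
      have hj1 : j ≠ 1 := by rintro rfl; exact hy1 rfl
      have hjn : j ≠ n := by rintro rfl; exact hyn' rfl
      refine ⟨j, fun l => p (j - l), p (j + 1), by omega, ?_, fun l hl => hpW _ (by omega), ?_, ?_,
        hpW _ (by omega), ?_, ?_⟩
      · intro a ha c hc hac
        simp only [Set.mem_Iic] at ha hc
        have := hinj _ (by omega) _ (by omega) hac
        omega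
      · intro l hl
        have := hpa (j - (l + 1)) (by omega)
        rw [show j - (l + 1) + 1 = j - l by omega] at this
        exact this.symm
      · simpa using hy.2
      · intro l hl h
        have := hinj _ (by omega) _ (by omega) h
        omega
      · simpa using (hpa j (by omega)).symm
    · push Not at hmem
      exact ⟨n, p, y, by omega, hpi, hpW, hpa, hya, hy.1, hmem, hy.2.symm⟩
  · refine ⟨n - i, fun j => p (i + j), p (i - 1), by omega, ?_, fun l hl => hpW _ (by omega), ?_, ?_,
        hpW _ (by omega), ?_, ?_⟩
    · intro a ha c hc hac
      simp only [Set.mem_Iic] at ha hc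
      have := hinj _ (by omega) _ (by omega) hac
      omega
    · intro l hl
      exact hpa (i + l) (by omega)
    · simpa [show i + (n - i) = n by omega] using hya
    · intro l hl h
      have := hinj _ (by omega) _ (by omega) h
      omega
    · have := hpa (i - 1) (by omega)
      rwa [show i - 1 + 1 = i by omega] at this

theorem mk_ne_mk {a b c d : V} (h : a ≠ c ∧ a ≠ d ∨ b ≠ c ∧ b ≠ d) : s(a, b) ≠ s(c, d) := by
  rw [Ne, Sym2.eq_iff]
  tauto

theorem not_edgeConflict {a b c d : V} (h1 : a ≠ c) (h2 : a ≠ d) (h3 : b ≠ c) (h4 : b ≠ d) :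
    ¬ EdgeConflict s(a, b) s(c, d) := by
  rintro ⟨-, v, hv, hv'⟩
  rw [Sym2.mem_iff] at hv hv'
  rcases hv with rfl | rfl <;> rcases hv' with h | h <;> contradiction

/-- The sum of the values of `ρ` at the two ends of an edge. -/
def endSum (ρ : V → ℕ) : Sym2 V → ℕ := Sym2.lift ⟨fun x y => ρ x + ρ y, fun _ _ => add_comm _ _⟩

theorem endSum_mk (ρ : V → ℕ) (x y : V) : endSum ρ s(x, y) = ρ x + ρ y := rfl

theorem exists_edges_of_cycle_with_pendant {t : ℕ} {q : ℕ → V} {z : V} (ht : 2 ≤ t)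
    (hq : Set.InjOn q (Set.Iic t)) (hz : ∀ i ≤ t, z ≠ q i) (ξ : Sym2 V → ℤ)
    (hξc : ∀ i < t, 0 ≤ ξ s(q i, q (i + 1))) (hξt : 0 ≤ ξ s(q t, q 0)) (hξz : 0 ≤ ξ s(z, q 0)) :
    Choosable (insert s(z, q 0) (insert s(q t, q 0)
      ((Finset.range t).image fun i => s(q i, q (i + 1))))) ξ := by
  have hne : ∀ i ≤ t, ∀ j ≤ t, i ≠ j → q i ≠ q j := fun i hi j hj h h' => h (hq hi hj h')
  set H := insert s(z, q 0) (insert s(q t, q 0)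
      ((Finset.range t).image fun i => s(q i, q (i + 1)))) with hH
  have hmem : ∀ e, e ∈ H ↔ e = s(z, q 0) ∨ e = s(q t, q 0) ∨ ∃ i < t, s(q i, q (i + 1)) = e := by
    intro e; simp [hH]
  have hξ : ∀ e ∈ H, 0 ≤ ξ e := by
    intro e he
    rcases (hmem e).1 he with rfl | rfl | ⟨i, hi, rfl⟩
    · exact hξz
    · exact hξt
    · exact hξc i hi
  intro A hA
  have hA' : ∀ e ∈ H, lineDeg H e ≤ (A e).card := fun e he => by
    have := hA e he
    have := hξ e he
    omega
  have he₀ : s(z, q 0) ∈ H := (hmem _).2 (Or.inl rfl)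
  have hg : s(q 0, q 1) ∈ H := (hmem _).2 (Or.inr (Or.inr ⟨0, by omega, rfl⟩))
  have hf : s(q 1, q 2) ∈ H := (hmem _).2 (Or.inr (Or.inr ⟨1, by omega, rfl⟩))
  have hl : s(q t, q 0) ∈ H := (hmem _).2 (Or.inr (Or.inl rfl))
  have h01 := hne 0 (by omega) 1 (by omega) (by omega)
  have h02 := hne 0 (by omega) 2 (by omega) (by omega)
  have h12 := hne 1 (by omega) 2 (by omega) (by omega)
  have h0t := hne 0 (by omega) t (by omega) (by omega)
  have h1t := hne 1 (by omega) t (by omega) (by omega)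
  have hz0 := hz 0 (by omega)
  have hz1 := hz 1 (by omega)
  have hz2 := hz 2 (by omega)
  have hzt := hz t (by omega)
  have hcg0 : EdgeConflict s(q 0, q 1) s(z, q 0) :=
    ⟨mk_ne_mk (Or.inr ⟨hz1.symm, h01.symm⟩), q 0, by simp, by simp⟩
  have hcgf : EdgeConflict s(q 0, q 1) s(q 1, q 2) :=
    ⟨mk_ne_mk (Or.inl ⟨h01, h02⟩), q 1, by simp, by simp⟩
  have hclg : EdgeConflict s(q t, q 0) s(q 0, q 1) :=
    ⟨mk_ne_mk (Or.inl ⟨h0t.symm, h1t.symm⟩), q 0, by simp, by simp⟩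
  have two : ∀ e a b : Sym2 V, a ∈ H → b ∈ H → a ≠ b → EdgeConflict e a → EdgeConflict e b →
      2 ≤ lineDeg H e := by
    intro e a b ha hb hab hca hcb
    rw [← Finset.card_pair hab]
    refine Finset.card_le_card ?_
    intro x hx
    rw [Finset.mem_insert, Finset.mem_singleton] at hx
    rcases hx with rfl | rfl
    · exact Finset.mem_filter.2 ⟨ha, hca⟩
    · exact Finset.mem_filter.2 ⟨hb, hcb⟩
  have hd0 : 2 ≤ lineDeg H s(z, q 0) := two _ _ _ hg hl (hclg.1.symm) hcg0.symm
    ⟨mk_ne_mk (Or.inl ⟨hzt, hz0⟩), q 0, by simp, by simp⟩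
  have hdf : 2 ≤ lineDeg H s(q 1, q 2) := by
    rcases Nat.eq_or_lt_of_le ht with h | h
    · refine two _ _ _ hg hl (hclg.1.symm) hcgf.symm ⟨mk_ne_mk (Or.inl ⟨h1t, h01.symm⟩), q t, ?_, ?_⟩
      · rw [← h]; simp
      · simp
    · have h13 := hne 1 (by omega) 3 (by omega) (by omega)
      have h03 := hne 0 (by omega) 3 (by omega) (by omega)
      exact two _ _ s(q 2, q 3) hg ((hmem _).2 (Or.inr (Or.inr ⟨2, h, rfl⟩)))
        (mk_ne_mk (Or.inl ⟨h02, h03⟩)) hcgf.symm ⟨mk_ne_mk (Or.inl ⟨h12, h13⟩), q 2, by simp, by simp⟩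
  have hdg : lineDeg H s(q 0, q 1) ≤ 3 := by
    refine le_trans (Finset.card_le_card (t := {s(z, q 0), s(q t, q 0), s(q 1, q 2)}) ?_)
      Finset.card_le_three
    intro e he
    rw [Finset.mem_filter] at he
    rw [Finset.mem_insert, Finset.mem_insert, Finset.mem_singleton]
    obtain ⟨he, hce⟩ := he
    rcases (hmem e).1 he with h | h | ⟨i, hi, rfl⟩
    · exact Or.inl h
    · exact Or.inr (Or.inl h)
    · refine Or.inr (Or.inr ?_)
      have hi0 : i ≠ 0 := by rintro rfl; exact hce.1 rfl
      have hi1 : i = 1 := by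
        by_contra hi1
        exact not_edgeConflict (hne 0 (by omega) i (by omega) (by omega))
          (hne 0 (by omega) (i + 1) (by omega) (by omega)) (hne 1 (by omega) i (by omega) (by omega))
          (hne 1 (by omega) (i + 1) (by omega) (by omega)) hce
      subst hi1; rfl
  have hA0 := hA' _ he₀
  have hAf := hA' _ hf
  obtain ⟨c, hc, -, -, hres⟩ := exists_pair_coloring he₀ hf (mk_ne_mk (Or.inl ⟨hz1, hz2⟩)) hcg0 hcgf
    (not_edgeConflict hz1 hz2 h01 h02) subset_rfl subset_rfl
    (Finset.card_pos.1 (by omega)) (Finset.card_pos.1 (by omega)) (hA' _ hg) (by omega)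
  set Q : Finset (Sym2 V) := {s(z, q 0), s(q 1, q 2)} with hQ
  have hQH : Q ⊆ H := Finset.insert_subset he₀ (Finset.singleton_subset_iff.2 hf)
  obtain ⟨ρ, hρ⟩ : ∃ ρ : V → ℕ, ∀ i ≤ t, ρ (q i) = if i ≤ 1 then 0 else t + 1 - i :=
    ⟨fun x => if Function.invFunOn q (Set.Iic t) x ≤ 1 then 0 else
      t + 1 - Function.invFunOn q (Set.Iic t) x, fun i hi => by
        dsimp only
        rw [hq.leftInvOn_invFunOn (show i ∈ Set.Iic t from hi)]⟩
  have hJ : Choosable (H \ Q) fun e => if e = s(q 0, q 1) then 1 else 0 := by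
    refine choosable_of_rank _ (endSum ρ) _ (fun e _ => by split_ifs <;> simp) fun e he => ?_
    rw [Finset.mem_sdiff, hmem] at he
    obtain ⟨he, heQ⟩ := he
    have hgJ : s(q 0, q 1) ∈ H \ Q := by
      refine Finset.mem_sdiff.2 ⟨hg, fun h => ?_⟩
      rw [hQ, Finset.mem_insert, Finset.mem_singleton] at h
      rcases h with h | h
      · exact hcg0.1 h
      · exact hcgf.1 h
    have hlJ : s(q t, q 0) ∈ H \ Q := by
      refine Finset.mem_sdiff.2 ⟨hl, fun h => ?_⟩
      rw [hQ, Finset.mem_insert, Finset.mem_singleton] at h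
      rcases h with h | h
      · exact mk_ne_mk (Or.inl ⟨hzt.symm, h0t.symm⟩) h
      · exact mk_ne_mk (Or.inr ⟨h01, h02⟩) h
    have hr0 := hρ 0 (by omega)
    have hr1 := hρ 1 (by omega)
    have hrt := hρ t le_rfl
    rw [if_pos (by omega)] at hr0 hr1
    rw [if_neg (by omega)] at hrt
    rcases he with rfl | rfl | ⟨i, hi, rfl⟩
    · exact absurd (by simp [hQ]) heQ
    · refine Or.inr ⟨_, hgJ, hclg, ?_⟩
      rw [endSum_mk, endSum_mk]
      omega
    · have hi1 : i ≠ 1 := by rintro rfl; exact heQ (by simp [hQ])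
      rcases Nat.eq_zero_or_pos i with rfl | hpos
      · left; simp
      right
      have hri := hρ i (by omega)
      have hri1 := hρ (i + 1) (by omega)
      rw [if_neg (by omega)] at hri hri1
      by_cases hit : i + 1 = t
      · refine ⟨_, hlJ, ⟨mk_ne_mk (Or.inl ⟨hne i (by omega) t (by omega) (by omega),
          hne i (by omega) 0 (by omega) (by omega)⟩), q t, by simp [hit], by simp⟩, ?_⟩
        rw [endSum_mk, endSum_mk]
        omega
      · have hri2 := hρ (i + 2) (by omega)
        rw [if_neg (by omega)] at hri2
        refine ⟨s(q (i + 1), q (i + 2)), Finset.mem_sdiff.2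
          ⟨(hmem _).2 (Or.inr (Or.inr ⟨i + 1, by omega, rfl⟩)), fun h => ?_⟩,
          ⟨mk_ne_mk (Or.inl ⟨hne i (by omega) (i + 1) (by omega) (by omega),
            hne i (by omega) (i + 2) (by omega) (by omega)⟩), q (i + 1), by simp, by simp⟩, ?_⟩
        · rw [hQ, Finset.mem_insert, Finset.mem_singleton] at h
          rcases h with h | h
          · exact mk_ne_mk (Or.inl ⟨(hz (i + 1) (by omega)).symm,
              hne (i + 1) (by omega) 0 (by omega) (by omega)⟩) h
          · exact mk_ne_mk (Or.inr ⟨hne (i + 2) (by omega) 1 (by omega) (by omega),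
              hne (i + 2) (by omega) 2 (by omega) (by omega)⟩) h
        · rw [endSum_mk, endSum_mk]
          omega
  obtain ⟨g', hg'⟩ := hJ (residualList Q c A) fun e he => by
    dsimp only
    split_ifs with h
    · subst h; exact_mod_cast hres
    · rw [Finset.mem_sdiff] at he
      have := hA' e he.1
      have := lineDeg_add_lineDeg_sdiff hQH e
      have := card_le_card_residualList_add Q c A e
      omega
  exact hc.extend hg'

/-- In a 6-list-edge-critical graph of maximum degree 5, the vertices of degree 4 induce a
subgraph in which every set of vertices spans at most as many edges as vertices. -/
theorem ListEdgeCritical.sum_card_adj_le [Fintype V] {G : SimpleGraph V} [DecidableRel G.Adj]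
    (hcrit : ListEdgeCritical G 6) (W : Finset V) (hW : ∀ u ∈ W, G.degree u = 4) :
    ∑ u ∈ W, (W.filter (G.Adj u)).card ≤ 2 * W.card := by
  induction W using Finset.strongInduction with
  | H W ih =>
    by_contra hlt
    rw [not_le] at hlt
    have h2 : ∀ u ∈ W, 2 ≤ (W.filter (G.Adj u)).card := by
      intro u hu
      by_contra hu2
      have h1 := ih (W.erase u) (Finset.erase_ssubset hu) fun v hv => hW v (Finset.mem_of_mem_erase hv)
      have h3 : ∀ v ∈ W.erase u, (W.filter (G.Adj v)).card =
          ((W.erase u).filter (G.Adj v)).card + if G.Adj u v then 1 else 0 := by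
        intro v _
        rw [← Finset.insert_erase hu, Finset.filter_insert, Finset.erase_insert (by simp)]
        by_cases h : G.Adj u v
        · rw [if_pos h.symm, if_pos h, Finset.card_insert_of_notMem (by simp)]
        · rw [if_neg fun h' => h h'.symm, if_neg h, add_zero]
      have h4 : ∑ v ∈ W.erase u, (if G.Adj u v then 1 else 0) = (W.filter (G.Adj u)).card := by
        rw [← Finset.card_filter, Finset.filter_erase, Finset.erase_eq_of_notMem]
        simp
      rw [← Finset.add_sum_erase _ _ hu, Finset.sum_congr rfl h3, Finset.sum_add_distrib, h4] at hlt
      have := Finset.card_erase_add_one hu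
      omega
    obtain ⟨x, hxW, hx⟩ : ∃ x ∈ W, 2 < (W.filter (G.Adj x)).card := by
      refine Finset.exists_lt_of_sum_lt (s := W) (f := fun _ => 2) ?_
      rw [Finset.sum_const, smul_eq_mul]
      omega
    obtain ⟨t, q, z, ht, hq, hqW, hqa, hqt, hzW, hz, hza⟩ := exists_cycle_with_pendant G W h2 hxW hx
    have hsl : ∀ a ∈ W, ∀ b ∈ W, G.Adj a b →
        (0 : ℤ) ≤ ((6 : ℕ) : ℤ) - lineDeg G.edgeFinset s(a, b) := by
      intro a ha b hb hab
      have := lineDeg_edgeFinset hab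
      have := hW a ha
      have := hW b hb
      omega
    refine hcrit.not_choosable ?_ (Finset.insert_nonempty _ _)
      (exists_edges_of_cycle_with_pendant ht hq hz _ (fun i hi => hsl _ (hqW _ (by omega)) _ (hqW _ (by omega)) (hqa i hi))
        (hsl _ (hqW _ le_rfl) _ (hqW _ (by omega)) hqt) (hsl _ hzW _ (hqW _ (by omega)) hza))
    intro e he
    simp only [Finset.mem_insert, Finset.mem_image, Finset.mem_range] at he
    rw [SimpleGraph.mem_edgeFinset]
    rcases he with rfl | rfl | ⟨i, hi, rfl⟩
    · exact hza
    · exact hqt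
    · exact hqa i hi

end

section
variable {V : Type*} [Fintype V]

/-- The number of neighbors of degree four. -/
noncomputable def deg4Nbrs (G : SimpleGraph V) [DecidableRel G.Adj] (u : V) : ℕ :=
  (Finset.univ.filter fun v => G.Adj u v ∧ G.degree v = 4).card

/-- `u` lies on a component of the graph induced by the vertices of degree four
that is a path on three vertices. -/
def OnShortPath (G : SimpleGraph V) [DecidableRel G.Adj] (u : V) : Prop :=
  ∃ b, G.degree b = 4 ∧ deg4Nbrs G b = 2 ∧
    (∀ x, G.Adj b x → G.degree x = 4 → deg4Nbrs G x = 1) ∧ (u = b ∨ G.Adj u b)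

/-- The number of edges that may be picked at a vertex of degree four. -/
noncomputable def pickBound (G : SimpleGraph V) [DecidableRel G.Adj] (u : V) : ℕ :=
  if deg4Nbrs G u = 0 then 2 else if deg4Nbrs G u = 1 then (if OnShortPath G u then 1 else 2)
  else if deg4Nbrs G u = 2 then 1 else 0

theorem deg4Nbrs_pos {G : SimpleGraph V} [DecidableRel G.Adj] {u v : V} (h : G.Adj u v)
    (hv : G.degree v = 4) : 1 ≤ deg4Nbrs G u :=
  Finset.card_pos.2 ⟨v, by simp [h, hv]⟩

theorem eq_of_deg4Nbrs_eq_one {G : SimpleGraph V} [DecidableRel G.Adj] {u v w : V}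
    (hk : deg4Nbrs G u = 1) (h : G.Adj u v) (hv : G.degree v = 4) (h' : G.Adj u w)
    (hw : G.degree w = 4) : v = w := by
  obtain ⟨x, hx⟩ := Finset.card_eq_one.1 hk
  have h1 : v ∈ ({x} : Finset V) := by rw [← hx]; simp [h, hv]
  have h2 : w ∈ ({x} : Finset V) := by rw [← hx]; simp [h', hw]
  rw [Finset.mem_singleton] at h1 h2
  rw [h1, h2]

theorem ListEdgeCritical.card_le_sum_pickBound {G : SimpleGraph V} [DecidableRel G.Adj]
    (hcrit : ListEdgeCritical G 6) :
    (Finset.univ.filter fun v => G.degree v = 4).card ≤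
      ∑ u ∈ Finset.univ.filter fun v => G.degree v = 4, pickBound G u := by
  set F : Finset V := Finset.univ.filter fun v => G.degree v = 4 with hF
  have hFm : ∀ u, u ∈ F ↔ G.degree u = 4 := fun u => by simp [hF]
  set W := F.filter fun u => ¬ OnShortPath G u ∧ 1 ≤ deg4Nbrs G u with hW
  have hWm : ∀ u, u ∈ W ↔ G.degree u = 4 ∧ ¬ OnShortPath G u ∧ 1 ≤ deg4Nbrs G u := fun u => by
    simp [hW, hF]
  have hWF : W ⊆ F := Finset.filter_subset _ _
  have hclosed : ∀ u ∈ W, ∀ x, G.Adj u x → G.degree x = 4 → x ∈ W := by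
    intro u hu x hux hx
    rw [hWm] at hu ⊢
    refine ⟨hx, ?_, deg4Nbrs_pos hux.symm hu.1⟩
    rintro ⟨b, hb, hkb, hbn, rfl | hxb⟩
    · exact hu.2.1 ⟨x, hb, hkb, hbn, Or.inr hux⟩
    · have := eq_of_deg4Nbrs_eq_one (hbn x hxb.symm hx) hxb hb hux.symm hu.1
      exact hu.2.1 ⟨b, hb, hkb, hbn, Or.inl this.symm⟩
  have h1 : ∑ u ∈ W, deg4Nbrs G u ≤ 2 * W.card := by
    refine le_trans (le_of_eq (Finset.sum_congr rfl fun u hu => ?_))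
      (hcrit.sum_card_adj_le W fun u hu => ((hWm u).1 hu).1)
    unfold deg4Nbrs
    congr 1
    ext x
    simp only [Finset.mem_filter, Finset.mem_univ, true_and]
    exact ⟨fun h => ⟨hclosed u hu x h.1 h.2, h.1⟩, fun h => ⟨h.2, ((hWm x).1 h.1).1⟩⟩
  have h2 : ∀ u ∈ F, 1 + (if u ∈ W then 2 else 0) ≤
      pickBound G u + if u ∈ W then deg4Nbrs G u else 0 := by
    intro u hu
    rw [hFm] at hu
    unfold pickBound
    by_cases huW : u ∈ W
    · rw [if_pos huW, if_pos huW]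
      have := (hWm u).1 huW
      rw [if_neg this.2.1]
      split_ifs <;> omega
    · rw [if_neg huW, if_neg huW]
      rcases Nat.eq_zero_or_pos (deg4Nbrs G u) with h0 | h0
      · rw [if_pos h0]; omega
      · have hs : OnShortPath G u := by
          by_contra hs
          exact huW ((hWm u).2 ⟨hu, hs, h0⟩)
        have h12 : deg4Nbrs G u = 1 ∨ deg4Nbrs G u = 2 := by
          obtain ⟨b, hb, hkb, hbn, rfl | hub⟩ := hs
          · exact Or.inr hkb
          · exact Or.inl (hbn u hub.symm hu)
        rcases h12 with h | h <;> simp [h, hs]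
  have h3 := Finset.sum_le_sum h2
  rw [Finset.sum_add_distrib, Finset.sum_add_distrib, Finset.sum_ite_mem, Finset.sum_ite_mem,
    Finset.inter_eq_right.2 hWF] at h3
  simp only [Finset.sum_const, smul_eq_mul] at h3
  omega

/-- The configuration of picked edges obtained from a counterexample with maximum degree 5. -/
theorem exists_picks_of_not_lt {G : SimpleGraph V} [DecidableRel G.Adj]
    (hΔ : G.maxDegree = 5) (hcrit : ListEdgeCritical G 6)
    (hcon : 2 * (Finset.univ.filter fun v : V => G.degree v = 5).card ≤
      2 * (Finset.univ.filter fun v : V => G.degree v = 3).card +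
        (Finset.univ.filter fun v : V => G.degree v = 4).card) :
    ∃ Z : Finset V, Z.Nonempty ∧ (∀ u ∈ Z, G.degree u = 3 ∨ G.degree u = 4 ∧ deg4Nbrs G u ≤ 2) ∧
      ∃ P : V → V → Prop, (∀ u v, P u v → u ∈ Z ∧ G.degree v = 5 ∧ G.Adj u v) ∧
      (∀ u ∈ Z, (Finset.univ.filter fun v => P u v).card ≤ 2) ∧
      (∀ u ∈ Z, G.degree u = 4 → (Finset.univ.filter fun v => P u v).card ≤ pickBound G u) ∧
      (∀ v, G.degree v = 5 → (Finset.univ.filter fun u => P u v).card ≤ 2) ∧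
      ∀ u ∈ Z, ∀ v, G.degree v = 5 → G.Adj u v → ¬ P u v →
        (Finset.univ.filter fun u => P u v).card = 2 := by
  have hpb : ∀ u, pickBound G u ≤ 2 := by
    intro u; unfold pickBound; split_ifs <;> omega
  set Z₀ : Finset V := (Finset.univ.filter fun v => G.degree v = 3) ∪
    Finset.univ.filter fun v => G.degree v = 4 ∧ deg4Nbrs G v ≤ 2 with hZ₀
  set w : V → ℕ := fun u => if G.degree u = 4 then pickBound G u else 2 with hw
  have hsum : ∑ u ∈ Z₀, w u = 2 * (Finset.univ.filter fun v : V => G.degree v = 3).card +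
      ∑ u ∈ Finset.univ.filter fun v => G.degree v = 4, pickBound G u := by
    rw [hZ₀, Finset.sum_union]
    · refine congrArg₂ _ ?_ ?_
      · rw [mul_comm, ← smul_eq_mul, ← Finset.sum_const]
        refine Finset.sum_congr rfl fun u hu => ?_
        have := (Finset.mem_filter.1 hu).2
        rw [hw]; dsimp only; rw [if_neg (by omega)]
      · rw [← Finset.filter_filter, Finset.sum_filter]
        refine Finset.sum_congr rfl fun u hu => ?_
        have h4 := (Finset.mem_filter.1 hu).2
        rw [hw]; dsimp only; rw [if_pos h4]
        by_cases hk : deg4Nbrs G u ≤ 2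
        · rw [if_pos hk]
        · rw [if_neg hk]
          unfold pickBound
          rw [if_neg (by omega), if_neg (by omega), if_neg (by omega)]
    · rw [Finset.disjoint_filter]
      intro v _ h; omega
  have h1 := hcrit.card_le_sum_pickBound
  have hnonempty : Nonempty V := by
    by_contra hne
    rw [not_nonempty_iff] at hne
    rw [SimpleGraph.maxDegree_of_subsingleton] at hΔ
    omega
  have hpos : 0 < (Finset.univ.filter fun v : V => G.degree v = 5).card := by
    obtain ⟨v, hv⟩ := G.exists_maximal_degree_vertex
    exact Finset.card_pos.2 ⟨v, by simp [← hv, hΔ]⟩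
  have hZne : Z₀.Nonempty := by
    by_contra hemp
    rw [Finset.not_nonempty_iff_eq_empty] at hemp
    rw [hemp, Finset.sum_empty] at hsum
    omega
  obtain ⟨Z, hZ, hne, P, hP, hPu, hPv, hPb⟩ := exists_pick_relation G.Adj
    (Finset.univ.filter fun v => G.degree v = 5) w (fun _ => 2) Z₀ hZne (by
      refine (Finset.sum_le_sum fun v _ => min_le_left _ _).trans ?_
      rw [Finset.sum_const, smul_eq_mul]
      omega)
  refine ⟨Z, hne, fun u hu => ?_, P, fun u v h => ?_, fun u hu => ?_, fun u hu h4 => ?_,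
    fun v hv => hPv v (by simp [hv]), fun u hu v hv => hPb u hu v (by simp [hv])⟩
  · simpa [hZ₀] using hZ hu
  · simpa using hP u v h
  · refine (hPu u hu).trans ?_
    rw [hw]; dsimp only
    split_ifs
    · exact hpb u
    · exact le_rfl
  · simpa [hw, h4] using hPu u hu

end

section
variable {V : Type*} [Fintype V]

/-- The number of vertices picked by `u`. -/
noncomputable def pickCount (P : V → V → Prop) (u : V) : ℕ :=
  (Finset.univ.filter fun v => P u v).card

/-- Picked edges between a set `Z` of vertices of degree three or four and vertices of degree
five, with a special pick `s u` for every vertex `u` of degree four having two picks. -/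
structure PickConfig (G : SimpleGraph V) [DecidableRel G.Adj] (Z : Finset V) (P : V → V → Prop)
    (s : V → V) : Prop where
  le : ∀ v, G.degree v ≤ 5
  add : ∀ u v, G.Adj u v → 8 ≤ G.degree u + G.degree v
  deg : ∀ u ∈ Z, G.degree u = 3 ∨ G.degree u = 4 ∧ deg4Nbrs G u ≤ 2
  pick : ∀ u v, P u v → u ∈ Z ∧ G.degree v = 5 ∧ G.Adj u v
  two : ∀ u ∈ Z, pickCount P u ≤ 2
  bound : ∀ u ∈ Z, G.degree u = 4 → pickCount P u ≤ pickBound G u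
  sat : ∀ u ∈ Z, ∀ v, G.degree v = 5 → G.Adj u v → ¬ P u v →
    (Finset.univ.filter fun u => P u v).card = 2
  spec : ∀ u ∈ Z, G.degree u = 4 → pickCount P u = 2 → P u (s u)
  spec_inj : ∀ u ∈ Z, G.degree u = 4 → pickCount P u = 2 → ∀ u' ∈ Z, G.degree u' = 4 →
    pickCount P u' = 2 → s u = s u' → u = u'

theorem exists_pickConfig_of_not_lt {G : SimpleGraph V} [DecidableRel G.Adj]
    (hΔ : G.maxDegree = 5) (hcrit : ListEdgeCritical G 6)
    (hcon : 2 * (Finset.univ.filter fun v : V => G.degree v = 5).card ≤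
      2 * (Finset.univ.filter fun v : V => G.degree v = 3).card +
        (Finset.univ.filter fun v : V => G.degree v = 4).card) :
    ∃ (Z : Finset V) (P : V → V → Prop) (s : V → V), Z.Nonempty ∧ PickConfig G Z P s := by
  obtain ⟨Z, hne, hdeg, P, hP, htwo, hbound, htarget, hsat⟩ :=
    exists_picks_of_not_lt hΔ hcrit hcon
  have : Nonempty V := hne.to_type
  set T : Finset V := Z.filter fun u => G.degree u = 4 ∧ pickCount P u = 2 with hT
  obtain ⟨s, hs, hsP⟩ := exists_injOn_of_hall T (fun u => Finset.univ.filter fun v => P u v) (by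
    intro T' hT'
    have := Finset.card_mul_le_card_mul (s := T')
      (t := T'.biUnion fun u => Finset.univ.filter fun v => P u v) P (m := 2) (n := 2) (by
        intro u hu
        have h2 : pickCount P u = 2 := (Finset.mem_filter.1 (hT' hu)).2.2
        rw [← h2]
        refine Finset.card_le_card fun v hv => ?_
        have hv' := (Finset.mem_filter.1 hv).2
        simp only [Finset.bipartiteAbove, Finset.mem_filter, Finset.mem_biUnion]
        exact ⟨⟨u, hu, Finset.mem_univ v, hv'⟩, hv'⟩) (by
        intro v hv
        obtain ⟨u, -, hu⟩ := Finset.mem_biUnion.1 hv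
        have hu := (Finset.mem_filter.1 hu).2
        refine le_trans (Finset.card_le_card fun w hw => ?_) (htarget v (hP u v hu).2.1)
        simpa using (Finset.mem_filter.1 hw).2)
    omega)
  have hTm : ∀ u ∈ Z, G.degree u = 4 → pickCount P u = 2 → u ∈ T := fun u h1 h2 h3 =>
    Finset.mem_filter.2 ⟨h1, h2, h3⟩
  exact ⟨Z, P, s, hne, fun v => hΔ ▸ G.degree_le_maxDegree v,
    fun u v h => hcrit.degree_add_degree h, hdeg, hP, htwo, hbound, hsat,
    fun u h1 h2 h3 => (Finset.mem_filter.1 (hsP u (hTm u h1 h2 h3))).2,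
    fun u h1 h2 h3 u' h1' h2' h3' h => hs (hTm u h1 h2 h3) (hTm u' h1' h2' h3') h⟩

/-- The edges of `G` with both ends in `Z`. -/
def innerGraph (G : SimpleGraph V) (Z : Finset V) : SimpleGraph V where
  Adj x y := G.Adj x y ∧ x ∈ Z ∧ y ∈ Z
  symm := ⟨fun _ _ h => ⟨h.1.symm, h.2.2, h.2.1⟩⟩
  loopless := ⟨fun _ h => h.1.ne rfl⟩

/-- `b c` is an edge of a component of the inner graph whose removal keeps the rest of the
component connected; `a` is the other inner neighbor of `b`, or `a = c` if there is none. -/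
structure Gadget (G : SimpleGraph V) [DecidableRel G.Adj] (Z : Finset V) (P : V → V → Prop)
    (a b c v : V) : Prop where
  adj_c : (innerGraph G Z).Adj b c
  adj_a : (innerGraph G Z).Adj a b
  only : ∀ y, (innerGraph G Z).Adj b y → y = a ∨ y = c
  reach : ∀ x y, (innerGraph G Z).Reachable b x → (innerGraph G Z).Adj x y → s(x, y) ≠ s(b, c) →
    ((innerGraph G Z).deleteEdges {s(b, c)}).Reachable b x
  big : a ≠ c → pickCount P a ≤ 1 ∧ G.Adj a v ∧ G.degree v = 5 ∧ ¬ P a v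

namespace PickConfig
variable {G : SimpleGraph V} [DecidableRel G.Adj] {Z : Finset V} {P : V → V → Prop} {s : V → V}

theorem degree_inner (h : PickConfig G Z P s) {x y : V} (hxy : (innerGraph G Z).Adj x y) :
    G.degree x = 4 := by
  have h1 := h.add x y hxy.1
  have h2 := h.deg x hxy.2.1
  have h3 := h.deg y hxy.2.2
  omega

theorem degree_eq (h : PickConfig G Z P s) {u y : V} (hu : u ∈ Z) (huy : G.Adj u y) :
    G.degree y = 4 ∨ G.degree y = 5 := by
  have h1 := h.add u y huy
  have h2 := h.deg u hu
  have h3 := h.le y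
  omega

theorem card_unpicked (h : PickConfig G Z P s) {u : V} (hu : u ∈ Z) :
    G.degree u ≤ deg4Nbrs G u + pickCount P u +
      (Finset.univ.filter fun y => G.Adj u y ∧ G.degree y = 5 ∧ ¬ P u y).card := by
  rw [← G.card_neighborFinset_eq_degree]
  unfold deg4Nbrs pickCount
  refine le_trans (Finset.card_le_card ?_) ((Finset.card_union_le _ _).trans
    (Nat.add_le_add_right (Finset.card_union_le _ _) _))
  intro y hy
  rw [SimpleGraph.mem_neighborFinset] at hy
  have := h.degree_eq hu hy
  simp only [Finset.mem_union, Finset.mem_filter, Finset.mem_univ, true_and]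
  tauto

theorem exists_unpicked (h : PickConfig G Z P s) {u : V} (hu : u ∈ Z) (h4 : G.degree u = 4) :
    ∃ y, G.Adj u y ∧ G.degree y = 5 ∧ ¬ P u y := by
  have h1 := h.card_unpicked hu
  have h2 := h.bound u hu h4
  have h3 := h.deg u hu
  have h5 : pickBound G u + deg4Nbrs G u ≤ 3 := by
    unfold pickBound
    split_ifs <;> omega
  obtain ⟨y, hy⟩ := Finset.card_pos.1
    (show 0 < (Finset.univ.filter fun y => G.Adj u y ∧ G.degree y = 5 ∧ ¬ P u y).card by omega)
  exact ⟨y, (Finset.mem_filter.1 hy).2⟩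

theorem eq_of_inner (h : PickConfig G Z P s) {u a c y : V} (ha : (innerGraph G Z).Adj u a)
    (hc : (innerGraph G Z).Adj u c) (hac : a ≠ c) (hy : G.Adj u y) (hy4 : G.degree y = 4) :
    y = a ∨ y = c := by
  by_contra hne
  push Not at hne
  have h1 := h.deg u ha.2.1
  have h2 := h.degree_inner ha
  have h3 : ({a, c, y} : Finset V).card ≤ deg4Nbrs G u := by
    refine Finset.card_le_card fun z hz => ?_
    simp only [Finset.mem_insert, Finset.mem_singleton] at hz
    simp only [Finset.mem_filter, Finset.mem_univ, true_and]
    rcases hz with rfl | rfl | rfl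
    · exact ⟨ha.1, h.degree_inner ha.symm⟩
    · exact ⟨hc.1, h.degree_inner hc.symm⟩
    · exact ⟨hy, hy4⟩
  rw [Finset.card_eq_three.2 ⟨a, c, y, hac, hne.1.symm, hne.2.symm, rfl⟩] at h3
  omega

theorem deg4Nbrs_eq_two (h : PickConfig G Z P s) {u a c : V} (ha : (innerGraph G Z).Adj u a)
    (hc : (innerGraph G Z).Adj u c) (hac : a ≠ c) : deg4Nbrs G u = 2 := by
  have h1 := h.deg u ha.2.1
  have h2 := h.degree_inner ha
  have h3 : ({a, c} : Finset V).card ≤ deg4Nbrs G u := by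
    refine Finset.card_le_card fun z hz => ?_
    simp only [Finset.mem_insert, Finset.mem_singleton] at hz
    simp only [Finset.mem_filter, Finset.mem_univ, true_and]
    rcases hz with rfl | rfl
    · exact ⟨ha.1, h.degree_inner ha.symm⟩
    · exact ⟨hc.1, h.degree_inner hc.symm⟩
  rw [Finset.card_pair hac] at h3
  omega

theorem pickCount_le_one (h : PickConfig G Z P s) {u a : V} (ha : (innerGraph G Z).Adj u a)
    (hu : deg4Nbrs G u = 2) : pickCount P u ≤ 1 := by
  have h1 := h.bound u ha.2.1 (h.degree_inner ha)
  unfold pickBound at h1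
  simpa [hu] using h1

theorem gadget_of_end (h : PickConfig G Z P s) {b c : V} (hbc : (innerGraph G Z).Adj b c)
    (hc : ∀ y, (innerGraph G Z).Adj c y → y = b) {a : V} (ha : (innerGraph G Z).Adj a b)
    (hb : ∀ y, (innerGraph G Z).Adj b y → y = a ∨ y = c)
    (hpick : a ≠ c → pickCount P a ≤ 1) : ∃ v, Gadget G Z P a b c v := by
  obtain ⟨v, hv⟩ := h.exists_unpicked ha.2.1 (h.degree_inner ha)
  refine ⟨v, hbc, ha, hb, ?_, fun hac => ⟨hpick hac, hv⟩⟩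
  intro x y hx hxy hne
  have key : ((innerGraph G Z).deleteEdges {s(b, c)}).Reachable b x ∨ x = c := by
    rw [SimpleGraph.reachable_iff_reflTransGen] at hx
    clear hxy hne
    induction hx with
    | refl => exact Or.inl (SimpleGraph.Reachable.refl _)
    | @tail x y _ hxy ih =>
      rcases ih with ih | rfl
      · by_cases heq : s(x, y) = s(b, c)
        · rw [Sym2.eq_iff] at heq
          rcases heq with ⟨-, rfl⟩ | ⟨-, rfl⟩
          · exact Or.inr rfl
          · exact Or.inl (SimpleGraph.Reachable.refl _)
        · refine Or.inl (ih.trans (SimpleGraph.Adj.reachable ?_))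
          rw [SimpleGraph.deleteEdges_adj]
          exact ⟨hxy, by simpa using heq⟩
      · rw [hc y hxy]
        exact Or.inl (SimpleGraph.Reachable.refl _)
  rcases key with key | rfl
  · exact key
  · rw [hc y hxy] at hne
    exact absurd Sym2.eq_swap hne

theorem exists_gadget (h : PickConfig G Z P s) {x₀ y₀ : V} (h₀ : (innerGraph G Z).Adj x₀ y₀) :
    ∃ a b c v, (innerGraph G Z).Reachable x₀ b ∧ Gadget G Z P a b c v := by
  by_cases hend : ∃ b c, (innerGraph G Z).Reachable x₀ b ∧ (innerGraph G Z).Adj b c ∧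
      ∀ y, (innerGraph G Z).Adj c y → y = b
  · obtain ⟨b, c, hb, hbc, hc⟩ := hend
    by_cases ha : ∃ a, (innerGraph G Z).Adj b a ∧ a ≠ c
    · obtain ⟨a, hba, hac⟩ := ha
      have hk := h.deg4Nbrs_eq_two hba hbc hac
      by_cases hpa : pickCount P a ≤ 1
      · obtain ⟨v, hv⟩ := h.gadget_of_end hbc hc hba.symm
          (fun y hy => h.eq_of_inner hba hbc hac hy.1 (h.degree_inner hy.symm)) fun _ => hpa
        exact ⟨a, b, c, v, hb, hv⟩
      · have hka := deg4Nbrs_pos hba.1.symm (h.degree_inner hba)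
        have hkc := deg4Nbrs_pos hbc.1.symm (h.degree_inner hbc)
        have h1 := h.bound a hba.2.2 (h.degree_inner hba.symm)
        have h2 : deg4Nbrs G a = 1 ∧ ¬ OnShortPath G a := by
          unfold pickBound at h1
          split_ifs at h1 <;> first | omega | exact ⟨by assumption, by assumption⟩
        have h3 : deg4Nbrs G c ≠ 1 := by
          intro h3
          refine h2.2 ⟨b, h.degree_inner hba, hk, fun x hx hx4 => ?_, Or.inr hba.1.symm⟩
          rcases h.eq_of_inner hba hbc hac hx hx4 with rfl | rfl
          · exact h2.1
          · exact h3
        have h5 : deg4Nbrs G c = 2 := by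
          have := h.deg c hbc.2.2
          have := h.degree_inner hbc.symm
          omega
        obtain ⟨v, hv⟩ := h.gadget_of_end hba
          (fun y hy => eq_of_deg4Nbrs_eq_one h2.1 hy.1 (h.degree_inner hy.symm) hba.1.symm
            (h.degree_inner hba)) hbc.symm
          (fun y hy => (h.eq_of_inner hba hbc hac hy.1 (h.degree_inner hy.symm)).symm)
          fun _ => h.pickCount_le_one hbc.symm h5
        exact ⟨c, b, a, v, hb, hv⟩
    · push Not at ha
      obtain ⟨v, hv⟩ := h.gadget_of_end hbc hc hbc.symm (fun y hy => Or.inl (ha y hy))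
        fun h => absurd rfl h
      exact ⟨c, b, c, v, hb, hv⟩
  · push Not at hend
    have hother : ∀ x y, (innerGraph G Z).Reachable x₀ x → (innerGraph G Z).Adj x y →
        ∃ z, (innerGraph G Z).Adj x z ∧ z ≠ y := fun x y hx hxy =>
      hend y x (hx.trans hxy.reachable) hxy.symm
    obtain ⟨a, ha, hac⟩ := hother x₀ y₀ (SimpleGraph.Reachable.refl _) h₀
    have hcyc : ((innerGraph G Z).deleteEdges {s(x₀, y₀)}).Reachable x₀ y₀ := by
      let M : SimpleGraph V :=
        { Adj := fun x y => (innerGraph G Z).Adj x y ∧ (innerGraph G Z).Reachable x₀ x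
          symm := ⟨fun x y h => ⟨h.1.symm, h.2.trans h.1.reachable⟩⟩
          loopless := ⟨fun x h => h.1.ne rfl⟩ }
      have hM : M.IsCycles := by
        rintro x ⟨y, hxy : (innerGraph G Z).Adj x y ∧ (innerGraph G Z).Reachable x₀ x⟩
        obtain ⟨z, hxz, hzy⟩ := hother x y hxy.2 hxy.1
        rw [Set.ncard_eq_two]
        refine ⟨z, y, hzy, ?_⟩
        ext w
        constructor
        · rintro (hw : (innerGraph G Z).Adj x w ∧ (innerGraph G Z).Reachable x₀ x)
          exact h.eq_of_inner hxz hxy.1 hzy hw.1.1 (h.degree_inner hw.1.symm)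
        · rintro (rfl | rfl)
          · exact ⟨hxz, hxy.2⟩
          · exact hxy
      have hle : M ≤ innerGraph G Z := fun x y hxy => hxy.1
      exact (SimpleGraph.IsCycles.reachable_deleteEdges (G := M) (v := x₀) (w := y₀)
        ⟨h₀, SimpleGraph.Reachable.refl _⟩ hM).mono (SimpleGraph.deleteEdges_mono hle)
    have hreach : ∀ x, (innerGraph G Z).Reachable x₀ x →
        ((innerGraph G Z).deleteEdges {s(x₀, y₀)}).Reachable x₀ x := by
      intro x hx
      rw [SimpleGraph.reachable_iff_reflTransGen] at hx
      induction hx with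
      | refl => exact SimpleGraph.Reachable.refl _
      | @tail x y _ hxy ih =>
        by_cases heq : s(x, y) = s(x₀, y₀)
        · rw [Sym2.eq_iff] at heq
          rcases heq with ⟨-, rfl⟩ | ⟨-, rfl⟩
          · exact hcyc
          · exact SimpleGraph.Reachable.refl _
        · refine ih.trans (SimpleGraph.Adj.reachable ?_)
          rw [SimpleGraph.deleteEdges_adj]
          exact ⟨hxy, by simpa using heq⟩
    obtain ⟨z, haz, hz⟩ := hother a x₀ ha.reachable ha.symm
    obtain ⟨v, hv⟩ := h.exists_unpicked ha.2.2 (h.degree_inner ha.symm)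
    exact ⟨a, x₀, y₀, v, SimpleGraph.Reachable.refl _, h₀, ha.symm,
      fun y hy => h.eq_of_inner ha h₀ hac hy.1 (h.degree_inner hy.symm),
      fun x y hx _ _ => hreach x hx,
      fun _ => ⟨h.pickCount_le_one ha.symm (h.deg4Nbrs_eq_two haz ha.symm hz), hv⟩⟩

end PickConfig
end

section
variable {V : Type*} [Fintype V]

/-- The edges colored first in a gadget. -/
noncomputable def gadgetEdges (a b c v : V) : Finset (Sym2 V) :=
  if a = c then {s(b, c)} else {s(a, v), s(b, c)}

/-- `u` has two picks and is the only vertex of `Z` adjacent to its special pick. -/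
def IsTight (G : SimpleGraph V) [DecidableRel G.Adj] (Z : Finset V) (P : V → V → Prop)
    (s : V → V) (u : V) : Prop :=
  u ∈ Z ∧ G.degree u = 4 ∧ pickCount P u = 2 ∧ ∀ w ∈ Z, G.Adj w (s u) → w = u

/-- The edges that gain slack when the edges of a gadget are colored first. -/
def GadgetSlack (G : SimpleGraph V) [DecidableRel G.Adj] (Z : Finset V) (P : V → V → Prop)
    (s : V → V) (a b c : V) (e : Sym2 V) : Prop :=
  (a ≠ c ∧ e = s(a, b)) ∨ ∃ u, (u = b ∨ u = c) ∧ IsTight G Z P s u ∧ e = s(u, s u)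

/-- The excess of lists of size six over the line degree, increased by one where `X` holds. -/
noncomputable def excess (G : SimpleGraph V) [DecidableRel G.Adj] (X : Sym2 V → Prop)
    (e : Sym2 V) : ℤ :=
  ((6 : ℕ) : ℤ) - lineDeg G.edgeFinset e + if X e then 1 else 0

theorem excess_mk {G : SimpleGraph V} [DecidableRel G.Adj] {X : Sym2 V → Prop} {u v : V}
    (h : G.Adj u v) : excess G X s(u, v) = 8 - G.degree u - G.degree v +
      if X s(u, v) then 1 else 0 := by
  have := lineDeg_edgeFinset h
  unfold excess
  omega

theorem le_excess {G : SimpleGraph V} [DecidableRel G.Adj] {X : Sym2 V → Prop} {u v : V}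
    (h : G.Adj u v) : 8 - (G.degree u : ℤ) - G.degree v ≤ excess G X s(u, v) := by
  rw [excess_mk h]
  split_ifs <;> omega

theorem excess_of_slack {G : SimpleGraph V} [DecidableRel G.Adj] {X : Sym2 V → Prop} {u v : V}
    (h : G.Adj u v) (hX : X s(u, v)) :
    excess G X s(u, v) = 9 - (G.degree u : ℤ) - G.degree v := by
  rw [excess_mk h, if_pos hX]
  ring

namespace PickConfig
variable {G : SimpleGraph V} [DecidableRel G.Adj] {Z : Finset V} {P : V → V → Prop} {s : V → V}

theorem not_mem_of_degree (h : PickConfig G Z P s) {v : V} (hv : G.degree v = 5) : v ∉ Z := by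
  intro hZ
  have := h.deg v hZ
  omega

theorem pick_of_tight (h : PickConfig G Z P s) {u : V} (hu : IsTight G Z P s u) : P u (s u) :=
  h.spec u hu.1 hu.2.1 hu.2.2.1

theorem lineDeg_le_of_tight (h : PickConfig G Z P s) {H : Finset (Sym2 V)}
    (hH : H ⊆ edgesMeeting G Z) {u : V} (hu : IsTight G Z P s u) : lineDeg H s(u, s u) ≤ 3 := by
  have hp := h.pick u (s u) (h.pick_of_tight hu)
  have hsZ := h.not_mem_of_degree hp.2.1
  have h3 : (((G.neighborFinset u).erase (s u)).map (starEmb u)).card = 3 := by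
    rw [Finset.card_map, Finset.card_erase_of_mem (by simpa using hp.2.2),
      G.card_neighborFinset_eq_degree, hu.2.1]
  rw [← h3]
  unfold lineDeg
  refine Finset.card_le_card fun e he => ?_
  obtain ⟨heH, hne, w, hw, hwe⟩ := Finset.mem_filter.1 he
  obtain ⟨z, rfl⟩ := hwe
  have hm := mk_mem_edgesMeeting.1 (hH heH)
  rw [Sym2.mem_iff] at hw
  rw [Finset.mem_map]
  rcases hw with rfl | rfl
  · refine ⟨z, ?_, rfl⟩
    rw [Finset.mem_erase, SimpleGraph.mem_neighborFinset]
    exact ⟨fun h => hne (by rw [h]), hm.1⟩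
  · have hz : z ∈ Z := hm.2.resolve_left hsZ
    rw [hu.2.2.2 z hz hm.1.symm] at hne
    exact absurd Sym2.eq_swap hne

theorem six_le_lineDeg_of_inner (h : PickConfig G Z P s) {b c : V} (hbc : (innerGraph G Z).Adj b c)
    {H : Finset (Sym2 V)} (hb : ∀ y, G.Adj b y → s(b, y) ∈ H) (hc : ∀ y, G.Adj c y → s(c, y) ∈ H) :
    6 ≤ lineDeg H s(b, c) := by
  have h1 := lineDeg_edgeFinset hbc.1
  rw [h.degree_inner hbc, h.degree_inner hbc.symm] at h1
  have h2 : lineDeg G.edgeFinset s(b, c) ≤ lineDeg H s(b, c) := by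
    unfold lineDeg
    refine Finset.card_le_card fun e he => ?_
    obtain ⟨heG, hne, w, hw, hwe⟩ := Finset.mem_filter.1 he
    obtain ⟨z, rfl⟩ := hwe
    rw [SimpleGraph.mem_edgeFinset, SimpleGraph.mem_edgeSet] at heG
    refine Finset.mem_filter.2 ⟨?_, hne, w, hw, Sym2.mem_mk_left _ _⟩
    rw [Sym2.mem_iff] at hw
    rcases hw with rfl | rfl
    · exact hb z heG
    · exact hc z heG
  omega

theorem five_le_lineDeg (h : PickConfig G Z P s) {a v : V} (haZ : a ∈ Z) (ha4 : G.degree a = 4)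
    (hav : G.Adj a v) (hv : G.degree v = 5) (hP : ¬ P a v) {H : Finset (Sym2 V)}
    (ha : ∀ y, G.Adj a y → s(a, y) ∈ H) (hPH : ∀ u y, P u y → s(u, y) ∈ H) :
    5 ≤ lineDeg H s(a, v) := by
  have h2 := h.sat a haZ v hv hav hP
  have h3 : (((G.neighborFinset a).erase v).map (starEmb a)).card = 3 := by
    rw [Finset.card_map, Finset.card_erase_of_mem (by simpa using hav),
      G.card_neighborFinset_eq_degree, ha4]
  have h4 : (((G.neighborFinset a).erase v).map (starEmb a) ∪
      (Finset.univ.filter fun u => P u v).map (starEmb v)).card = 5 := by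
    rw [Finset.card_union_of_disjoint, h3, Finset.card_map, h2]
    rw [Finset.disjoint_left]
    intro e he he'
    obtain ⟨x, hx, rfl⟩ := Finset.mem_map.1 he
    obtain ⟨y, hy, hxy⟩ := Finset.mem_map.1 he'
    have hy := (Finset.mem_filter.1 hy).2
    have : s(v, y) = s(a, x) := hxy
    rw [Sym2.eq_iff] at this
    rcases this with ⟨rfl, -⟩ | ⟨rfl, rfl⟩
    · exact hav.ne rfl
    · exact hP hy
  rw [← h4]
  refine Finset.card_le_card fun e he => ?_
  rw [Finset.mem_union] at he
  refine Finset.mem_filter.2 ?_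
  rcases he with he | he
  · obtain ⟨x, hx, rfl⟩ := Finset.mem_map.1 he
    rw [Finset.mem_erase, SimpleGraph.mem_neighborFinset] at hx
    exact ⟨ha x hx.2, edgeConflict_left hx.1.symm⟩
  · obtain ⟨y, hy, rfl⟩ := Finset.mem_map.1 he
    have hy := (Finset.mem_filter.1 hy).2
    have hya : a ≠ y := by rintro rfl; exact hP hy
    have : starEmb v y = s(y, v) := Sym2.eq_swap
    rw [this]
    exact ⟨hPH y v hy, edgeConflict_right hya⟩

end PickConfig
end

section
variable {V : Type*} [Fintype V]

namespace PickConfig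
variable {G : SimpleGraph V} [DecidableRel G.Adj] {Z : Finset V} {P : V → V → Prop} {s : V → V}

theorem extend_gadget (h : PickConfig G Z P s) {a b c v : V} (hg : Gadget G Z P a b c v)
    {H : Finset (Sym2 V)} {X : Sym2 V → Prop} (hHZ : H ⊆ edgesMeeting G Z)
    (hQH : gadgetEdges a b c v ⊆ H)
    (hc : Choosable (H \ gadgetEdges a b c v)
      (excess G fun e => X e ∨ GadgetSlack G Z P s a b c e))
    {A : Sym2 V → Finset ℕ} (hA : ∀ e ∈ H, (lineDeg H e : ℤ) + excess G X e ≤ (A e).card)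
    {f : Sym2 V → ℕ} (hf : IsListColoring (gadgetEdges a b c v) A f)
    (htight : ∀ u, (u = b ∨ u = c) → IsTight G Z P s u → (A s(u, s u)).card ≤ 2 →
      f s(b, c) ∉ A s(u, s u))
    (hbig : a ≠ c → lineDeg (H \ gadgetEdges a b c v) s(a, b) + 1 ≤
      (residualList (gadgetEdges a b c v) f A s(a, b)).card) :
    ∃ f, IsListColoring H A f := by
  obtain ⟨g, hg'⟩ := hc (residualList (gadgetEdges a b c v) f A) fun e he => by
    rw [Finset.mem_sdiff] at he
    by_cases hX : GadgetSlack G Z P s a b c e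
    · rcases hX with ⟨hac, rfl⟩ | ⟨u, hu, ht, rfl⟩
      · have := hbig hac
        rw [excess_of_slack hg.adj_a.1 (Or.inr (Or.inl ⟨hac, rfl⟩)), h.degree_inner hg.adj_a,
          h.degree_inner hg.adj_a.symm]
        push_cast
        omega
      · have hp := h.pick u (s u) (h.pick_of_tight ht)
        rw [excess_of_slack hp.2.2 (Or.inr (Or.inr ⟨u, hu, ht, rfl⟩)), hp.2.1, ht.2.1]
        have h1 := hA _ he.1
        have h2 := le_excess (X := X) hp.2.2
        rw [hp.2.1, ht.2.1] at h2
        have h3 := lineDeg_add_lineDeg_sdiff hQH s(u, s u)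
        push_cast at h2 ⊢
        by_cases hcard : (A s(u, s u)).card ≤ 2
        · have hbcQ : s(b, c) ∈ gadgetEdges a b c v := by
            unfold gadgetEdges; split_ifs <;> simp
          have hsZ := h.not_mem_of_degree hp.2.1
          have hne : s(u, s u) ≠ s(b, c) := by
            intro heq
            rw [Sym2.eq_iff] at heq
            rcases heq with ⟨-, heq⟩ | ⟨-, heq⟩
            · exact hsZ (heq ▸ hg.adj_c.2.2)
            · exact hsZ (heq ▸ hg.adj_c.2.1)
          have h4 : 1 ≤ lineDeg (gadgetEdges a b c v) s(u, s u) := by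
            refine Finset.card_pos.2 ⟨s(b, c), Finset.mem_filter.2 ⟨hbcQ, hne, u, by simp, ?_⟩⟩
            rcases hu with rfl | rfl <;> simp
          have h5 : A s(u, s u) ⊆ residualList (gadgetEdges a b c v) f A s(u, s u) := by
            intro x hx
            refine Finset.mem_sdiff.2 ⟨hx, fun hx' => ?_⟩
            obtain ⟨e, he, rfl⟩ := Finset.mem_image.1 hx'
            obtain ⟨heQ, hconf⟩ := Finset.mem_filter.1 he
            have hbc := htight u hu ht hcard
            unfold gadgetEdges at heQ
            split_ifs at heQ with hac
            · rw [Finset.mem_singleton] at heQ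
              exact hbc (heQ ▸ hx)
            · rw [Finset.mem_insert, Finset.mem_singleton] at heQ
              rcases heQ with rfl | rfl
              · have hb := hg.big hac
                have hvZ := h.not_mem_of_degree hb.2.2.1
                have hau : a ≠ u := by
                  rcases hu with rfl | rfl
                  · exact hg.adj_a.ne
                  · exact hac
                refine not_edgeConflict hau.symm ?_ ?_ ?_ hconf
                · rintro rfl; exact hvZ ht.1
                · intro hsa; exact hsZ (hsa ▸ hg.adj_a.2.1)
                · intro hsv
                  exact hau (ht.2.2.2 a hg.adj_a.2.1 (hsv ▸ hb.2.1))
              · exact hbc hx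
          have h6 := Finset.card_le_card h5
          omega
        · have h4 := h.lineDeg_le_of_tight hHZ ht
          have h5 := card_le_card_residualList_add (gadgetEdges a b c v) f A s(u, s u)
          omega
    · have h1 := hA e he.1
      have h2 := lineDeg_add_lineDeg_sdiff hQH e
      have h3 := card_le_card_residualList_add (gadgetEdges a b c v) f A e
      have h4 : (excess G (fun e => X e ∨ GadgetSlack G Z P s a b c e) e) = excess G X e := by
        unfold excess
        simp only [hX, or_false]
      rw [h4]
      omega
  exact hf.extend hg'

theorem choosable_of_gadget (h : PickConfig G Z P s) {a b c v : V} (hg : Gadget G Z P a b c v)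
    {H : Finset (Sym2 V)} {X : Sym2 V → Prop} (hHZ : H ⊆ edgesMeeting G Z)
    (hH : ∀ u y, (u = a ∨ u = b ∨ u = c) → G.Adj u y → s(u, y) ∈ H)
    (hPH : ∀ u y, P u y → s(u, y) ∈ H)
    (hc : Choosable (H \ gadgetEdges a b c v)
      (excess G fun e => X e ∨ GadgetSlack G Z P s a b c e)) :
    Choosable H (excess G X) := by
  intro A hA
  have hfH : s(b, c) ∈ H := hH b c (by simp) hg.adj_c.1
  have hAf : 6 ≤ (A s(b, c)).card := by
    have h1 := h.six_le_lineDeg_of_inner hg.adj_c (H := H) (fun y => hH b y (by simp))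
      fun y => hH c y (by simp)
    have h2 := le_excess (X := X) hg.adj_c.1
    have h3 := hA _ hfH
    rw [h.degree_inner hg.adj_c, h.degree_inner hg.adj_c.symm] at h2
    push_cast at h2
    omega
  let R : V → Finset ℕ := fun u =>
    if IsTight G Z P s u ∧ (A s(u, s u)).card ≤ 2 then A s(u, s u) else ∅
  have hR : ∀ u, (R u).card ≤ 2 := by
    intro u
    dsimp only [R]
    split_ifs with hu
    · exact hu.2
    · simp
  have hRn : ∀ u, IsTight G Z P s u → (A s(u, s u)).card ≤ 2 → ∀ x, x ∉ R u →
      x ∉ A s(u, s u) := by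
    intro u h1 h2 x hx
    dsimp only [R] at hx
    rwa [if_pos ⟨h1, h2⟩] at hx
  by_cases hac : a = c
  · have hQ : gadgetEdges a b c v = {s(b, c)} := if_pos hac
    obtain ⟨x, hx⟩ : (A s(b, c) \ (R b ∪ R c)).Nonempty := by
      rw [← Finset.card_pos]
      have h1 := Finset.le_card_sdiff (R b ∪ R c) (A s(b, c))
      have h2 := Finset.card_union_le (R b) (R c)
      have h3 := hR b
      have h4 := hR c
      omega
    rw [Finset.mem_sdiff, Finset.mem_union, not_or] at hx
    refine h.extend_gadget hg hHZ (by rw [hQ]; simpa using hfH) hc hA (f := fun _ => x)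
      ⟨?_, ?_⟩ ?_ fun hac' => absurd hac hac'
    · rw [hQ]
      intro e he
      rw [Finset.mem_singleton.1 he]
      exact hx.1
    · rw [hQ]
      intro e he e' he' hconf
      rw [Finset.mem_singleton.1 he, Finset.mem_singleton.1 he'] at hconf
      exact absurd rfl hconf.1
    · rintro u (rfl | rfl) h1 h2
      · exact hRn _ h1 h2 x hx.2.1
      · exact hRn _ h1 h2 x hx.2.2
  · obtain ⟨hpa, hav, hv5, hnP⟩ := hg.big hac
    have hQ : gadgetEdges a b c v = {s(a, v), s(b, c)} := if_neg hac
    have hvZ := h.not_mem_of_degree hv5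
    have hvb : v ≠ b := by rintro rfl; exact hvZ hg.adj_c.2.1
    have hvc : v ≠ c := by rintro rfl; exact hvZ hg.adj_c.2.2
    have hab : a ≠ b := hg.adj_a.ne
    have he₀ : s(a, v) ∈ H := hH a v (by simp) hav
    have hgH : s(a, b) ∈ H := hH a b (by simp) hg.adj_a.1
    have hpb := h.pickCount_le_one hg.adj_c (h.deg4Nbrs_eq_two hg.adj_a.symm hg.adj_c hac)
    have hA₀ : 4 ≤ (A s(a, v)).card := by
      have h1 := h.five_le_lineDeg (H := H) hg.adj_a.2.1 (h.degree_inner hg.adj_a) hav hv5 hnP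
        (fun y => hH a y (by simp)) hPH
      have h2 := le_excess (X := X) hav
      have h3 := hA _ he₀
      rw [h.degree_inner hg.adj_a, hv5] at h2
      push_cast at h2
      omega
    have hB₀ : 4 ≤ (A s(b, c) \ R c).card := by
      have h1 := Finset.le_card_sdiff (R c) (A s(b, c))
      have := hR c
      omega
    have hld : lineDeg H s(a, b) ≤ 6 := by
      have h1 := lineDeg_edgeFinset hg.adj_a.1
      rw [h.degree_inner hg.adj_a, h.degree_inner hg.adj_a.symm] at h1
      have h2 := lineDeg_mono (hHZ.trans (Finset.filter_subset _ _)) s(a, b)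
      omega
    have hAg : lineDeg H s(a, b) ≤ (A s(a, b)).card := by
      have h2 := le_excess (X := X) hg.adj_a.1
      have h3 := hA _ hgH
      rw [h.degree_inner hg.adj_a, h.degree_inner hg.adj_a.symm] at h2
      push_cast at h2
      omega
    obtain ⟨f, hf, -, hfB, hres⟩ := exists_pair_coloring he₀ hfH
      (mk_ne_mk (Or.inl ⟨hab, hac⟩)) (edgeConflict_left hvb.symm)
      (by
        have := edgeConflict_left (u := b) hac
        rwa [Sym2.eq_swap] at this)
      (not_edgeConflict hab hac hvb hvc) (Finset.Subset.refl (A s(a, v)))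
      (Finset.sdiff_subset (s := A s(b, c)) (t := R c)) (Finset.card_pos.1 (by omega))
      (Finset.card_pos.1 (by omega)) hAg (by omega)
    rw [← hQ] at hf hres
    refine h.extend_gadget hg hHZ ?_ hc hA hf ?_ fun _ => hres
    · rw [hQ]
      exact Finset.insert_subset he₀ (Finset.singleton_subset_iff.2 hfH)
    · rintro u (rfl | rfl) h1 h2
      · have := h1.2.2.1
        omega
      · exact hRn _ h1 h2 _ (Finset.mem_sdiff.1 hfB).2

end PickConfig
end

section
variable {V : Type*} [Fintype V]

/-- A choice of one gadget in every nontrivial component of the inner graph. -/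
structure GadgetSystem (G : SimpleGraph V) [DecidableRel G.Adj] (Z : Finset V)
    (P : V → V → Prop) (S : Finset V) (a c v : V → V) : Prop where
  gadget : ∀ b ∈ S, Gadget G Z P (a b) b (c b) (v b)
  sep : ∀ b ∈ S, ∀ b' ∈ S, (innerGraph G Z).Reachable b b' → b = b'
  cover : ∀ x y, (innerGraph G Z).Adj x y → ∃ b ∈ S, (innerGraph G Z).Reachable b x

/-- The edges colored first in all gadgets of a system. -/
noncomputable def systemEdges (S : Finset V) (a c v : V → V) : Finset (Sym2 V) :=
  S.biUnion fun b => gadgetEdges (a b) b (c b) (v b)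

/-- The edges that gain slack in some gadget of a system. -/
def SystemSlack (G : SimpleGraph V) [DecidableRel G.Adj] (Z : Finset V) (P : V → V → Prop)
    (s : V → V) (S : Finset V) (a c : V → V) (e : Sym2 V) : Prop :=
  ∃ b ∈ S, GadgetSlack G Z P s (a b) b (c b) e

theorem PickConfig.exists_gadgetSystem {G : SimpleGraph V} [DecidableRel G.Adj] {Z : Finset V}
    {P : V → V → Prop} {s : V → V} (h : PickConfig G Z P s) :
    ∃ (S : Finset V) (a c v : V → V), GadgetSystem G Z P S a c v := by
  have key : ∀ K : (innerGraph G Z).ConnectedComponent, ∃ b a c v,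
      (∃ x y, (innerGraph G Z).Adj x y ∧ (innerGraph G Z).connectedComponentMk x = K) →
      (innerGraph G Z).connectedComponentMk b = K ∧ Gadget G Z P a b c v := by
    intro K
    by_cases hK : ∃ x y, (innerGraph G Z).Adj x y ∧ (innerGraph G Z).connectedComponentMk x = K
    · obtain ⟨x, y, hxy, hx⟩ := hK
      obtain ⟨a, b, c, v, hb, hg⟩ := h.exists_gadget hxy
      exact ⟨b, a, c, v, fun _ => ⟨by rw [← hx, SimpleGraph.ConnectedComponent.eq]; exact hb.symm, hg⟩⟩
    · induction K using SimpleGraph.ConnectedComponent.ind with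
      | h x => exact ⟨x, x, x, x, fun h => absurd h hK⟩
  choose b a c v hF using key
  refine ⟨Finset.univ.filter fun x => b ((innerGraph G Z).connectedComponentMk x) = x ∧
    ∃ y, (innerGraph G Z).Adj x y, fun x => a ((innerGraph G Z).connectedComponentMk x),
    fun x => c ((innerGraph G Z).connectedComponentMk x),
    fun x => v ((innerGraph G Z).connectedComponentMk x), ?_, ?_, ?_⟩
  · intro x hx
    obtain ⟨-, hbx, y, hxy⟩ := Finset.mem_filter.1 hx
    have := (hF _ ⟨x, y, hxy, rfl⟩).2
    rwa [hbx] at this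
  · intro x hx x' hx' hr
    obtain ⟨-, hbx, -⟩ := Finset.mem_filter.1 hx
    obtain ⟨-, hbx', -⟩ := Finset.mem_filter.1 hx'
    rw [← hbx, ← hbx', SimpleGraph.ConnectedComponent.sound hr]
  · intro x y hxy
    obtain ⟨h1, h2⟩ := hF _ ⟨x, y, hxy, rfl⟩
    refine ⟨_, Finset.mem_filter.2 ⟨Finset.mem_univ _, by rw [h1], _, h2.adj_c⟩, ?_⟩
    exact SimpleGraph.ConnectedComponent.exact h1

namespace GadgetSystem
variable {G : SimpleGraph V} [DecidableRel G.Adj] {Z : Finset V} {P : V → V → Prop} {s : V → V}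
  {S : Finset V} {a c v : V → V}

theorem mem_systemEdges (h : PickConfig G Z P s) (hS : GadgetSystem G Z P S a c v) {u y : V}
    (hu : u ∈ Z) : s(u, y) ∈ systemEdges S a c v ↔ ∃ b ∈ S,
      u = a b ∧ y = v b ∧ a b ≠ c b ∨ u = b ∧ y = c b ∨ u = c b ∧ y = b := by
  unfold systemEdges
  rw [Finset.mem_biUnion]
  refine exists_congr fun b => and_congr_right fun hb => ?_
  have hg := hS.gadget b hb
  unfold gadgetEdges
  split_ifs with hac
  · rw [Finset.mem_singleton, Sym2.eq_iff]
    tauto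
  · rw [Finset.mem_insert, Finset.mem_singleton, Sym2.eq_iff, Sym2.eq_iff]
    have : u ≠ v b := by
      rintro rfl
      exact h.not_mem_of_degree (hg.big hac).2.2.1 hu
    tauto

theorem reachable_of_mem (hS : GadgetSystem G Z P S a c v) {b u : V} (hb : b ∈ S)
    (hu : u = a b ∨ u = b ∨ u = c b) : (innerGraph G Z).Reachable b u := by
  have hg := hS.gadget b hb
  rcases hu with rfl | rfl | rfl
  · exact hg.adj_a.reachable.symm
  · exact SimpleGraph.Reachable.refl _
  · exact hg.adj_c.reachable

theorem eq_of_mem (hS : GadgetSystem G Z P S a c v) {b b' u : V} (hb : b ∈ S) (hb' : b' ∈ S)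
    (hu : u = a b ∨ u = b ∨ u = c b) (hu' : u = a b' ∨ u = b' ∨ u = c b') : b = b' :=
  hS.sep b hb b' hb' ((hS.reachable_of_mem hb hu).trans (hS.reachable_of_mem hb' hu').symm)

theorem exists_of_mem (h : PickConfig G Z P s) (hS : GadgetSystem G Z P S a c v) {u y : V}
    (hu : u ∈ Z) (hQ : s(u, y) ∈ systemEdges S a c v) :
    ∃ b ∈ S, (u = a b ∨ u = b ∨ u = c b) ∧ G.degree u = 4 := by
  obtain ⟨b, hb, hQ⟩ := (hS.mem_systemEdges h hu).1 hQ
  have hg := hS.gadget b hb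
  refine ⟨b, hb, by tauto, ?_⟩
  rcases hQ with ⟨rfl, -⟩ | ⟨rfl, -⟩ | ⟨rfl, -⟩
  · exact h.degree_inner hg.adj_a
  · exact h.degree_inner hg.adj_c
  · exact h.degree_inner hg.adj_c.symm

theorem eq_of_mem_systemEdges (h : PickConfig G Z P s) (hS : GadgetSystem G Z P S a c v)
    {u y y' : V} (hu : u ∈ Z) (hy : s(u, y) ∈ systemEdges S a c v)
    (hy' : s(u, y') ∈ systemEdges S a c v) : y = y' := by
  obtain ⟨b, hb, hQ⟩ := (hS.mem_systemEdges h hu).1 hy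
  obtain ⟨b', hb', hQ'⟩ := (hS.mem_systemEdges h hu).1 hy'
  obtain rfl := hS.eq_of_mem (u := u) hb hb' (by tauto) (by tauto)
  have hg := hS.gadget b hb
  have h1 := hg.adj_a.ne
  have h2 := hg.adj_c.ne
  grind

theorem not_mem_of_pick (h : PickConfig G Z P s) (hS : GadgetSystem G Z P S a c v) {u y : V}
    (hP : P u y) : s(u, y) ∉ systemEdges S a c v := by
  intro hQ
  have hp := h.pick u y hP
  have hyZ := h.not_mem_of_degree hp.2.1
  obtain ⟨b, hb, hQ⟩ := (hS.mem_systemEdges h hp.1).1 hQ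
  have hg := hS.gadget b hb
  rcases hQ with ⟨rfl, rfl, hac⟩ | ⟨rfl, rfl⟩ | ⟨rfl, rfl⟩
  · exact (hg.big hac).2.2.2 hP
  · exact hyZ hg.adj_c.2.2
  · exact hyZ hg.adj_c.2.1

theorem mem_of_pickCount (h : PickConfig G Z P s) (hS : GadgetSystem G Z P S a c v) {u y : V}
    (hu : u ∈ Z) (hQ : s(u, y) ∈ systemEdges S a c v) (h2 : pickCount P u = 2) :
    ∃ b ∈ S, u = b ∨ u = c b := by
  obtain ⟨b, hb, hQ⟩ := (hS.mem_systemEdges h hu).1 hQ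
  have hg := hS.gadget b hb
  refine ⟨b, hb, ?_⟩
  rcases hQ with ⟨rfl, -, hac⟩ | ⟨rfl, -⟩ | ⟨rfl, -⟩
  · have := (hg.big hac).1
    omega
  · exact Or.inl rfl
  · exact Or.inr rfl

theorem choosable (h : PickConfig G Z P s) (hS : GadgetSystem G Z P S a c v)
    (hc : Choosable (edgesMeeting G Z \ systemEdges S a c v)
      (excess G (SystemSlack G Z P s S a c))) :
    Choosable (edgesMeeting G Z) (excess G fun _ => False) := by
  have key : ∀ T ⊆ S, Choosable (edgesMeeting G Z \ systemEdges T a c v)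
      (excess G (SystemSlack G Z P s T a c)) →
      Choosable (edgesMeeting G Z) (excess G fun _ => False) := by
    intro T
    induction T using Finset.induction with
    | empty =>
      intro _ hT
      have h1 : SystemSlack G Z P s ∅ a c = fun _ => False := by
        funext e
        simp [SystemSlack]
      rw [h1] at hT
      simpa [systemEdges] using hT
    | @insert b T hbT ih =>
      intro hTS hT
      have hbS : b ∈ S := hTS (Finset.mem_insert_self b T)
      have hTS' : T ⊆ S := (Finset.subset_insert b T).trans hTS
      have hg := hS.gadget b hbS
      have hsub : systemEdges T a c v ⊆ systemEdges S a c v :=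
        Finset.biUnion_subset_biUnion_of_subset_left _ hTS'
      refine ih hTS' (h.choosable_of_gadget hg Finset.sdiff_subset ?_ ?_ ?_)
      · intro u y hu hy
        have huZ : u ∈ Z := by
          rcases hu with rfl | rfl | rfl
          · exact hg.adj_a.2.1
          · exact hg.adj_c.2.1
          · exact hg.adj_c.2.2
        refine Finset.mem_sdiff.2 ⟨mk_mem_edgesMeeting.2 ⟨hy, Or.inl huZ⟩, fun hQ => hbT ?_⟩
        obtain ⟨b', hb', hQ⟩ := Finset.mem_biUnion.1 hQ
        have hb'S := hTS' hb'
        have hg' := hS.gadget b' hb'S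
        have hmem : u = a b' ∨ u = b' ∨ u = c b' := by
          unfold gadgetEdges at hQ
          split_ifs at hQ with hac
          · rw [Finset.mem_singleton, Sym2.eq_iff] at hQ
            tauto
          · rw [Finset.mem_insert, Finset.mem_singleton, Sym2.eq_iff, Sym2.eq_iff] at hQ
            have : u ≠ v b' := by
              rintro rfl
              exact h.not_mem_of_degree (hg'.big hac).2.2.1 huZ
            tauto
        rwa [hS.eq_of_mem hbS hb'S hu hmem]
      · intro u y hP
        have hp := h.pick u y hP
        exact Finset.mem_sdiff.2 ⟨mk_mem_edgesMeeting.2 ⟨hp.2.2, Or.inl hp.1⟩,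
          fun hQ => hS.not_mem_of_pick h hP (hsub hQ)⟩
      · have h1 : (fun e => SystemSlack G Z P s T a c e ∨ GadgetSlack G Z P s (a b) b (c b) e) =
            SystemSlack G Z P s (insert b T) a c := by
          funext e
          simp [SystemSlack, or_comm]
        have h2 : (edgesMeeting G Z \ systemEdges T a c v) \ gadgetEdges (a b) b (c b) (v b) =
            edgesMeeting G Z \ systemEdges (insert b T) a c v := by
          rw [systemEdges, systemEdges, Finset.biUnion_insert, Finset.union_comm, sdiff_sdiff]
          rfl
        rw [h1, h2]
        exact hT
  exact key S Finset.Subset.rfl hc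

end GadgetSystem
end

theorem exists_adj_dist_lt {V : Type*} {G : SimpleGraph V} {b x : V} (hr : G.Reachable b x) (hx : x ≠ b) :
    ∃ x', G.Adj x' x ∧ G.dist b x' < G.dist b x := by
  obtain ⟨p, hp⟩ := hr.symm.exists_walk_length_eq_dist
  cases p with
  | nil => exact absurd rfl hx
  | @cons _ x' _ hxx' p =>
    refine ⟨x', hxx'.symm, ?_⟩
    rw [G.dist_comm, G.dist_comm (u := b) (v := x), ← hp]
    exact Nat.lt_succ_of_le (SimpleGraph.dist_le p)

section
variable {V : Type*} [Fintype V]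

namespace GadgetSystem
variable {G : SimpleGraph V} [DecidableRel G.Adj] {Z : Finset V} {P : V → V → Prop} {s : V → V}
  {S : Finset V} {a c v : V → V}

theorem choosable_inner (h : PickConfig G Z P s) (hS : GadgetSystem G Z P S a c v)
    {J : Finset (Sym2 V)} (hJ : ∀ x y, s(x, y) ∈ J ↔
      (innerGraph G Z).Adj x y ∧ s(x, y) ∉ systemEdges S a c v) :
    Choosable J (excess G (SystemSlack G Z P s S a c)) := by
  have hrep : ∀ x, ∃ b, ∀ y, (innerGraph G Z).Adj x y →
      b ∈ S ∧ (innerGraph G Z).Reachable b x := by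
    intro x
    by_cases hx : ∃ y, (innerGraph G Z).Adj x y
    · obtain ⟨y, hxy⟩ := hx
      obtain ⟨b, hb⟩ := hS.cover x y hxy
      exact ⟨b, fun _ _ => hb⟩
    · exact ⟨x, fun y hxy => absurd ⟨y, hxy⟩ hx⟩
  choose rep hrep using hrep
  let N : V → SimpleGraph V := fun b => (innerGraph G Z).deleteEdges {s(b, c b)}
  let ρ : V → ℕ := fun y => (N (rep y)).dist (rep y) y
  have hstep : ∀ x y, (innerGraph G Z).Adj x y → s(x, y) ∉ systemEdges S a c v → ρ x ≤ ρ y →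
      1 ≤ excess G (SystemSlack G Z P s S a c) s(x, y) ∨
        ∃ e' ∈ J, EdgeConflict s(x, y) e' ∧ endSum ρ e' < endSum ρ s(x, y) := by
    intro x y hxy hQ hle
    obtain ⟨hbS, hbx⟩ := hrep x y hxy
    have hg := hS.gadget _ hbS
    have hnbc : s(x, y) ≠ s(rep x, c (rep x)) := by
      intro heq
      apply hQ
      rw [heq, hS.mem_systemEdges h hg.adj_c.2.1]
      exact ⟨_, hbS, Or.inr (Or.inl ⟨rfl, rfl⟩)⟩
    have hr : (N (rep x)).Reachable (rep x) x := hg.reach x y hbx hxy hnbc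
    rcases eq_or_ne x (rep x) with hxb | hxb
    · left
      have hya : y = a (rep x) := by
        refine (hg.only y (by rwa [← hxb])).resolve_right fun hyc => hnbc ?_
        rw [← hyc, ← hxb]
      have hac : a (rep x) ≠ c (rep x) := by
        intro hac
        apply hnbc
        rw [← hac, ← hya, ← hxb]
      rw [excess_of_slack hxy.1, h.degree_inner hxy, h.degree_inner hxy.symm]
      · norm_num
      · refine ⟨_, hbS, Or.inl ⟨hac, ?_⟩⟩
        rw [← hya, ← hxb]
        exact Sym2.eq_swap
    · right
      obtain ⟨x', hadj, hlt⟩ := exists_adj_dist_lt hr hxb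
      have hadj' : (innerGraph G Z).Adj x' x := ((SimpleGraph.deleteEdges_adj ..).1 hadj).1
      have hne : s(x', x) ≠ s(rep x, c (rep x)) := by
        simpa using ((SimpleGraph.deleteEdges_adj ..).1 hadj).2
      obtain ⟨hbS', hbx'⟩ := hrep x' x hadj'
      obtain ⟨hbS'', hby⟩ := hrep y x hxy.symm
      have hx' : rep x' = rep x := hS.sep _ hbS' _ hbS
        ((hbx'.trans hadj'.reachable).trans hbx.symm)
      have hy : rep y = rep x := hS.sep _ hbS'' _ hbS
        ((hby.trans hxy.symm.reachable).trans hbx.symm)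
      have hlt' : ρ x' < ρ x := by
        dsimp only [ρ]
        rw [hx']
        exact hlt
      refine ⟨s(x', x), (hJ x' x).2 ⟨hadj', fun hQ' => ?_⟩, ?_, ?_⟩
      · obtain ⟨b', hb', hQ'⟩ := (hS.mem_systemEdges h hadj'.2.1).1 hQ'
        have hb'x : b' = rep x := hS.sep _ hb' _ hbS
          (((hS.reachable_of_mem hb' (u := x') (by tauto)).trans hadj'.reachable).trans hbx.symm)
        have hg' := hS.gadget b' hb'
        rcases hQ' with ⟨-, rfl, hac⟩ | ⟨rfl, hxc⟩ | ⟨hxc, rfl⟩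
        · exact h.not_mem_of_degree (hg'.big hac).2.2.1 hadj'.2.2
        · exact hne (by rw [← hb'x, ← hxc])
        · exact hxb hb'x
      · have : x' ≠ y := by
          rintro rfl
          omega
        have hconf := edgeConflict_left (u := x) this.symm
        rwa [Sym2.eq_swap (a := x) (b := x')] at hconf
      · rw [endSum_mk, endSum_mk]
        omega
  refine choosable_of_rank _ (endSum ρ) J (fun e he => ?_) fun e he => ?_
  · induction e using Sym2.ind with
    | h x y =>
      have hxy := ((hJ x y).1 he).1
      have := le_excess (X := SystemSlack G Z P s S a c) hxy.1
      rw [h.degree_inner hxy, h.degree_inner hxy.symm] at this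
      push_cast at this
      omega
  · induction e using Sym2.ind with
    | h x y =>
      obtain ⟨hxy, hQ⟩ := (hJ x y).1 he
      rcases le_total (ρ x) (ρ y) with hle | hle
      · exact hstep x y hxy hQ hle
      · rw [Sym2.eq_swap] at hQ ⊢
        exact hstep y x hxy.symm hQ hle

end GadgetSystem
end

section
variable {V : Type*} [Fintype V]

namespace GadgetSystem
variable {G : SimpleGraph V} [DecidableRel G.Adj] {Z : Finset V} {P : V → V → Prop} {s : V → V}
  {S : Finset V} {a c v : V → V}

/-- The neighbors of `u` along edges that are neither picked nor colored first. -/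
noncomputable def freeNbrs (G : SimpleGraph V) [DecidableRel G.Adj] (P : V → V → Prop)
    (Q : Finset (Sym2 V)) (u : V) : Finset V :=
  (G.neighborFinset u).filter fun y => ¬ P u y ∧ s(u, y) ∉ Q

theorem mem_freeNbrs {Q : Finset (Sym2 V)} {u y : V} :
    y ∈ freeNbrs G P Q u ↔ G.Adj u y ∧ ¬ P u y ∧ s(u, y) ∉ Q := by
  unfold freeNbrs
  rw [Finset.mem_filter, SimpleGraph.mem_neighborFinset]

theorem card_freeNbrs (Q : Finset (Sym2 V)) (u : V) :
    G.degree u ≤ (freeNbrs G P Q u).card + pickCount P u +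
      (Finset.univ.filter fun y => s(u, y) ∈ Q).card := by
  rw [← G.card_neighborFinset_eq_degree]
  refine le_trans (Finset.card_le_card ?_) ((Finset.card_union_le _ _).trans
    (Nat.add_le_add_right (Finset.card_union_le _ _) _))
  intro y hy
  rw [SimpleGraph.mem_neighborFinset] at hy
  rw [Finset.mem_union, Finset.mem_union, mem_freeNbrs, Finset.mem_filter, Finset.mem_filter]
  have := Finset.mem_univ y
  tauto

theorem choosable_boundary (h : PickConfig G Z P s) (hS : GadgetSystem G Z P S a c v) :
    Choosable (edgesMeeting G Z \ systemEdges S a c v)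
      (excess G (SystemSlack G Z P s S a c)) := by
  set Q := systemEdges S a c v with hQdef
  set H := edgesMeeting G Z \ Q with hH
  have hHm : ∀ u y, s(u, y) ∈ H ↔ (G.Adj u y ∧ (u ∈ Z ∨ y ∈ Z)) ∧ s(u, y) ∉ Q := by
    intro u y
    rw [hH, Finset.mem_sdiff, mk_mem_edgesMeeting]
  have hinner : ∀ x y, x ∈ Z → y ∈ Z → s(x, y) ∉ boundaryEdges H Z := by
    intro x y hx hy hb
    obtain ⟨-, u, hu, w, hw, heq⟩ := mem_boundaryEdges.1 hb
    rw [Sym2.eq_iff] at heq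
    rcases heq with ⟨-, rfl⟩ | ⟨rfl, -⟩
    · exact hw hy
    · exact hw hx
  let IsSpec : V → V → Prop := fun u w => G.degree u = 4 ∧ pickCount P u = 2 ∧ s u = w
  let ca : V → V → ℕ := fun u w =>
    if P u w then (if IsSpec u w then 1 else 0) else if G.degree w = 5 then 3 else 2
  let cb : V → V → ℕ := fun u w => if P u w then (if IsSpec u w then 1 else 2) else 0
  have hca0 : ∀ u w, P u w → ¬ IsSpec u w → ca u w = 0 := fun u w h1 h2 => by simp [ca, h1, h2]
  have hca1 : ∀ u w, P u w → ca u w ≤ 1 := fun u w h1 => by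
    dsimp only [ca]; rw [if_pos h1]; split_ifs <;> omega
  have hcaS : ∀ u w, P u w → IsSpec u w → ca u w = 1 := fun u w h1 h2 => by simp [ca, h1, h2]
  have hca2 : ∀ u w, ¬ P u w → 2 ≤ ca u w := fun u w h1 => by
    dsimp only [ca]; rw [if_neg h1]; split_ifs <;> omega
  have hcb0 : ∀ u w, ¬ P u w → cb u w = 0 := fun u w h1 => by simp [cb, h1]
  have hcb1 : ∀ u w, P u w → 1 ≤ cb u w := fun u w h1 => by
    dsimp only [cb]; rw [if_pos h1]; split_ifs <;> omega
  have hcbS : ∀ u w, P u w → IsSpec u w → cb u w = 1 := fun u w h1 h2 => by simp [cb, h1, h2]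
  have hcb2 : ∀ u w, P u w → ¬ IsSpec u w → cb u w = 2 := fun u w h1 h2 => by simp [cb, h1, h2]
  have hPH : ∀ u w, P u w → s(u, w) ∈ H := fun u w hP =>
    have hp := h.pick u w hP
    (hHm u w).2 ⟨⟨hp.2.2, Or.inl hp.1⟩, hS.not_mem_of_pick h hP⟩
  have hQcard : ∀ u ∈ Z, (Finset.univ.filter fun y => s(u, y) ∈ Q).card ≤ 1 := by
    intro u hu
    rw [Finset.card_le_one]
    intro y hy y' hy'
    exact hS.eq_of_mem_systemEdges h hu (Finset.mem_filter.1 hy).2 (Finset.mem_filter.1 hy').2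
  have hfree : ∀ u ∈ Z, ∀ w, P u w → (freeNbrs G P Q u).map (starEmb u) ⊆ H ∧
      ∀ e' ∈ (freeNbrs G P Q u).map (starEmb u), EdgeConflict s(u, w) e' ∧
        (e' ∉ boundaryEdges H Z ∨ (∃ w' ∉ Z, e' = s(u, w') ∧ ca u w < ca u w') ∨
          ∃ u' ∈ Z, e' = s(u', w) ∧ cb u w < cb u' w) := by
    intro u hu w hP
    refine ⟨fun e' he' => ?_, fun e' he' => ?_⟩
    · obtain ⟨y, hy, rfl⟩ := Finset.mem_map.1 he'
      rw [mem_freeNbrs] at hy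
      exact (hHm u y).2 ⟨⟨hy.1, Or.inl hu⟩, hy.2.2⟩
    · obtain ⟨y, hy, rfl⟩ := Finset.mem_map.1 he'
      rw [mem_freeNbrs] at hy
      have hwy : w ≠ y := by rintro rfl; exact hy.2.1 hP
      refine ⟨edgeConflict_left hwy, ?_⟩
      by_cases hyZ : y ∈ Z
      · exact Or.inl (hinner u y hu hyZ)
      · refine Or.inr (Or.inl ⟨y, hyZ, rfl, ?_⟩)
        have := hca1 u w hP
        have := hca2 u y hy.2.1
        omega
  refine choosable_of_boundary Z H _ ca cb ?_ ?_
  · intro u hu w hw huw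
    obtain ⟨⟨hadj, -⟩, huwQ⟩ := (hHm u w).1 huw
    have hex := le_excess (X := SystemSlack G Z P s S a c) hadj
    have hdu := h.deg u hu
    by_cases hP : P u w
    · have hp := h.pick u w hP
      obtain ⟨hsub, hconf⟩ := hfree u hu w hP
      have hcard := card_freeNbrs (G := G) (P := P) Q u
      have htwo := h.two u hu
      have hQ1 := hQcard u hu
      by_cases hsimple : 1 ≤ ((freeNbrs G P Q u).card : ℤ) +
          excess G (SystemSlack G Z P s S a c) s(u, w)
      · exact ⟨_, hsub, by rwa [Finset.card_map], hconf⟩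
      rw [hp.2.1] at hex
      have hQ4 : (Finset.univ.filter fun y => s(u, y) ∈ Q).card ≠ 0 → G.degree u = 4 := by
        intro hne
        obtain ⟨y, hy⟩ := Finset.card_pos.1 (Nat.pos_of_ne_zero hne)
        obtain ⟨_, _, _, hd⟩ := hS.exists_of_mem h hu (Finset.mem_filter.1 hy).2
        exact hd
      have h4 : G.degree u = 4 := by
        by_contra h4
        have := mt hQ4 h4
        push_cast at hex
        omega
      have hpick2 : pickCount P u = 2 := by
        push_cast at hex
        omega
      have hfree1 : 1 ≤ (freeNbrs G P Q u).card := by omega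
      obtain ⟨y, hy⟩ := Finset.card_pos.1
        (show 0 < (Finset.univ.filter fun y => s(u, y) ∈ Q).card by push_cast at hex; omega)
      obtain ⟨b, hb, hub⟩ := hS.mem_of_pickCount h hu (Finset.mem_filter.1 hy).2 hpick2
      have hextra : ∀ e, e ∉ (freeNbrs G P Q u).map (starEmb u) → 1 ≤
          ((insert e ((freeNbrs G P Q u).map (starEmb u))).card : ℤ) +
            excess G (SystemSlack G Z P s S a c) s(u, w) := by
        intro e he
        rw [Finset.card_insert_of_notMem he, Finset.card_map]
        push_cast at hex ⊢
        omega
      by_cases hsw : s u = w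
      · obtain ⟨u', hu'Z, hu'w, hu'⟩ : ∃ u' ∈ Z, G.Adj u' w ∧ u' ≠ u := by
          by_contra hno
          push Not at hno
          have ht : IsTight G Z P s u := ⟨hu, h4, hpick2, by rw [hsw]; exact hno⟩
          rw [excess_of_slack hadj ⟨b, hb, Or.inr ⟨u, hub, ht, by rw [hsw]⟩⟩, h4, hp.2.1] at hsimple
          push_cast at hsimple
          omega
        obtain ⟨u₁, hP₁, hu₁⟩ : ∃ u₁, P u₁ w ∧ u₁ ≠ u := by
          by_cases hP' : P u' w
          · exact ⟨u', hP', hu'⟩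
          · have h2 := h.sat u' hu'Z w hp.2.1 hu'w hP'
            obtain ⟨u₁, hm, hne⟩ := Finset.exists_mem_ne
              (show 1 < (Finset.univ.filter fun u => P u w).card by omega) u
            exact ⟨u₁, (Finset.mem_filter.1 hm).2, hne⟩
        have hp₁ := h.pick u₁ w hP₁
        refine ⟨insert s(u₁, w) ((freeNbrs G P Q u).map (starEmb u)),
          Finset.insert_subset (hPH u₁ w hP₁) hsub, hextra _ ?_, fun e' he' => ?_⟩
        · intro hm
          obtain ⟨z, -, hz⟩ := Finset.mem_map.1 hm
          have hz : s(u, z) = s(u₁, w) := hz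
          rw [Sym2.eq_iff] at hz
          rcases hz with ⟨rfl, -⟩ | ⟨rfl, -⟩
          · exact hu₁ rfl
          · exact hw hu
        · rcases Finset.mem_insert.1 he' with rfl | he'
          · refine ⟨edgeConflict_right hu₁.symm, Or.inr (Or.inr ⟨u₁, hp₁.1, rfl, ?_⟩)⟩
            rw [hcbS u w hP ⟨h4, hpick2, hsw⟩, hcb2 u₁ w hP₁ fun hsp => hu₁
              (h.spec_inj u₁ hp₁.1 hsp.1 hsp.2.1 u hu h4 hpick2 (hsp.2.2.trans hsw.symm))]
            norm_num
          · exact hconf e' he'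
      · have hPs := h.spec u hu h4 hpick2
        have hps := h.pick u (s u) hPs
        refine ⟨insert s(u, s u) ((freeNbrs G P Q u).map (starEmb u)),
          Finset.insert_subset (hPH u _ hPs) hsub, hextra _ ?_, fun e' he' => ?_⟩
        · intro hm
          obtain ⟨z, hz, hzs⟩ := Finset.mem_map.1 hm
          obtain rfl : z = s u := Sym2.congr_right.1 hzs
          exact (mem_freeNbrs.1 hz).2.1 hPs
        · rcases Finset.mem_insert.1 he' with rfl | he'
          · refine ⟨edgeConflict_left (Ne.symm hsw),
              Or.inr (Or.inl ⟨s u, h.not_mem_of_degree hps.2.1, rfl, ?_⟩)⟩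
            rw [hca0 u w hP fun hsp => hsw hsp.2.2, hcaS u (s u) hPs ⟨h4, hpick2, rfl⟩]
            norm_num
          · exact hconf e' he'
    · rcases h.degree_eq hu hadj with hw4 | hw5
      · have h4 : G.degree u = 4 := by
          have := h.add u w hadj
          omega
        rw [h4, hw4] at hex
        obtain ⟨y, huy, hy5, hPy⟩ := h.exists_unpicked hu h4
        have hyZ := h.not_mem_of_degree hy5
        by_cases hyQ : s(u, y) ∈ Q
        · obtain ⟨b, hb, hQ⟩ := (hS.mem_systemEdges h hu).1 hyQ
          have hg := hS.gadget b hb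
          rcases hQ with ⟨rfl, rfl, hac⟩ | ⟨-, rfl⟩ | ⟨-, rfl⟩
          · have hbw : w ≠ b := by rintro rfl; exact hw hg.adj_c.2.1
            have hmem : s(a b, b) ∈ H := by
              refine (hHm _ _).2 ⟨⟨hg.adj_a.1, Or.inl hu⟩, fun hQ => hyZ ?_⟩
              rw [hS.eq_of_mem_systemEdges h hu hyQ hQ]
              exact hg.adj_c.2.1
            refine ⟨{s(a b, b)}, Finset.singleton_subset_iff.2 hmem, ?_, fun e' he' => ?_⟩
            · rw [Finset.card_singleton]
              push_cast at hex ⊢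
              omega
            · rw [Finset.mem_singleton.1 he']
              exact ⟨edgeConflict_left hbw, Or.inl (hinner _ _ hu hg.adj_c.2.1)⟩
          · exact absurd hg.adj_c.2.2 hyZ
          · exact absurd hg.adj_c.2.1 hyZ
        · refine ⟨{s(u, y)}, Finset.singleton_subset_iff.2 ((hHm u y).2 ⟨⟨huy, Or.inl hu⟩, hyQ⟩),
            ?_, fun e' he' => ?_⟩
          · rw [Finset.card_singleton]
            push_cast at hex ⊢
            omega
          · rw [Finset.mem_singleton.1 he']
            refine ⟨edgeConflict_left fun hwy => ?_, Or.inr (Or.inl ⟨y, hyZ, rfl, ?_⟩)⟩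
            · rw [hwy] at hw4
              omega
            · simp [ca, hP, hPy, hw4, hy5]
      · rw [hw5] at hex
        refine ⟨(Finset.univ.filter fun u' => P u' w).map (starEmb w), fun e' he' => ?_, ?_,
          fun e' he' => ?_⟩
        · obtain ⟨u', hu', rfl⟩ := Finset.mem_map.1 he'
          have : starEmb w u' = s(u', w) := Sym2.eq_swap
          rw [this]
          exact hPH u' w (Finset.mem_filter.1 hu').2
        · rw [Finset.card_map, h.sat u hu w hw5 hadj hP]
          push_cast at hex ⊢
          omega
        · obtain ⟨u', hu', rfl⟩ := Finset.mem_map.1 he'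
          have hPu' := (Finset.mem_filter.1 hu').2
          have : starEmb w u' = s(u', w) := Sym2.eq_swap
          rw [this]
          have hne : u ≠ u' := by rintro rfl; exact hP hPu'
          refine ⟨edgeConflict_right hne, Or.inr (Or.inr ⟨u', (h.pick u' w hPu').1, rfl, ?_⟩)⟩
          have := hcb1 u' w hPu'
          rw [hcb0 u w hP]
          omega
  · refine hS.choosable_inner h fun x y => ?_
    rw [Finset.mem_sdiff, mem_boundaryEdges, hHm]
    constructor
    · rintro ⟨⟨⟨hxy, hZ⟩, hQ⟩, hb⟩
      refine ⟨?_, hQ⟩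
      by_contra hN
      apply hb
      refine ⟨⟨⟨hxy, hZ⟩, hQ⟩, ?_⟩
      by_cases hx : x ∈ Z
      · exact ⟨x, hx, y, fun hy => hN ⟨hxy, hx, hy⟩, rfl⟩
      · exact ⟨y, hZ.resolve_left hx, x, hx, Sym2.eq_swap⟩
    · rintro ⟨hxy, hQ⟩
      refine ⟨⟨⟨hxy.1, Or.inl hxy.2.1⟩, hQ⟩, fun hb => hinner x y hxy.2.1 hxy.2.2 ?_⟩
      rw [mem_boundaryEdges, hHm]
      exact hb

end GadgetSystem
end

theorem stmt_13 {V : Type*} [Fintype V] (G : SimpleGraph V) [DecidableRel G.Adj]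
    (Δ : ℕ) (hΔ : G.maxDegree = Δ) (hΔ5 : 5 ≤ Δ)
    (hcrit : ListEdgeCritical G (Δ + 1)) :
    2 * (Finset.univ.filter fun v : V => G.degree v = 3).card +
        2 * (Finset.univ.filter fun v : V => G.degree v = 4).card <
      (Finset.univ.filter fun v : V => G.degree v = Δ - 1).card +
        2 * (Finset.univ.filter fun v : V => G.degree v = Δ).card := by
  rcases hΔ5.eq_or_lt with rfl | hΔ6
  · by_contra hcon
    obtain ⟨Z, P, s, ⟨u, hu⟩, h⟩ := exists_pickConfig_of_not_lt hΔ hcrit (by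
      norm_num at hcon
      omega)
    obtain ⟨S, a, c, v, hS⟩ := h.exists_gadgetSystem
    have hpos : 0 < G.degree u := by
      have := h.deg u hu
      omega
    obtain ⟨y, hy⟩ := (G.degree_pos_iff_exists_adj u).1 hpos
    refine hcrit.not_choosable (H := edgesMeeting G Z) (Finset.filter_subset _ _)
      ⟨s(u, y), mk_mem_edgesMeeting.2 ⟨hy, Or.inl hu⟩⟩ ?_
    have := hS.choosable h (hS.choosable_boundary h)
    rwa [show excess G (fun _ => False) = fun e => ((5 + 1 : ℕ) : ℤ) - lineDeg G.edgeFinset e from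
      funext fun e => by simp [excess]] at this
  · exact lt_weighted_card_of_six_le G Δ hΔ hΔ6 hcrit
end

section
/- If G is a finite simple graph with maximum degree Δ ≥ 8 that is (Δ+1)-list-edge-critical, then 2·|V₃| + 2·|V₄| + 2·|V₅| < |V_{Δ−2}| + 2·|V_{Δ−1}| + 3·|V_Δ|. -/
open scoped Classical

/-- Stable matchings exist: a set `E` of edges of a bipartite graph with strict preferences `a` at
the left vertices and `b` at the right vertices contains a matching dominating all of `E`. -/
theorem exists_stable_matching {U W : Type*} (E : Finset (U × W)) (a b : U × W → ℕ)
    (ha : Set.InjOn a E) (hb : Set.InjOn b E) :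
    ∃ M ⊆ E, (∀ p ∈ M, ∀ q ∈ M, p ≠ q → p.1 ≠ q.1 ∧ p.2 ≠ q.2) ∧
      ∀ e ∈ E, e ∉ M → ∃ f ∈ M, (f.1 = e.1 ∧ a f < a e) ∨ (f.2 = e.2 ∧ b f < b e) := by
  induction E using Finset.strongInduction with
  | H E ih =>
    by_cases h : ∃ e ∈ E, ∃ f ∈ E, f.2 = e.2 ∧ b f < b e ∧ ∀ g ∈ E, g.1 = f.1 → a f ≤ a g
    · obtain ⟨e, he, f, hf, hfe, hlt, htop⟩ := h
      obtain ⟨M, hM, hmatch, hdom⟩ := ih (E.erase e) (Finset.erase_ssubset he)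
        (ha.mono (Finset.erase_subset _ _)) (hb.mono (Finset.erase_subset _ _))
      refine ⟨M, hM.trans (Finset.erase_subset _ _), hmatch, fun e' he' hne => ?_⟩
      by_cases hee : e' = e
      · subst hee
        by_cases hfM : f ∈ M
        · exact ⟨f, hfM, Or.inr ⟨hfe, hlt⟩⟩
        · obtain ⟨g, hg, hg'⟩ := hdom f
            (Finset.mem_erase.2 ⟨by rintro rfl; exact lt_irrefl _ hlt, hf⟩) hfM
          rcases hg' with ⟨h1, h2⟩ | ⟨h1, h2⟩
          · exact absurd (htop g (Finset.mem_of_mem_erase (hM hg)) h1) (not_le.2 h2)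
          · exact ⟨g, hg, Or.inr ⟨h1.trans hfe, h2.trans hlt⟩⟩
      · exact hdom e' (Finset.mem_erase.2 ⟨hee, he'⟩) hne
    · push Not at h
      refine ⟨E.filter fun f => ∀ g ∈ E, g.1 = f.1 → a f ≤ a g, Finset.filter_subset _ _, ?_, ?_⟩
      · intro p hp q hq hpq
        rw [Finset.mem_filter] at hp hq
        refine ⟨fun h1 => hpq (ha hp.1 hq.1
          (le_antisymm (hp.2 q hq.1 h1.symm) (hq.2 p hp.1 h1))), fun h2 => ?_⟩
        rcases lt_trichotomy (b p) (b q) with hlt | heq | hlt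
        · obtain ⟨g, hg, hg1, hg2⟩ := h q hq.1 p hp.1 h2 hlt
          exact absurd (hp.2 g hg hg1) (not_le.2 hg2)
        · exact hpq (hb hp.1 hq.1 heq)
        · obtain ⟨g, hg, hg1, hg2⟩ := h p hp.1 q hq.1 h2.symm hlt
          exact absurd (hq.2 g hg hg1) (not_le.2 hg2)
      · intro e he _
        obtain ⟨f, hf, hmin⟩ := (E.filter fun f => f.1 = e.1).exists_min_image a
          ⟨e, Finset.mem_filter.2 ⟨he, rfl⟩⟩
        rw [Finset.mem_filter] at hf
        have hfM : f ∈ E.filter fun f => ∀ g ∈ E, g.1 = f.1 → a f ≤ a g :=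
          Finset.mem_filter.2 ⟨hf.1, fun g hg hgf =>
            hmin g (Finset.mem_filter.2 ⟨hg, hgf.trans hf.2⟩)⟩
        refine ⟨f, hfM, Or.inl ⟨hf.2, lt_of_le_of_ne (hmin e (Finset.mem_filter.2 ⟨he, rfl⟩)) ?_⟩⟩
        intro heq
        have : f = e := ha hf.1 he heq
        subst this
        contradiction

/-- Galvin's argument: a bipartite edge set with strict preferences at every vertex is colorable
from lists that are longer than the number of preferred adjacent edges. -/
theorem exists_coloring_of_preferences {U W : Type*} (E : Finset (U × W)) (a b : U × W → ℕ)
    (ha : Set.InjOn a E) (hb : Set.InjOn b E) (L : U × W → Finset ℕ)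
    (hL : ∀ e ∈ E, (E.filter fun f => f.1 = e.1 ∧ a f < a e).card +
      (E.filter fun f => f.2 = e.2 ∧ b f < b e).card < (L e).card) :
    ∃ c : U × W → ℕ, (∀ e ∈ E, c e ∈ L e) ∧
      ∀ p ∈ E, ∀ q ∈ E, p ≠ q → (p.1 = q.1 ∨ p.2 = q.2) → c p ≠ c q := by
  induction E using Finset.strongInduction generalizing L with
  | H E ih =>
    rcases E.eq_empty_or_nonempty with rfl | ⟨e₀, he₀⟩
    · exact ⟨fun _ => 0, by simp⟩
    obtain ⟨κ, hκ⟩ : (L e₀).Nonempty := Finset.card_pos.1 (by have := hL e₀ he₀; omega)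
    obtain ⟨M, hM, hmatch, hdom⟩ := exists_stable_matching (E.filter fun e => κ ∈ L e) a b
      (ha.mono (Finset.filter_subset _ _)) (hb.mono (Finset.filter_subset _ _))
    have hME : M ⊆ E := hM.trans (Finset.filter_subset _ _)
    have hMne : M.Nonempty := by
      by_cases h : e₀ ∈ M
      · exact ⟨e₀, h⟩
      · obtain ⟨f, hf, -⟩ := hdom e₀ (Finset.mem_filter.2 ⟨he₀, hκ⟩) h
        exact ⟨f, hf⟩
    have hsub : ∀ (P : U × W → Prop) [DecidablePred P], (E \ M).filter P ⊆ E.filter P := fun P _ =>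
      Finset.filter_subset_filter _ Finset.sdiff_subset
    obtain ⟨c, hc, hproper⟩ := ih (E \ M) (Finset.sdiff_ssubset hME hMne)
      (ha.mono Finset.sdiff_subset) (hb.mono Finset.sdiff_subset) (fun e => (L e).erase κ) (by
        intro e he
        rw [Finset.mem_sdiff] at he
        have h0 := hL e he.1
        have h1 := Finset.card_le_card (hsub fun f => f.1 = e.1 ∧ a f < a e)
        have h2 := Finset.card_le_card (hsub fun f => f.2 = e.2 ∧ b f < b e)
        by_cases hκe : κ ∈ L e
        · rw [Finset.card_erase_of_mem hκe]
          obtain ⟨f, hf, hf' | hf'⟩ := hdom e (Finset.mem_filter.2 ⟨he.1, hκe⟩) he.2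
          · have := Finset.card_lt_card (Finset.ssubset_iff_subset_ne.2
              ⟨hsub fun f => f.1 = e.1 ∧ a f < a e, fun heq => by
                have : f ∈ E.filter fun f => f.1 = e.1 ∧ a f < a e :=
                  Finset.mem_filter.2 ⟨hME hf, hf'⟩
                rw [← heq] at this
                simp [hf] at this⟩)
            omega
          · have := Finset.card_lt_card (Finset.ssubset_iff_subset_ne.2
              ⟨hsub fun f => f.2 = e.2 ∧ b f < b e, fun heq => by
                have : f ∈ E.filter fun f => f.2 = e.2 ∧ b f < b e :=
                  Finset.mem_filter.2 ⟨hME hf, hf'⟩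
                rw [← heq] at this
                simp [hf] at this⟩)
            omega
        · rw [Finset.erase_eq_of_notMem hκe]
          omega)
    refine ⟨fun e => if e ∈ M then κ else c e, fun e he => ?_, fun p hp q hq hpq hadj => ?_⟩
    · by_cases h : e ∈ M
      · simpa [h] using (Finset.mem_filter.1 (hM h)).2
      · simpa [h] using Finset.mem_of_mem_erase (hc e (Finset.mem_sdiff.2 ⟨he, h⟩))
    · have hne : ∀ e ∈ E, e ∉ M → c e ≠ κ := fun e he h =>
        Finset.ne_of_mem_erase (hc e (Finset.mem_sdiff.2 ⟨he, h⟩))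
      by_cases h1 : p ∈ M <;> by_cases h2 : q ∈ M
      · have := hmatch p h1 q h2 hpq
        tauto
      · simpa [h1, h2] using (hne q hq h2).symm
      · simpa [h1, h2] using hne p hp h1
      · simpa [h1, h2] using
          hproper p (Finset.mem_sdiff.2 ⟨hp, h1⟩) q (Finset.mem_sdiff.2 ⟨hq, h2⟩) hpq hadj

/-- Every weight function on a finite set can be refined to an injective one. -/
theorem exists_injOn_refinement {α : Type*} (E : Finset α) (c : α → ℕ) :
    ∃ a : α → ℕ, Set.InjOn a E ∧ ∀ e ∈ E, ∀ f ∈ E, a f < a e → c f ≤ c e := by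
  obtain ⟨i, hi, hlt⟩ : ∃ i : α → ℕ, Set.InjOn i E ∧ ∀ e ∈ E, i e < E.card := by
    refine ⟨fun e => if h : e ∈ E then E.equivFin ⟨e, h⟩ else 0, ?_, ?_⟩
    · intro e he f hf h
      rw [Finset.mem_coe] at he hf
      simpa [he, hf, Fin.val_inj] using h
    · intro e he
      simp [he]
  refine ⟨fun e => E.card * c e + i e, ?_, ?_⟩
  · intro e he f hf h
    have h' := congrArg (· % E.card) h
    simp only [Nat.mul_add_mod, Nat.mod_eq_of_lt (hlt e he), Nat.mod_eq_of_lt (hlt f hf)] at h'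
    exact hi he hf h'
  · intro e he f hf h
    have := hlt e he
    by_contra! hc
    have : E.card * (c e + 1) ≤ E.card * c f := Nat.mul_le_mul_left _ hc
    simp only [mul_add, mul_one] at this h
    omega

/-- If every right vertex has degree at most `t`, then some set of edges that contains at most one
edge at each right vertex covers all vertices of degree at least `t`. -/
theorem exists_covering_edges {U W : Type*} (E : Finset (U × W)) (t : ℕ) (ht : 0 < t)
    (hW : ∀ w, (E.filter fun f => f.2 = w).card ≤ t) :
    ∃ D ⊆ E, (∀ p ∈ D, ∀ q ∈ D, p.2 = q.2 → p = q) ∧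
      (∀ u, t ≤ (E.filter fun f => f.1 = u).card → ∃ p ∈ D, p.1 = u) ∧
      ∀ w, t ≤ (E.filter fun f => f.2 = w).card → ∃ p ∈ D, p.2 = w := by
  let X := {u : U // t ≤ (E.filter fun f => f.1 = u).card}
  obtain ⟨m, hm, hmE⟩ := (Finset.all_card_le_biUnion_card_iff_exists_injective
    (fun u : X => (E.filter fun f => f.1 = u.1).image Prod.snd)).1 (by
      intro S
      let F := E.filter fun f => f.1 ∈ S.map (Function.Embedding.subtype _)
      have h1 : F.image Prod.fst = S.map (Function.Embedding.subtype _) := by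
        ext u
        rw [Finset.mem_image]
        constructor
        · rintro ⟨p, hp, rfl⟩
          exact (Finset.mem_filter.1 hp).2
        · intro hu
          obtain ⟨⟨u', hu'⟩, -, rfl⟩ := Finset.mem_map.1 hu
          obtain ⟨p, hp⟩ := Finset.card_pos.1 (ht.trans_le hu')
          rw [Finset.mem_filter] at hp
          exact ⟨p, Finset.mem_filter.2 ⟨hp.1, by rw [hp.2]; exact hu⟩, hp.2⟩
      have h2 : F.image Prod.snd =
          S.biUnion fun u => (E.filter fun f => f.1 = u.1).image Prod.snd := by
        ext w
        simp only [F, Finset.mem_image, Finset.mem_filter, Finset.mem_biUnion, Finset.mem_map]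
        constructor
        · rintro ⟨p, ⟨hp, u, hu, hup⟩, rfl⟩
          exact ⟨u, hu, p, ⟨hp, hup.symm⟩, rfl⟩
        · rintro ⟨u, hu, p, ⟨hp, hup⟩, rfl⟩
          exact ⟨p, ⟨hp, u, hu, hup.symm⟩, rfl⟩
      have h3 : t * (F.image Prod.fst).card ≤ F.card := by
        refine Finset.mul_card_image_le_card _ _ fun u hu => ?_
        rw [h1] at hu
        have : (F.filter fun f => f.1 = u) = E.filter fun f => f.1 = u := by
          ext p
          simp only [F, Finset.mem_filter]
          constructor
          · tauto
          · rintro ⟨hp, rfl⟩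
            exact ⟨⟨hp, hu⟩, rfl⟩
        rw [this]
        obtain ⟨u', -, rfl⟩ := Finset.mem_map.1 hu
        exact u'.2
      have h4 : F.card ≤ t * (F.image Prod.snd).card :=
        Finset.card_le_mul_card_image _ _ fun w _ =>
          (Finset.card_le_card (Finset.filter_subset_filter _ (Finset.filter_subset _ _))).trans
            (hW w)
      rw [h1, Finset.card_map] at h3
      rw [h2] at h4
      exact Nat.le_of_mul_le_mul_left (h3.trans h4) ht)
  have hpick : ∀ w, t ≤ (E.filter fun f => f.2 = w).card → ∃ p ∈ E, p.2 = w := fun w hw => by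
    obtain ⟨p, hp⟩ := Finset.card_pos.1 (ht.trans_le hw)
    exact ⟨p, (Finset.mem_filter.1 hp).1, (Finset.mem_filter.1 hp).2⟩
  choose pick hpickE hpick2 using hpick
  refine ⟨E.filter fun p => (∃ u : X, u.1 = p.1 ∧ m u = p.2) ∨
    ((∀ u, m u ≠ p.2) ∧ ∃ h, p = pick p.2 h), Finset.filter_subset _ _, ?_, ?_, ?_⟩
  · intro p hp q hq h
    obtain ⟨-, ⟨u, hu, hup⟩ | ⟨hp1, hp2, hp3⟩⟩ := Finset.mem_filter.1 hp <;>
      obtain ⟨-, ⟨v, hv, hvq⟩ | ⟨hq1, hq2, hq3⟩⟩ := Finset.mem_filter.1 hq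
    · have : u = v := hm (by rw [hup, hvq, h])
      subst this
      exact Prod.ext (hu.symm.trans hv) h
    · exact absurd (hup.trans h) (hq1 u)
    · exact absurd (hvq.trans h.symm) (hp1 v)
    · rw [hp3, hq3]
      congr
  · intro u hu
    have := hmE ⟨u, hu⟩
    simp only [Finset.mem_image, Finset.mem_filter] at this
    obtain ⟨p, ⟨hp, hpu⟩, hpm⟩ := this
    exact ⟨p, Finset.mem_filter.2 ⟨hp, Or.inl ⟨⟨u, hu⟩, hpu.symm, hpm.symm⟩⟩, hpu⟩
  · intro w hw
    by_cases h : ∃ u, m u = w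
    · obtain ⟨u, rfl⟩ := h
      have := hmE u
      simp only [Finset.mem_image, Finset.mem_filter] at this
      obtain ⟨p, ⟨hp, hpu⟩, hpm⟩ := this
      exact ⟨p, Finset.mem_filter.2 ⟨hp, Or.inl ⟨u, hpu.symm, hpm.symm⟩⟩, hpm⟩
    · push Not at h
      refine ⟨pick w hw, Finset.mem_filter.2 ⟨hpickE w hw, Or.inr ?_⟩, hpick2 w hw⟩
      rw [hpick2 w hw]
      exact ⟨h, hw, rfl⟩

/-- Levels for a bipartite edge set whose right degrees are at most `t` and whose left degrees
exceed `t` by at most `g`. -/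
theorem exists_levels_of_degree_le {U W : Type*} (g : U → ℕ) (t : ℕ) (E : Finset (U × W))
    (hU : ∀ u, (E.filter fun f => f.1 = u).card ≤ t + g u)
    (hW : ∀ w, (E.filter fun f => f.2 = w).card ≤ t) :
    ∃ c : U × W → ℕ, ∀ e ∈ E,
      (E.filter fun f => f.1 = e.1 ∧ c f ≤ c e).card ≤ c e + 1 + g e.1 ∧
      (E.filter fun f => f.2 = e.2 ∧ c e ≤ c f).card + c e ≤ t := by
  induction t generalizing E with
  | zero =>
    refine ⟨fun _ => 0, fun e he => ?_⟩
    have : 0 < (E.filter fun f => f.2 = e.2).card :=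
      Finset.card_pos.2 ⟨e, Finset.mem_filter.2 ⟨he, rfl⟩⟩
    exact absurd (hW e.2) (by omega)
  | succ t ih =>
    obtain ⟨D, hDE, hD, hDU, hDW⟩ := exists_covering_edges E (t + 1) t.succ_pos hW
    have hlt : ∀ (P : U × W → Prop) [DecidablePred P], (∃ p ∈ D, P p) →
        ((E \ D).filter P).card < (E.filter P).card := by
      rintro P _ ⟨p, hp, hpP⟩
      refine Finset.card_lt_card ⟨Finset.filter_subset_filter _ Finset.sdiff_subset, fun h => ?_⟩
      have := h (Finset.mem_filter.2 ⟨hDE hp, hpP⟩)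
      simp [hp] at this
    have hle : ∀ (P : U × W → Prop) [DecidablePred P],
        ((E \ D).filter P).card ≤ (E.filter P).card := fun P _ =>
      Finset.card_le_card (Finset.filter_subset_filter _ Finset.sdiff_subset)
    obtain ⟨c, hc⟩ := ih (E \ D)
      (fun u => by
        have h1 := hU u
        by_cases h : t + 1 ≤ (E.filter fun f => f.1 = u).card
        · have := hlt _ (hDU u h)
          omega
        · have := hle fun f => f.1 = u
          omega)
      (fun w => by
        have h1 := hW w
        by_cases h : t + 1 ≤ (E.filter fun f => f.2 = w).card
        · have := hlt _ (hDW w h)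
          omega
        · have := hle fun f => f.2 = w
          omega)
    have hct : ∀ e ∈ E, e ∉ D → c e < t := fun e he heD => by
      have h1 := (hc e (Finset.mem_sdiff.2 ⟨he, heD⟩)).2
      have : 0 < ((E \ D).filter fun f => f.2 = e.2 ∧ c e ≤ c f).card := Finset.card_pos.2
        ⟨e, Finset.mem_filter.2 ⟨Finset.mem_sdiff.2 ⟨he, heD⟩, rfl, le_rfl⟩⟩
      omega
    refine ⟨fun e => if e ∈ D then t else c e, fun e he => ?_⟩
    by_cases heD : e ∈ D
    · simp only [heD, if_true]
      constructor
      · refine (Finset.card_le_card fun f hf => ?_).trans ((hU e.1).trans (by omega))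
        rw [Finset.mem_filter] at hf ⊢
        exact ⟨hf.1, hf.2.1⟩
      · have : (E.filter fun f => f.2 = e.2 ∧ t ≤ if f ∈ D then t else c f).card ≤
            ({e} : Finset (U × W)).card := Finset.card_le_card fun f hf => by
          obtain ⟨hf1, hf2, hf3⟩ := Finset.mem_filter.1 hf
          rw [Finset.mem_singleton]
          by_cases hfD : f ∈ D
          · exact hD f hfD e heD hf2
          · have := hct f hf1 hfD
            simp only [hfD, if_false] at hf3
            omega
        rw [Finset.card_singleton] at this
        omega
    · simp only [heD, if_false]
      have het := hct e he heD
      obtain ⟨h1, h2⟩ := hc e (Finset.mem_sdiff.2 ⟨he, heD⟩)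
      constructor
      · refine (Finset.card_le_card fun f hf => ?_).trans h1
        obtain ⟨hf1, hf2, hf3⟩ := Finset.mem_filter.1 hf
        by_cases hfD : f ∈ D
        · simp only [hfD, if_true] at hf3
          omega
        · simp only [hfD, if_false] at hf3
          exact Finset.mem_filter.2 ⟨Finset.mem_sdiff.2 ⟨hf1, hfD⟩, hf2, hf3⟩
      · have h3 : (D.filter fun f => f.2 = e.2).card ≤ 1 :=
          Finset.card_le_one.2 fun p hp q hq => by
            rw [Finset.mem_filter] at hp hq
            exact hD p hp.1 q hq.1 (hp.2.trans hq.2.symm)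
        have h4 : (E.filter fun f => f.2 = e.2 ∧ c e ≤ if f ∈ D then t else c f) ⊆
            ((E \ D).filter fun f => f.2 = e.2 ∧ c e ≤ c f) ∪ D.filter fun f => f.2 = e.2 := by
          intro f hf
          obtain ⟨hf1, hf2, hf3⟩ := Finset.mem_filter.1 hf
          rw [Finset.mem_union, Finset.mem_filter, Finset.mem_filter, Finset.mem_sdiff]
          by_cases hfD : f ∈ D
          · exact Or.inr ⟨hfD, hf2⟩
          · simp only [hfD, if_false] at hf3
            exact Or.inl ⟨⟨hf1, hfD⟩, hf2, hf3⟩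
        have h5 := (Finset.card_le_card h4).trans (Finset.card_union_le _ _)
        omega

/-- Levels for a bipartite edge set whose right degrees are at most `h ≥ t` and whose left degrees
exceed `t` by at most `g`. -/
theorem exists_levels {U W : Type*} (g : U → ℕ) (t : ℕ) (E : Finset (U × W)) (h : W → ℕ)
    (hU : ∀ u, (E.filter fun f => f.1 = u).card ≤ t + g u)
    (hW : ∀ w, (E.filter fun f => f.2 = w).card ≤ h w) (ht : ∀ w, t ≤ h w) :
    ∃ c : U × W → ℕ, ∀ e ∈ E,
      (E.filter fun f => f.1 = e.1 ∧ c f ≤ c e).card ≤ c e + 1 + g e.1 ∧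
      (E.filter fun f => f.2 = e.2 ∧ c e ≤ c f).card + c e ≤ h e.2 := by
  induction E using Finset.strongInduction generalizing h with
  | H E ih =>
    by_cases hbig : ∃ w, t < (E.filter fun f => f.2 = w).card
    · obtain ⟨w, hw⟩ := hbig
      obtain ⟨e₀, hmem⟩ := Finset.card_pos.1 (Nat.zero_lt_of_lt hw)
      obtain ⟨he₀, rfl⟩ := Finset.mem_filter.1 hmem
      have hh := hW e₀.2
      obtain ⟨c, hc⟩ := ih (E.erase e₀) (Finset.erase_ssubset he₀)
        (fun w => if w = e₀.2 then h w - 1 else h w)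
        (fun u => (Finset.card_le_card
          (Finset.filter_subset_filter _ (Finset.erase_subset _ _))).trans (hU u))
        (fun w => by
          by_cases hwe : w = e₀.2
          · subst hwe
            have : ((E.erase e₀).filter fun f => f.2 = e₀.2) =
                (E.filter fun f => f.2 = e₀.2).erase e₀ := Finset.filter_erase ..
            rw [this, Finset.card_erase_of_mem hmem]
            simp only [if_true]
            omega
          · simp only [hwe, if_false]
            exact (Finset.card_le_card
              (Finset.filter_subset_filter _ (Finset.erase_subset _ _))).trans (hW w))
        (fun w => by
          have := ht w
          by_cases hwe : w = e₀.2
          · subst hwe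
            simp only [if_true]
            omega
          · simpa [hwe] using this)
      have hlt : ∀ e ∈ E, e ≠ e₀ → e.2 = e₀.2 → c e < h e₀.2 - 1 := fun e he hne h2 => by
        have h1 := (hc e (Finset.mem_erase.2 ⟨hne, he⟩)).2
        have : 0 < ((E.erase e₀).filter fun f => f.2 = e.2 ∧ c e ≤ c f).card :=
          Finset.card_pos.2
            ⟨e, Finset.mem_filter.2 ⟨Finset.mem_erase.2 ⟨hne, he⟩, rfl, le_rfl⟩⟩
        simp only [h2, if_true] at h1 this
        omega
      refine ⟨fun e => if e = e₀ then h e₀.2 - 1 else c e, fun e he => ⟨?_, ?_⟩⟩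
      · by_cases hce : t ≤ if e = e₀ then h e₀.2 - 1 else c e
        · refine (Finset.card_le_card fun f hf => ?_).trans ((hU e.1).trans (by dsimp only; omega))
          rw [Finset.mem_filter] at hf ⊢
          exact ⟨hf.1, hf.2.1⟩
        · have hne : e ≠ e₀ := by
            rintro rfl
            simp only [if_true] at hce
            omega
          simp only [hne, if_false] at hce ⊢
          refine (Finset.card_le_card fun f hf => ?_).trans
            (hc e (Finset.mem_erase.2 ⟨hne, he⟩)).1
          obtain ⟨hf1, hf2, hf3⟩ := Finset.mem_filter.1 hf
          by_cases hfe : f = e₀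
          · simp only [hfe, if_true] at hf3
            omega
          · simp only [hfe, if_false] at hf3
            exact Finset.mem_filter.2 ⟨Finset.mem_erase.2 ⟨hfe, hf1⟩, hf2, hf3⟩
      · by_cases hne : e = e₀
        · subst hne
          simp only [if_true]
          have : (E.filter fun f => f.2 = e.2 ∧ h e.2 - 1 ≤
              if f = e then h e.2 - 1 else c f).card ≤ ({e} : Finset (U × W)).card :=
            Finset.card_le_card fun f hf => by
              obtain ⟨hf1, hf2, hf3⟩ := Finset.mem_filter.1 hf
              rw [Finset.mem_singleton]
              by_contra hfe
              have := hlt f hf1 hfe hf2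
              simp only [hfe, if_false] at hf3
              omega
          rw [Finset.card_singleton] at this
          omega
        · simp only [hne, if_false]
          have h2 := (hc e (Finset.mem_erase.2 ⟨hne, he⟩)).2
          have hsub : (E.filter fun f => f.2 = e.2 ∧ c e ≤ if f = e₀ then h e₀.2 - 1 else c f) ⊆
              ((E.erase e₀).filter fun f => f.2 = e.2 ∧ c e ≤ c f) ∪
                if e.2 = e₀.2 then {e₀} else ∅ := by
            intro f hf
            obtain ⟨hf1, hf2, hf3⟩ := Finset.mem_filter.1 hf
            rw [Finset.mem_union, Finset.mem_filter, Finset.mem_erase]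
            by_cases hfe : f = e₀
            · subst hfe
              simp [hf2]
            · simp only [hfe, if_false] at hf3
              exact Or.inl ⟨⟨hfe, hf1⟩, hf2, hf3⟩
          have h5 := (Finset.card_le_card hsub).trans (Finset.card_union_le _ _)
          by_cases h2e : e.2 = e₀.2
          · simp only [h2e, if_true, Finset.card_singleton] at h2 h5 ⊢
            omega
          · simp only [h2e, if_false, Finset.card_empty] at h2 h5 ⊢
            omega
    · push Not at hbig
      obtain ⟨c, hc⟩ := exists_levels_of_degree_le g t E hU hbig
      exact ⟨c, fun e he => ⟨(hc e he).1, (hc e he).2.trans (ht _)⟩⟩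

/-- List coloring of a bipartite edge set in which right degrees dominate left degrees up to the
slack `g`. -/
theorem exists_bipartite_list_coloring {U W : Type*} (E : Finset (U × W)) (L : U × W → Finset ℕ)
    (t : ℕ) (g : U → ℕ) (h : W → ℕ)
    (hU : ∀ u, (E.filter fun f => f.1 = u).card ≤ t + g u)
    (hW : ∀ e ∈ E, (E.filter fun f => f.2 = e.2).card ≤ h e.2) (ht : ∀ e ∈ E, t ≤ h e.2)
    (hL : ∀ e ∈ E, h e.2 + g e.1 ≤ (L e).card) :
    ∃ c : U × W → ℕ, (∀ e ∈ E, c e ∈ L e) ∧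
      ∀ p ∈ E, ∀ q ∈ E, p ≠ q → (p.1 = q.1 ∨ p.2 = q.2) → c p ≠ c q := by
  obtain ⟨c, hc⟩ := exists_levels g t E (fun w => max t (h w)) hU
    (fun w => by
      rcases (E.filter fun f => f.2 = w).eq_empty_or_nonempty with h0 | ⟨e, hmem⟩
      · simp [h0]
      · obtain ⟨he, rfl⟩ := Finset.mem_filter.1 hmem
        exact (hW e he).trans (le_max_right _ _))
    (fun w => le_max_left _ _)
  obtain ⟨a, ha, hac⟩ := exists_injOn_refinement E c
  obtain ⟨b, hb, hbc⟩ := exists_injOn_refinement E fun e => E.sup c - c e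
  refine exists_coloring_of_preferences E a b ha hb L fun e he => ?_
  obtain ⟨h1, h2⟩ := hc e he
  simp only [max_eq_right (ht e he)] at h2
  have h3 : (E.filter fun f => f.1 = e.1 ∧ a f < a e).card <
      (E.filter fun f => f.1 = e.1 ∧ c f ≤ c e).card := by
    refine Finset.card_lt_card ⟨fun f hf => ?_, fun hsub => ?_⟩
    · obtain ⟨hf1, hf2, hf3⟩ := Finset.mem_filter.1 hf
      exact Finset.mem_filter.2 ⟨hf1, hf2, hac e he f hf1 hf3⟩
    · have := hsub (Finset.mem_filter.2 ⟨he, rfl, le_rfl⟩)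
      simp at this
  have h4 : (E.filter fun f => f.2 = e.2 ∧ b f < b e).card <
      (E.filter fun f => f.2 = e.2 ∧ c e ≤ c f).card := by
    refine Finset.card_lt_card ⟨fun f hf => ?_, fun hsub => ?_⟩
    · obtain ⟨hf1, hf2, hf3⟩ := Finset.mem_filter.1 hf
      have h5 := hbc e he f hf1 hf3
      have h6 : c e ≤ E.sup c := Finset.le_sup he
      exact Finset.mem_filter.2 ⟨hf1, hf2, by omega⟩
    · have := hsub (Finset.mem_filter.2 ⟨he, rfl, le_rfl⟩)
      simp at this
  have := hL e he
  omega

/-- If the capacities of the right vertices sum to at most twice the number of left vertices, then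
some nonempty set `B'` of right vertices is such that each of its members has more neighbors than
its capacity among the left vertices that miss at most one of their edges. -/
theorem exists_subset_capacity_lt {U W : Type*} (A : Finset U) (B : Finset W) (R : U → W → Prop)
    [∀ u, DecidablePred (R u)] (cap : W → ℕ) (hcap : ∀ w ∈ B, 0 < cap w) (hB : B.Nonempty)
    (hA : ∀ u ∈ A, 3 ≤ (B.filter (R u)).card) (hsum : ∑ w ∈ B, cap w ≤ 2 * A.card) :
    ∃ B' ⊆ B, B'.Nonempty ∧ ∀ w ∈ B',
      cap w < (A.filter fun u => R u w ∧ ((B \ B').filter (R u)).card ≤ 1).card := by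
  by_contra! hno
  have key : ∀ n < B.card, ∃ C ⊆ B, C.card = n ∧
      ∑ u ∈ A, min 2 (C.filter (R u)).card ≤ ∑ w ∈ C, cap w := by
    intro n
    induction n with
    | zero => exact fun _ => ⟨∅, by simp⟩
    | succ n ih =>
      intro hn
      obtain ⟨C, hCB, hCn, hC⟩ := ih (by omega)
      have hne : (B \ C).Nonempty := by
        rw [← Finset.card_pos, Finset.card_sdiff_of_subset hCB]
        omega
      obtain ⟨w, hw, hle⟩ := hno (B \ C) Finset.sdiff_subset hne
      rw [Finset.sdiff_sdiff_eq_self hCB] at hle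
      obtain ⟨hwB, hwC⟩ := Finset.mem_sdiff.1 hw
      refine ⟨insert w C, Finset.insert_subset hwB hCB, by simp [hwC, hCn], ?_⟩
      rw [Finset.sum_insert hwC]
      calc ∑ u ∈ A, min 2 ((insert w C).filter (R u)).card
          = ∑ u ∈ A, ((if R u w ∧ (C.filter (R u)).card ≤ 1 then 1 else 0) +
              min 2 (C.filter (R u)).card) := by
            refine Finset.sum_congr rfl fun u _ => ?_
            rw [Finset.filter_insert]
            by_cases h : R u w
            · have : w ∉ C.filter (R u) := fun h => hwC (Finset.mem_filter.1 h).1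
              simp only [h, if_true, Finset.card_insert_of_notMem this, true_and]
              split_ifs <;> omega
            · simp [h]
        _ ≤ cap w + ∑ w ∈ C, cap w := by
            rw [Finset.sum_add_distrib, ← Finset.card_filter]
            exact add_le_add hle hC
  obtain ⟨C, hCB, hCn, hC⟩ := key (B.card - 1) (Nat.sub_lt (Finset.card_pos.2 hB) one_pos)
  have hBC : (B \ C).card = 1 := by
    have := Finset.card_pos.2 hB
    rw [Finset.card_sdiff_of_subset hCB]
    omega
  have h2 : ∀ u ∈ A, min 2 (C.filter (R u)).card = 2 := by
    intro u hu
    have h3 := hA u hu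
    rw [← Finset.sdiff_union_of_subset hCB, Finset.filter_union] at h3
    have h4 := h3.trans (Finset.card_union_le _ _)
    have h5 := Finset.card_filter_le (B \ C) (R u)
    omega
  rw [Finset.sum_congr rfl h2, Finset.sum_const, smul_eq_mul] at hC
  have h6 := Finset.sum_sdiff (f := cap) hCB
  have h7 : 0 < ∑ w ∈ B \ C, cap w := Finset.sum_pos (fun w hw => hcap w (Finset.mem_sdiff.1 hw).1)
    (Finset.card_pos.1 (by omega))
  omega

theorem ListEdgeColorable.mono_s14 {V : Type*} {G H : SimpleGraph V} (hHG : H ≤ G) {k m : ℕ}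
    (hkm : k ≤ m) (hG : ListEdgeColorable G k) : ListEdgeColorable H m := by
  intro L hL
  obtain ⟨f, hf1, hf2⟩ := hG (fun e => if e ∈ H.edgeSet then L e else Finset.range k) (by
    intro e _
    by_cases h : e ∈ H.edgeSet
    · simpa [h] using hkm.trans (hL e h)
    · simp [h])
  have hsub := SimpleGraph.edgeSet_mono hHG
  exact ⟨f, fun e he => by simpa [he] using hf1 e (hsub he),
    fun e₁ h₁ e₂ h₂ => hf2 e₁ (hsub h₁) e₂ (hsub h₂)⟩

theorem ListEdgeCritical.not_listEdgeColorable {V : Type*} {G : SimpleGraph V} {k : ℕ}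
    (h : ListEdgeCritical G k) : ¬ ListEdgeColorable G k := fun hk =>
  absurd (Nat.sInf_le hk) (not_le.2 h.1)

theorem ListEdgeCritical.listEdgeColorable_deleteEdges {V : Type*} {G : SimpleGraph V} {k : ℕ}
    (h : ListEdgeCritical G k) {e : Sym2 V} (he : e ∈ G.edgeSet) :
    ListEdgeColorable (G.deleteEdges {e}) k := by
  obtain ⟨m, hm⟩ : {m | ListEdgeColorable G m}.Nonempty :=
    Nat.nonempty_of_pos_sInf (Nat.zero_lt_of_lt h.1)
  have hne : {m | ListEdgeColorable (G.deleteEdges {e}) m}.Nonempty :=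
    ⟨m, ListEdgeColorable.mono_s14 (G.deleteEdges_le _) le_rfl hm⟩
  exact ListEdgeColorable.mono_s14 le_rfl (h.2 e he) (Nat.sInf_mem hne)

/-- In a critical graph no nonempty set `F` of edges, oriented so that no vertex is both a source
and a target, can be colored from its residual lists. -/
theorem ListEdgeCritical.exists_residual_lists {V : Type*} [Fintype V] {G : SimpleGraph V}
    [DecidableRel G.Adj] {k : ℕ} (hG : ListEdgeCritical G k) (F : Finset (V × V))
    (hne : F.Nonempty) (hadj : ∀ p ∈ F, G.Adj p.1 p.2) (hbip : ∀ p ∈ F, ∀ q ∈ F, p.1 ≠ q.2) :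
    ∃ L : V × V → Finset ℕ,
      (∀ p ∈ F, k + (F.filter fun f => f.1 = p.1).card + (F.filter fun f => f.2 = p.2).card ≤
        (L p).card + G.degree p.1 + G.degree p.2) ∧
      ¬ ∃ c : V × V → ℕ, (∀ p ∈ F, c p ∈ L p) ∧
        ∀ p ∈ F, ∀ q ∈ F, p ≠ q → (p.1 = q.1 ∨ p.2 = q.2) → c p ≠ c q := by
  obtain ⟨p₀, hp₀⟩ := hne
  have hnot := hG.not_listEdgeColorable
  unfold ListEdgeColorable at hnot
  push Not at hnot
  obtain ⟨L, hL, hLG⟩ := hnot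
  obtain ⟨f, hf1, hf2⟩ := hG.listEdgeColorable_deleteEdges
    (show s(p₀.1, p₀.2) ∈ G.edgeSet from hadj p₀ hp₀) L fun e he =>
      hL e (SimpleGraph.edgeSet_mono (G.deleteEdges_le _) he)
  let used₁ : V → Finset ℕ := fun u =>
    ((G.neighborFinset u).filter fun x => (u, x) ∉ F).image fun x => f s(u, x)
  let used₂ : V → Finset ℕ := fun w =>
    ((G.neighborFinset w).filter fun x => (x, w) ∉ F).image fun x => f s(x, w)
  have hused₁ : ∀ u, (used₁ u).card + (F.filter fun f => f.1 = u).card ≤ G.degree u := by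
    intro u
    have h1 : (F.filter fun f => f.1 = u).card ≤
        ((G.neighborFinset u).filter fun x => (u, x) ∈ F).card := by
      refine Finset.card_le_card_of_injOn Prod.snd (fun p hp => ?_) (fun p hp q hq h => ?_)
      · obtain ⟨hpF, rfl⟩ := Finset.mem_filter.1 hp
        simp [hadj p hpF, hpF]
      · exact Prod.ext ((Finset.mem_filter.1 hp).2.trans (Finset.mem_filter.1 hq).2.symm) h
    have h2 := Finset.card_filter_add_card_filter_not (s := G.neighborFinset u)
      fun x => (u, x) ∈ F
    have h3 : (used₁ u).card ≤ _ := Finset.card_image_le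
    rw [G.card_neighborFinset_eq_degree] at h2
    omega
  have hused₂ : ∀ w, (used₂ w).card + (F.filter fun f => f.2 = w).card ≤ G.degree w := by
    intro w
    have h1 : (F.filter fun f => f.2 = w).card ≤
        ((G.neighborFinset w).filter fun x => (x, w) ∈ F).card := by
      refine Finset.card_le_card_of_injOn Prod.fst (fun p hp => ?_) (fun p hp q hq h => ?_)
      · obtain ⟨hpF, rfl⟩ := Finset.mem_filter.1 hp
        simp [(hadj p hpF).symm, hpF]
      · exact Prod.ext h ((Finset.mem_filter.1 hp).2.trans (Finset.mem_filter.1 hq).2.symm)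
    have h2 := Finset.card_filter_add_card_filter_not (s := G.neighborFinset w)
      fun x => (x, w) ∈ F
    have h3 : (used₂ w).card ≤ _ := Finset.card_image_le
    rw [G.card_neighborFinset_eq_degree] at h2
    omega
  refine ⟨fun p => L s(p.1, p.2) \ (used₁ p.1 ∪ used₂ p.2), fun p hp => ?_, ?_⟩
  · have h1 := hused₁ p.1
    have h2 := hused₂ p.2
    have h3 := hL s(p.1, p.2) (hadj p hp)
    have h4 := Finset.le_card_sdiff (used₁ p.1 ∪ used₂ p.2) (L s(p.1, p.2))
    have h5 := Finset.card_union_le (used₁ p.1) (used₂ p.2)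
    dsimp only
    omega
  · rintro ⟨c, hc1, hc2⟩
    have huniq : ∀ p ∈ F, ∀ q ∈ F, s(p.1, p.2) = s(q.1, q.2) → p = q := by
      intro p hp q hq h
      rcases Sym2.eq_iff.1 h with ⟨h1, h2⟩ | ⟨h1, -⟩
      · exact Prod.ext h1 h2
      · exact absurd h1 (hbip p hp q hq)
    obtain ⟨f', hf'F, hf'⟩ : ∃ f' : Sym2 V → ℕ, (∀ p ∈ F, f' s(p.1, p.2) = c p) ∧
        ∀ e, (∀ p ∈ F, s(p.1, p.2) ≠ e) → f' e = f e := by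
      refine ⟨fun e => if h : ∃ p ∈ F, s(p.1, p.2) = e then c h.choose else f e, ?_, ?_⟩
      · intro p hp
        have h : ∃ q ∈ F, s(q.1, q.2) = s(p.1, p.2) := ⟨p, hp, rfl⟩
        refine (dif_pos h).trans ?_
        exact congrArg c (huniq _ h.choose_spec.1 p hp h.choose_spec.2)
      · intro e he
        exact dif_neg fun ⟨p, hp, h⟩ => he p hp h
    have hdel : ∀ e ∈ G.edgeSet, (∀ p ∈ F, s(p.1, p.2) ≠ e) →
        e ∈ (G.deleteEdges {s(p₀.1, p₀.2)}).edgeSet := by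
      intro e he h
      rw [SimpleGraph.edgeSet_deleteEdges]
      exact ⟨he, fun h' => h p₀ hp₀ h'.symm⟩
    have hmixed : ∀ p ∈ F, ∀ e ∈ G.edgeSet, (∀ q ∈ F, s(q.1, q.2) ≠ e) →
        (∃ v, v ∈ s(p.1, p.2) ∧ v ∈ e) → c p ≠ f e := by
      rintro p hp e he hne ⟨v, hv, hve⟩ heq
      have h1 := (Finset.mem_sdiff.1 (hc1 p hp)).2
      rw [heq, Finset.mem_union, not_or] at h1
      obtain ⟨x, rfl⟩ := hve
      rcases Sym2.mem_iff.1 hv with rfl | rfl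
      · refine h1.1 (Finset.mem_image.2 ⟨x, Finset.mem_filter.2 ⟨?_, fun h => hne _ h rfl⟩, rfl⟩)
        simpa using he
      · refine h1.2 (Finset.mem_image.2 ⟨x, Finset.mem_filter.2
          ⟨?_, fun h => hne _ h Sym2.eq_swap⟩, by rw [Sym2.eq_swap]⟩)
        simpa using he
    refine hLG f' ⟨fun e he => ?_, fun e₁ he₁ e₂ he₂ hne hv => ?_⟩
    · by_cases h : ∃ p ∈ F, s(p.1, p.2) = e
      · obtain ⟨p, hp, rfl⟩ := h
        rw [hf'F p hp]
        exact (Finset.mem_sdiff.1 (hc1 p hp)).1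
      · push Not at h
        rw [hf' e h]
        exact hf1 e (hdel e he h)
    · by_cases h₁ : ∃ p ∈ F, s(p.1, p.2) = e₁ <;> by_cases h₂ : ∃ p ∈ F, s(p.1, p.2) = e₂
      · obtain ⟨p, hp, rfl⟩ := h₁
        obtain ⟨q, hq, rfl⟩ := h₂
        rw [hf'F p hp, hf'F q hq]
        refine hc2 p hp q hq (fun h => hne (by rw [h])) ?_
        obtain ⟨v, hv1, hv2⟩ := hv
        rcases Sym2.mem_iff.1 hv1 with h1 | h1 <;> rcases Sym2.mem_iff.1 hv2 with h2 | h2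
        · exact Or.inl (h1.symm.trans h2)
        · exact absurd (h1.symm.trans h2) (hbip p hp q hq)
        · exact absurd (h2.symm.trans h1) (hbip q hq p hp)
        · exact Or.inr (h1.symm.trans h2)
      · obtain ⟨p, hp, rfl⟩ := h₁
        push Not at h₂
        rw [hf'F p hp, hf' e₂ h₂]
        exact hmixed p hp e₂ he₂ h₂ hv
      · obtain ⟨q, hq, rfl⟩ := h₂
        push Not at h₁
        rw [hf'F q hq, hf' e₁ h₁]
        obtain ⟨v, hv1, hv2⟩ := hv
        exact (hmixed q hq e₁ he₁ h₁ ⟨v, hv2, hv1⟩).symm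
      · push Not at h₁ h₂
        rw [hf' e₁ h₁, hf' e₂ h₂]
        exact hf2 e₁ (hdel e₁ he₁ h₁) e₂ (hdel e₂ he₂ h₂) hne hv

theorem ListEdgeCritical.add_two_le_degree_add_degree {V : Type*} [Fintype V] {G : SimpleGraph V}
    [DecidableRel G.Adj] {k : ℕ} (hG : ListEdgeCritical G k) {u v : V} (huv : G.Adj u v) :
    k + 2 ≤ G.degree u + G.degree v := by
  obtain ⟨L, hL, hnot⟩ := hG.exists_residual_lists {(u, v)} (Finset.singleton_nonempty _)
    (by simpa using huv) (by simpa using huv.ne)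
  by_contra! hlt
  have h := hL (u, v) (Finset.mem_singleton_self _)
  simp only [Finset.filter_singleton, if_true, Finset.card_singleton] at h
  obtain ⟨x, hx⟩ := Finset.card_pos.1 (show 0 < (L (u, v)).card by omega)
  exact hnot ⟨fun _ => x, by simpa using hx, by simp⟩

theorem stmt_14 {V : Type*} [Fintype V] (G : SimpleGraph V) [DecidableRel G.Adj]
    (Δ : ℕ) (hΔ : G.maxDegree = Δ) (hΔ8 : 8 ≤ Δ)
    (hcrit : ListEdgeCritical G (Δ + 1)) :
    2 * (Finset.univ.filter fun v : V => G.degree v = 3).card +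
        2 * (Finset.univ.filter fun v : V => G.degree v = 4).card +
        2 * (Finset.univ.filter fun v : V => G.degree v = 5).card <
      (Finset.univ.filter fun v : V => G.degree v = Δ - 2).card +
        2 * (Finset.univ.filter fun v : V => G.degree v = Δ - 1).card +
        3 * (Finset.univ.filter fun v : V => G.degree v = Δ).card := by
  set A := Finset.univ.filter fun v : V => 3 ≤ G.degree v ∧ G.degree v ≤ 5 with hA
  set B := Finset.univ.filter fun v : V => Δ - 2 ≤ G.degree v with hB
  have hdeg : ∀ v, G.degree v ≤ Δ := fun v => hΔ ▸ G.degree_le_maxDegree v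
  have hcardA : 2 * (Finset.univ.filter fun v : V => G.degree v = 3).card +
      2 * (Finset.univ.filter fun v : V => G.degree v = 4).card +
      2 * (Finset.univ.filter fun v : V => G.degree v = 5).card = 2 * A.card := by
    simp only [hA, Finset.card_filter, Finset.mul_sum, ← Finset.sum_add_distrib]
    refine Finset.sum_congr rfl fun v _ => ?_
    split_ifs <;> omega
  have hcardB : (Finset.univ.filter fun v : V => G.degree v = Δ - 2).card +
      2 * (Finset.univ.filter fun v : V => G.degree v = Δ - 1).card +
      3 * (Finset.univ.filter fun v : V => G.degree v = Δ).card =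
      ∑ v ∈ B, (3 - (Δ - G.degree v)) := by
    simp only [hB, Finset.card_filter, Finset.sum_filter, Finset.mul_sum,
      ← Finset.sum_add_distrib]
    refine Finset.sum_congr rfl fun v _ => ?_
    have := hdeg v
    split_ifs <;> omega
  rw [hcardA, hcardB]
  by_contra! hsum
  have hnbr : ∀ u ∈ A, ∀ w, G.Adj u w → w ∈ B := by
    intro u hu w huw
    have h1 := hcrit.add_two_le_degree_add_degree huw
    have h2 := (Finset.mem_filter.1 hu).2
    exact Finset.mem_filter.2 ⟨Finset.mem_univ _, by omega⟩
  have hnbrB : ∀ u ∈ A, B.filter (G.Adj u) = G.neighborFinset u := by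
    intro u hu
    ext w
    simpa using hnbr u hu w
  have hBne : B.Nonempty := by
    have : Nonempty V := by
      by_contra h
      rw [not_nonempty_iff] at h
      simp only [SimpleGraph.maxDegree_of_subsingleton] at hΔ
      omega
    obtain ⟨v, hv⟩ := G.exists_maximal_degree_vertex
    exact ⟨v, Finset.mem_filter.2 ⟨Finset.mem_univ _, by omega⟩⟩
  obtain ⟨B', hB'B, ⟨w₀, hw₀⟩, hB'⟩ := exists_subset_capacity_lt A B G.Adj
    (fun v => 3 - (Δ - G.degree v))
    (fun w hw => by
      have := (Finset.mem_filter.1 hw).2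
      omega)
    hBne
    (fun u hu => by
      rw [hnbrB u hu, G.card_neighborFinset_eq_degree]
      exact (Finset.mem_filter.1 hu).2.1)
    hsum
  let F : Finset (V × V) := (A ×ˢ B').filter fun p =>
    G.Adj p.1 p.2 ∧ ((B \ B').filter (G.Adj p.1)).card ≤ 1
  have hF : ∀ p ∈ F, p.1 ∈ A ∧ p.2 ∈ B' ∧ G.Adj p.1 p.2 ∧
      ((B \ B').filter (G.Adj p.1)).card ≤ 1 := fun p hp => by
    simpa [F, and_assoc] using hp
  have hleft : ∀ u ∈ A, ((B \ B').filter (G.Adj u)).card ≤ 1 →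
      (F.filter fun f => f.1 = u).card + ((B \ B').filter (G.Adj u)).card = G.degree u := by
    intro u hu hmiss
    have h1 : (F.filter fun f => f.1 = u) =
        (B'.filter (G.Adj u)).map ⟨_, Prod.mk_right_injective u⟩ := by
      ext ⟨x, w⟩
      simp only [F, Finset.mem_filter, Finset.mem_product, Finset.mem_map,
        Function.Embedding.coeFn_mk, Prod.mk.injEq]
      constructor
      · rintro ⟨⟨⟨-, hw⟩, hxw, -⟩, rfl⟩
        exact ⟨w, ⟨hw, hxw⟩, rfl, rfl⟩
      · rintro ⟨w, ⟨hw, huw⟩, rfl, rfl⟩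
        exact ⟨⟨⟨hu, hw⟩, huw, hmiss⟩, rfl⟩
    rw [h1, Finset.card_map, ← G.card_neighborFinset_eq_degree, ← hnbrB u hu, add_comm,
      ← Finset.card_union_of_disjoint
        (Finset.disjoint_filter_filter Finset.sdiff_disjoint), ← Finset.filter_union,
      Finset.sdiff_union_of_subset hB'B]
  have hright : ∀ w ∈ B', 4 ≤ (F.filter fun f => f.2 = w).card + (Δ - G.degree w) := by
    intro w hw
    have h1 : (F.filter fun f => f.2 = w) = (A.filter fun u => G.Adj u w ∧
        ((B \ B').filter (G.Adj u)).card ≤ 1).map ⟨_, Prod.mk_left_injective w⟩ := by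
      ext ⟨u, x⟩
      simp only [F, Finset.mem_filter, Finset.mem_product, Finset.mem_map,
        Function.Embedding.coeFn_mk, Prod.mk.injEq]
      constructor
      · rintro ⟨⟨⟨hu, -⟩, h⟩, rfl⟩
        exact ⟨u, ⟨hu, h⟩, rfl, rfl⟩
      · rintro ⟨u, ⟨hu, h⟩, rfl, rfl⟩
        exact ⟨⟨⟨hu, hw⟩, h⟩, rfl⟩
    have h2 := hB' w hw
    rw [h1, Finset.card_map]
    omega
  obtain ⟨L, hL, hnot⟩ := hcrit.exists_residual_lists F
    (by
      have h1 := hright w₀ hw₀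
      have h2 := (Finset.mem_filter.1 (hB'B hw₀)).2
      obtain ⟨p, hp⟩ := Finset.card_pos.1
        (show 0 < (F.filter fun f => f.2 = w₀).card by omega)
      exact ⟨p, (Finset.mem_filter.1 hp).1⟩)
    (fun p hp => (hF p hp).2.2.1)
    (fun p hp q hq h => by
      have h1 := (Finset.mem_filter.1 (hF p hp).1).2
      have h2 := (Finset.mem_filter.1 (hB'B (hF q hq).2.1)).2
      rw [← h] at h2
      omega)
  refine hnot (exists_bipartite_list_coloring F L 4
    (fun u => 1 - ((B \ B').filter (G.Adj u)).card)
    (fun w => (F.filter fun f => f.2 = w).card + (Δ - G.degree w)) (fun u => ?_)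
    (fun p _ => Nat.le_add_right _ _) (fun p hp => hright p.2 (hF p hp).2.1) (fun p hp => ?_))
  · rcases (F.filter fun f => f.1 = u).eq_empty_or_nonempty with h0 | ⟨p, hp⟩
    · simp [h0]
    · obtain ⟨hpF, rfl⟩ := Finset.mem_filter.1 hp
      obtain ⟨hpA, -, -, hmiss⟩ := hF p hpF
      have h1 := hleft p.1 hpA hmiss
      have h2 := (Finset.mem_filter.1 hpA).2
      omega
  · obtain ⟨hpA, -, -, hmiss⟩ := hF p hp
    have h1 := hleft p.1 hpA hmiss
    have h2 := hL p hp
    have h3 := hdeg p.2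
    omega
end
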